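/- There exist constants c > 0 and C > 1 depending only on n such that the following holds. Let u be a harmonic function on a sufficiently large neighborhood of the unit cube Q ⊂ ℝⁿ whose gradient has doubling index bounded above by N ≥ 1 on Q (i.e., log( sup_{B(x,2r)} |∇u| / sup_{B(x,r)} |∇u| ) ≤ N for all x ∈ Q and small r > 0). For any integer K ≥ 2, subdivide Q into Kⁿ congruent subcubes. Then the number of subcubes q for which inf_q |∇u| < c · sup_{2q} |∇u| is at most C^{N²} · K^{n-2}, where 2q denotes the cube concentric with q of twice the side length. -/

import Mathlib

open MeasureTheory Metric Set ENNReal Matrix RealInnerProductSpace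

/-- `sup` of `|∇u|` over a set. -/
noncomputable def supGrad {n : ℕ} (u : EuclideanSpace ℝ (Fin n) → ℝ)
    (s : Set (EuclideanSpace ℝ (Fin n))) : ℝ :=
  sSup ((fun x => ‖fderiv ℝ u x‖) '' s)

/-- `u` is harmonic on `U`: smooth on `U` and its Laplacian vanishes on `U`. -/
def IsHarmonicOn {n : ℕ} (u : EuclideanSpace ℝ (Fin n) → ℝ)
    (U : Set (EuclideanSpace ℝ (Fin n))) : Prop :=
  ContDiffOn ℝ (⊤ : ℕ∞) u U ∧
    ∀ x ∈ U, ∑ i : Fin n,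
      fderiv ℝ (fun y => fderiv ℝ u y (EuclideanSpace.single i 1)) x (EuclideanSpace.single i 1) = 0

/-- normalized doubling index of the gradient on `B(x,r)`:
`N(x,r) = log ( sup_{B(x,2r)} |∇u| / sup_{B(x,r)} |∇u| )`. -/
noncomputable def doublingIndex {n : ℕ} (u : EuclideanSpace ℝ (Fin n) → ℝ)
    (x : EuclideanSpace ℝ (Fin n)) (r : ℝ) : ℝ :=
  Real.log (supGrad u (ball x (2 * r)) / supGrad u (ball x r))

/-- the closed axis-parallel cube with center `c` and side length `ℓ` -/
def cube {n : ℕ} (c : EuclideanSpace ℝ (Fin n)) (ℓ : ℝ) : Set (EuclideanSpace ℝ (Fin n)) :=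
  {x | ∀ i, |x i - c i| ≤ ℓ / 2}

/-- maximal normalized doubling index of the cube of center `c` and side `ℓ`:
`N(Q) = sup_{x ∈ Q, 0 < r ≤ ℓ(Q)} log ( sup_{B(x,10nr)} |∇u| / sup_{B(x,r)} |∇u| )`. -/
noncomputable def cubeDoublingIndex {n : ℕ} (u : EuclideanSpace ℝ (Fin n) → ℝ)
    (c : EuclideanSpace ℝ (Fin n)) (ℓ : ℝ) : ℝ :=
  sSup {t | ∃ x ∈ cube c ℓ, ∃ r : ℝ, 0 < r ∧ r ≤ ℓ ∧
    t = Real.log (supGrad u (ball x (10 * n * r)) / supGrad u (ball x r))}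

/-- `s`-dimensional Hausdorff content -/
noncomputable def hausdorffContent {n : ℕ} (s : ℝ) (E : Set (EuclideanSpace ℝ (Fin n))) : ℝ≥0∞ :=
  ⨅ (U : ℕ → Set (EuclideanSpace ℝ (Fin n))) (_ : E ⊆ ⋃ i, U i), ∑' i, EMetric.diam (U i) ^ s

/-- Riesz `s`-energy of a measure: `I_s(μ) = ∬ |x-y|^{-s} dμ(x) dμ(y)`. -/
noncomputable def rieszEnergy {n : ℕ} (s : ℝ) (μ : Measure (EuclideanSpace ℝ (Fin n))) : ℝ≥0∞ :=
  ∫⁻ x, ∫⁻ y, edist x y ^ (-s) ∂μ ∂μ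

/-- Riesz `s`-capacity of a set: the sup of `I_s(μ)⁻¹` over probability measures compactly
supported in `E`. -/
noncomputable def rieszCapacity {n : ℕ} (s : ℝ) (E : Set (EuclideanSpace ℝ (Fin n))) : ℝ≥0∞ :=
  ⨆ (μ : Measure (EuclideanSpace ℝ (Fin n)))
    (_ : μ E = 1 ∧ ∃ K, IsCompact K ∧ K ⊆ E ∧ μ Kᶜ = 0), (rieszEnergy s μ)⁻¹

/-- a function `Fin n → ℝ` regarded as a point of `EuclideanSpace ℝ (Fin n)` -/
noncomputable def vec {n : ℕ} (f : Fin n → ℝ) : EuclideanSpace ℝ (Fin n) :=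
  (EuclideanSpace.equiv (Fin n) ℝ).symm f

/-- center of the subcube indexed by `k` when the cube of center `c` and side `ℓ` is divided
into `M^n` congruent subcubes -/
noncomputable def subCenter {n : ℕ} (c : EuclideanSpace ℝ (Fin n)) (ℓ : ℝ) (M : ℕ)
    (k : Fin n → Fin M) : EuclideanSpace ℝ (Fin n) :=
  vec (fun i => c i + (((k i : ℝ) + 1 / 2) / M - 1 / 2) * ℓ)

/-- the last coordinate index of `Fin n` -/
def lastIdx (n : ℕ) (hn : 0 < n) : Fin n := ⟨n - 1, Nat.sub_lt hn Nat.one_pos⟩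

/-- the hyperplane `{xₙ = 0}` -/
def lastHyperplane (n : ℕ) (hn : 0 < n) : Set (EuclideanSpace ℝ (Fin n)) :=
  {x | x (lastIdx n hn) = 0}

abbrev En (n : ℕ) := EuclideanSpace ℝ (Fin n)

/-- directional derivative -/
noncomputable def Dd {n : ℕ} {G : Type*} [NormedAddCommGroup G] [NormedSpace ℝ G]
    (v : En n) (f : En n → G) : En n → G := fun x => fderiv ℝ f x v

/-- smooth -/
def Sm {n : ℕ} {G : Type*} [NormedAddCommGroup G] [NormedSpace ℝ G] (f : En n → G) : Prop :=
  ContDiff ℝ (⊤ : ℕ∞) f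

/-- standard basis vector -/
noncomputable def eb {n : ℕ} (i : Fin n) : En n := EuclideanSpace.single i 1

/-- Laplace equation on a set -/
def Hm {n : ℕ} {G : Type*} [NormedAddCommGroup G] [NormedSpace ℝ G] (f : En n → G)
    (U : Set (En n)) : Prop := ∀ x ∈ U, ∑ i, Dd (eb i) (Dd (eb i) f) x = 0

/-- bundled complete real normed space -/
structure NS where
  α : Type
  [i1 : NormedAddCommGroup α]
  [i2 : NormedSpace ℝ α]
  [i3 : CompleteSpace α]

attribute [instance] NS.i1 NS.i2 NS.i3

/-- tower of targets of the iterated derivatives -/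
noncomputable def TT (n : ℕ) : ℕ → NS
  | 0 => ⟨ℝ⟩
  | k + 1 => ⟨En n →L[ℝ] (TT n k).α⟩

/-- iterated derivatives -/
noncomputable def DD {n : ℕ} (f : En n → ℝ) : (k : ℕ) → En n → (TT n k).α
  | 0 => f
  | k + 1 => fderiv ℝ (DD f k)

section A1
variable {n : ℕ} {G : Type*} [NormedAddCommGroup G] [NormedSpace ℝ G]
  {G' : Type*} [NormedAddCommGroup G'] [NormedSpace ℝ G']

theorem Sm_fderiv {f : En n → G} (h : Sm f) : Sm (fderiv ℝ f) :=
  ContDiff.fderiv_right (m := (⊤ : ℕ∞)) h (by simp)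

theorem Sm.diff {f : En n → G} (h : Sm f) : Differentiable ℝ f :=
  ContDiff.differentiable h (by simp)

theorem Sm.cont {f : En n → G} (h : Sm f) : Continuous f :=
  ContDiff.continuous h

theorem Sm.clm {f : En n → G} (h : Sm f) (L : G →L[ℝ] G') : Sm (fun x => L (f x)) :=
  L.contDiff.comp h

theorem Sm_Dd {f : En n → G} (h : Sm f) (v : En n) : Sm (Dd v f) :=
  (Sm_fderiv h).clm (ContinuousLinearMap.apply ℝ G v)

theorem Dd_clm {f : En n → G} (h : Sm f) (L : G →L[ℝ] G') (v : En n) :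
    Dd v (fun x => L (f x)) = fun x => L (Dd v f x) := by
  funext x
  have := (L.hasFDerivAt.comp x (h.diff x).hasFDerivAt).fderiv
  simp only [Dd]
  change (fderiv ℝ (L ∘ f) x) v = _
  rw [this]; rfl

theorem Dd_fderiv {f : En n → G} (h : Sm f) (v w : En n) (x : En n) :
    Dd v (Dd w f) x = fderiv ℝ (fderiv ℝ f) x v w := by
  have := Dd_clm (Sm_fderiv h) (ContinuousLinearMap.apply ℝ G w) v
  exact congrFun this x

theorem snd_symm {f : En n → G} (h : Sm f) (x v w : En n) :
    fderiv ℝ (fderiv ℝ f) x v w = fderiv ℝ (fderiv ℝ f) x w v := by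
  have h1 : ContDiffAt ℝ (⊤ : ℕ∞) f x := ContDiff.contDiffAt h
  have := h1.isSymmSndFDerivAt (by
    simp only [minSmoothness_of_isRCLikeNormedField]
    exact WithTop.coe_le_coe.2 (le_top : (2 : ℕ∞) ≤ ⊤))
  exact this v w

theorem Dd_comm {f : En n → G} (h : Sm f) (v w : En n) : Dd v (Dd w f) = Dd w (Dd v f) := by
  funext x
  rw [Dd_fderiv h, Dd_fderiv h, snd_symm h]

theorem Hm.clm {f : En n → G} {U : Set (En n)} (h : Sm f) (hf : Hm f U) (L : G →L[ℝ] G') :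
    Hm (fun x => L (f x)) U := by
  intro x hx
  have := hf x hx
  simp_rw [Dd_clm h L, Dd_clm (Sm_Dd h _) L]
  rw [← map_sum, this, map_zero]

theorem Hm_Dd {f : En n → G} {U : Set (En n)} (hU : IsOpen U) (h : Sm f) (hf : Hm f U)
    (v : En n) : Hm (Dd v f) U := by
  intro x hx
  have e : ∀ i : Fin n, Dd (eb i) (Dd (eb i) (Dd v f)) = Dd v (Dd (eb i) (Dd (eb i) f)) := by
    intro i
    rw [Dd_comm h, Dd_comm (Sm_Dd h _)]
  simp_rw [e]
  have : (fun y => ∑ i, Dd (eb i) (Dd (eb i) f) y) =ᶠ[nhds x] fun _ => 0 := by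
    filter_upwards [hU.mem_nhds hx] with y hy using hf y hy
  have h2 := this.fderiv_eq (𝕜 := ℝ)
  have h3 : fderiv ℝ (fun y => ∑ i, Dd (eb i) (Dd (eb i) f) y) x
      = ∑ i, fderiv ℝ (Dd (eb i) (Dd (eb i) f)) x := by
    rw [fderiv_fun_sum]
    intro i _
    exact ((Sm_Dd (Sm_Dd h _) _).diff x)
  rw [h3] at h2
  have := congrArg (fun L => L v) h2
  simp only [_root_.sum_apply] at this
  simpa [Dd] using this

theorem Hm_fderiv {f : En n → G} {U : Set (En n)} (hU : IsOpen U) (h : Sm f) (hf : Hm f U) :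
    Hm (fderiv ℝ f) U := by
  intro x hx
  ext1 v
  have h1 := Hm_Dd hU h hf v x hx
  have e : Dd v f = fun x => (ContinuousLinearMap.apply ℝ G v) (fderiv ℝ f x) := rfl
  rw [e] at h1
  simp_rw [Dd_clm (Sm_fderiv h), Dd_clm (Sm_Dd (Sm_fderiv h) _)] at h1
  rw [← map_sum] at h1
  exact h1

theorem Sm_DD {f : En n → ℝ} (h : Sm f) (k : ℕ) : Sm (DD f k) := by
  induction k with
  | zero => exact h
  | succ k ih => exact Sm_fderiv ih

theorem Hm_DD {f : En n → ℝ} {U : Set (En n)} (hU : IsOpen U) (h : Sm f) (hf : Hm f U)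
    (k : ℕ) : Hm (DD f k) U := by
  induction k with
  | zero => exact hf
  | succ k ih => exact Hm_fderiv hU (Sm_DD h k) ih

theorem fderiv_Dd {f : En n → G} (h : Sm f) (p : En n) :
    fderiv ℝ (Dd p f) = Dd p (fderiv ℝ f) := by
  funext x
  ext1 v
  have h1 := Dd_fderiv h v p x
  have h2 := snd_symm h x v p
  simp only [Dd] at h1 ⊢
  rw [h1, h2]

theorem DD_Dd {f : En n → ℝ} (h : Sm f) (k : ℕ) (p : En n) :
    DD (Dd p f) k = Dd p (DD f k) := by
  induction k with
  | zero => rfl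
  | succ k ih =>
    have : DD (Dd p f) (k+1) = fderiv ℝ (DD (Dd p f) k) := rfl
    rw [this, ih, fderiv_Dd (Sm_DD h k)]
    rfl

theorem norm_DD_Dd_le {f : En n → ℝ} (h : Sm f) (k : ℕ) (p x : En n) :
    ‖DD (Dd p f) k x‖ ≤ ‖DD f (k + 1) x‖ * ‖p‖ := by
  rw [DD_Dd h]
  exact ContinuousLinearMap.le_opNorm (fderiv ℝ (DD f k) x) _

end A1

/-- profile -/
noncomputable def etaF (σ : ℝ) : ℝ := Real.smoothTransition (1 - σ)
/-- bump -/
noncomputable def Phi {n : ℕ} (y : En n) : ℝ := etaF (‖y‖ ^ 2)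
/-- kernel -/
noncomputable def Psi {n : ℕ} (y : En n) : ℝ := 2 * deriv etaF (‖y‖ ^ 2)

section A2
variable {n : ℕ} {G : Type*} [NormedAddCommGroup G] [NormedSpace ℝ G]

theorem etaF_smooth : ContDiff ℝ (⊤ : ℕ∞) etaF :=
  Real.smoothTransition.contDiff.comp (contDiff_const.sub contDiff_id)

theorem Phi_smooth : Sm (Phi (n := n)) :=
  ContDiff.comp etaF_smooth (contDiff_norm_sq ℝ)

theorem Psi_smooth : Sm (Psi (n := n)) := by
  have h : ContDiff ℝ (⊤ : ℕ∞) (deriv etaF) := by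
    have := (contDiff_infty_iff_deriv (𝕜 := ℝ) (f := etaF)).1 etaF_smooth
    exact this.2
  exact contDiff_const.mul (ContDiff.comp h (contDiff_norm_sq ℝ))

theorem Phi_zero {y : En n} (h : 1 ≤ ‖y‖) : Phi y = 0 := by
  unfold Phi etaF
  apply Real.smoothTransition.zero_of_nonpos
  nlinarith

theorem Psi_zero {y : En n} (h : 1 < ‖y‖) : Psi y = 0 := by
  unfold Psi
  have : etaF =ᶠ[nhds (‖y‖^2)] fun _ => 0 := by
    have h1 : (1:ℝ) < ‖y‖^2 := by nlinarith
    filter_upwards [lt_mem_nhds h1] with z hz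
    unfold etaF
    apply Real.smoothTransition.zero_of_nonpos
    linarith
  rw [this.deriv_eq]; simp

theorem cs_of_zero {E : Type*} [Zero E] {f : En n → E} (h : ∀ y, 1 < ‖y‖ → f y = 0) :
    HasCompactSupport f := by
  apply HasCompactSupport.intro (isCompact_closedBall (0 : En n) 1)
  intro x hx
  apply h
  simpa using hx

theorem Phi_cs : HasCompactSupport (Phi (n := n)) := cs_of_zero fun _ h => Phi_zero h.le
theorem Psi_cs : HasCompactSupport (Psi (n := n)) := cs_of_zero fun _ h => Psi_zero h

theorem Phi_fderiv (y v : En n) : fderiv ℝ Phi y v = Psi y * inner ℝ y v := by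
  have h1 : HasDerivAt etaF (deriv etaF (‖y‖^2)) (‖y‖^2) :=
    ((etaF_smooth.differentiable (by simp)) _).hasDerivAt
  have h2 := (hasStrictFDerivAt_norm_sq y).hasFDerivAt
  have h3 := h1.comp_hasFDerivAt y h2
  have h4 : fderiv ℝ Phi y = deriv etaF (‖y‖^2) • (2 • innerSL ℝ y) := h3.fderiv
  rw [h4]
  simp [Psi]; ring

theorem etaF_deriv_nonpos (σ : ℝ) : deriv etaF σ ≤ 0 := by
  apply Antitone.deriv_nonpos
  intro a b h
  exact Real.smoothTransition.monotone (by linarith)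

theorem Psi_int_neg (hn : 0 < n) : ∫ y : En n, Psi y < 0 := by
  have : ∃ c ∈ Set.Ioo (0:ℝ) 1, deriv etaF c = (etaF 1 - etaF 0) / (1 - 0) :=
    exists_deriv_eq_slope _ (by norm_num) etaF_smooth.continuous.continuousOn
      (etaF_smooth.differentiable (by simp)).differentiableOn
  obtain ⟨c, hc, hd⟩ := this
  have e1 : etaF 1 = 0 := by simp [etaF]
  have e0 : etaF 0 = 1 := by simp [etaF]
  have h := Continuous.integral_pos_of_hasCompactSupport_nonneg_nonzero (μ := volume)
    (f := fun y : En n => - Psi y) (x := EuclideanSpace.single ⟨0, hn⟩ (Real.sqrt c))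
    (Psi_smooth.cont.neg) (cs_of_zero fun _ h => by simp [Psi_zero h])
    (fun y => by simp only [Psi, Pi.zero_apply]; have := etaF_deriv_nonpos (‖y‖^2); linarith)
    (by
      simp only [Psi, PiLp.norm_single, Real.norm_eq_abs, sq_abs, Real.sq_sqrt hc.1.le,
        hd, e1, e0]
      norm_num)
  rw [integral_neg] at h
  linarith

theorem Sm_line {w : En n → G} (hw : Sm w) (x : En n) (t : ℝ) : Sm (fun y => w (x + t • y)) :=
  ContDiff.comp hw (by fun_prop)

theorem fderiv_line {w : En n → G} (hw : Sm w) (x : En n) (t : ℝ) (y v : En n) :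
    fderiv ℝ (fun y => w (x + t • y)) y v = t • fderiv ℝ w (x + t • y) v := by
  have h1 : HasFDerivAt (fun y : En n => x + t • y) (t • ContinuousLinearMap.id ℝ (En n)) y :=
    ((hasFDerivAt_id y).const_smul t).const_add x
  have h2 := (hw.diff (x + t • y)).hasFDerivAt.comp y h1
  have h3 : fderiv ℝ (fun y => w (x + t • y)) y = _ := h2.fderiv
  rw [h3]; simp

theorem int_smul_cs {f : En n → ℝ} {g : En n → G} (hf : Continuous f) (hg : Continuous g)
    (h : ∀ y, 1 < ‖y‖ → f y = 0) : Integrable (fun y => f y • g y) := by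
  apply Continuous.integrable_of_hasCompactSupport (hf.smul hg)
  apply cs_of_zero
  intro y hy; simp [h y hy]

theorem fderiv_zero_out {f : En n → ℝ} (h : ∀ y, 1 < ‖y‖ → f y = 0) (y v : En n)
    (hy : 1 < ‖y‖) : fderiv ℝ f y v = 0 := by
  have : f =ᶠ[nhds y] fun _ => 0 := by
    have : IsOpen {z : En n | 1 < ‖z‖} := isOpen_lt continuous_const continuous_norm
    filter_upwards [this.mem_nhds hy] with z hz using h z hz
  rw [this.fderiv_eq]; simp

theorem ibp {f : En n → ℝ} {g : En n → G} (hf : Sm f) (hg : Sm g)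
    (h : ∀ y, 1 < ‖y‖ → f y = 0) (v : En n) :
    ∫ y, f y • fderiv ℝ g y v = - ∫ y, fderiv ℝ f y v • g y := by
  apply integral_smul_fderiv_eq_neg_fderiv_smul_of_integrable
  · exact int_smul_cs (Sm_Dd hf v).cont hg.cont (fun y hy => fderiv_zero_out h y v hy)
  · exact int_smul_cs hf.cont (Sm_Dd hg v).cont h
  · exact int_smul_cs hf.cont hg.cont h
  · intro x _; exact hf.diff x
  · intro x _; exact hg.diff x

theorem sum_eb (y : En n) : y = ∑ i, (inner ℝ y (eb i) : ℝ) • eb i := by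
  ext j
  simp [eb, EuclideanSpace.inner_single_right]
  simp [Finset.sum_apply, Pi.single_apply]

theorem mv_deriv {w : En n → G} (hw : Sm w) (x : En n) (t : ℝ) :
    HasDerivAt (fun t : ℝ => ∫ y : En n, Psi y • w (x + t • y))
      (∫ y : En n, Psi y • fderiv ℝ w (x + t • y) y) t := by
  obtain ⟨C, hC⟩ := (isCompact_closedBall x (|t| + 1)).exists_bound_of_continuousOn
    (Sm_fderiv hw).cont.continuousOn
  refine (hasDerivAt_integral_of_dominated_loc_of_deriv_le (𝕜 := ℝ) (s := ball t 1)
    (F := fun t y => Psi y • w (x + t • y))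
    (F' := fun t y => Psi y • fderiv ℝ w (x + t • y) y)
    (bound := fun y => ‖Psi y‖ * C) (ball_mem_nhds t one_pos) ?_ ?_ ?_ ?_ ?_ ?_).2
  · refine Filter.Eventually.of_forall fun t => ?_
    exact (int_smul_cs Psi_smooth.cont (Sm_line hw x t).cont
      (fun y hy => Psi_zero hy)).aestronglyMeasurable
  · exact (int_smul_cs Psi_smooth.cont (Sm_line hw x t).cont (fun y hy => Psi_zero hy))
  · have : Continuous fun y => fderiv ℝ w (x + t • y) y := 
      ((Sm_fderiv hw).cont.comp (by fun_prop)).clm_apply continuous_id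
    exact (int_smul_cs Psi_smooth.cont this (fun y hy => Psi_zero hy)).aestronglyMeasurable
  · refine Filter.Eventually.of_forall fun y s hs => ?_
    rw [norm_smul]
    by_cases hy : 1 < ‖y‖
    · rw [Psi_zero hy]; simp
    push Not at hy
    gcongr
    have hs' : |s| ≤ |t| + 1 := by
      have : |s - t| < 1 := by simpa [Real.dist_eq] using hs
      have := abs_sub_abs_le_abs_sub s t
      linarith
    have hm : x + s • y ∈ closedBall x (|t| + 1) := by
      rw [mem_closedBall, dist_eq_norm]
      simp only [add_sub_cancel_left, norm_smul, Real.norm_eq_abs]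
      have : |s| * ‖y‖ ≤ |s| * 1 := by gcongr
      linarith
    have h1 := hC _ hm
    have := (fderiv ℝ w (x + s • y)).le_opNorm y
    have : ‖fderiv ℝ w (x + s • y)‖ * ‖y‖ ≤ ‖fderiv ℝ w (x + s • y)‖ * 1 := by gcongr
    linarith
  · exact (Continuous.integrable_of_hasCompactSupport (by
      exact Psi_smooth.cont.norm.mul continuous_const)
      (cs_of_zero fun y hy => by simp [Psi_zero hy]))
  · refine Filter.Eventually.of_forall fun y s hs => ?_
    have h1 : HasDerivAt (fun s : ℝ => x + s • y) y s := by
      simpa using ((hasDerivAt_id s).smul_const y).const_add x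
    have h2 := (hw.diff (x + s • y)).hasFDerivAt.comp_hasDerivAt s h1
    exact h2.const_smul (Psi y)

theorem mv_deriv_zero {w : En n → G} {U : Set (En n)} (hw : Sm w) (hh : Hm w U) (x : En n)
    {ρ : ℝ} (hU : closedBall x ρ ⊆ U) {t : ℝ} (ht : 0 ≤ t) (htρ : t ≤ ρ) :
    ∫ y : En n, Psi y • fderiv ℝ w (x + t • y) y = 0 := by
  have e1 : ∀ y : En n, Psi y • fderiv ℝ w (x + t • y) y
      = ∑ i, fderiv ℝ Phi y (eb i) • Dd (eb i) w (x + t • y) := by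
    intro y
    conv_lhs => rw [congrArg (fderiv ℝ w (x + t • y)) (sum_eb y)]
    rw [map_sum, Finset.smul_sum]
    refine Finset.sum_congr rfl fun i _ => ?_
    rw [map_smul, smul_smul, ← Phi_fderiv]; rfl
  simp_rw [e1]
  have hout : ∀ y : En n, 1 < ‖y‖ → Phi y = 0 := fun y h => Phi_zero h.le
  rw [integral_finsetSum]
  · have e2 : ∀ i : Fin n, ∫ y : En n, fderiv ℝ Phi y (eb i) • Dd (eb i) w (x + t • y)
        = - (t • ∫ y : En n, Phi y • Dd (eb i) (Dd (eb i) w) (x + t • y)) := by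
      intro i
      have := ibp (Phi_smooth (n := n)) (Sm_line (Sm_Dd hw (eb i)) x t) hout (eb i)
      simp_rw [fderiv_line (Sm_Dd hw (eb i))] at this
      rw [← integral_smul]
      rw [eq_neg_iff_add_eq_zero, add_comm, ← eq_neg_iff_add_eq_zero, ← this]
      congr 1; funext y
      rw [smul_comm]; rfl
    simp_rw [e2]
    rw [Finset.sum_neg_distrib, ← Finset.smul_sum, ← integral_finsetSum]
    · have : ∀ y : En n, ∑ i, Phi y • Dd (eb i) (Dd (eb i) w) (x + t • y) = 0 := by
        intro y
        rw [← Finset.smul_sum]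
        by_cases hy : 1 < ‖y‖
        · rw [hout y hy, zero_smul]
        push Not at hy
        rw [hh _ (hU ?_), smul_zero]
        rw [mem_closedBall, dist_eq_norm]
        simp only [add_sub_cancel_left, norm_smul, Real.norm_eq_abs, abs_of_nonneg ht]
        nlinarith [norm_nonneg y]
      simp [this]
    · intro i _
      exact int_smul_cs Phi_smooth.cont (Sm_line (Sm_Dd (Sm_Dd hw _) _) x t).cont hout
  · intro i _
    exact int_smul_cs (Sm_Dd Phi_smooth _).cont (Sm_line (Sm_Dd hw _) x t).cont
      (fun y hy => fderiv_zero_out hout y _ hy)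

theorem mean_value [CompleteSpace G] {w : En n → G} {U : Set (En n)} (hw : Sm w) (hh : Hm w U)
    (x : En n) {ρ : ℝ} (hρ : 0 ≤ ρ) (hU : closedBall x ρ ⊆ U) :
    ∫ y : En n, Psi y • w (x + ρ • y) = (∫ y : En n, Psi y) • w x := by
  have h := constant_of_has_deriv_right_zero (f := fun t : ℝ => ∫ y : En n, Psi y • w (x + t • y))
    (a := 0) (b := ρ) (fun t _ => (mv_deriv hw x t).continuousAt.continuousWithinAt)
    (fun t ht => by
      have h1 := (mv_deriv hw x t).hasDerivWithinAt (s := Set.Ici t)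
      rwa [mv_deriv_zero hw hh x hU ht.1 ht.2.le] at h1) ρ ⟨hρ, le_rfl⟩
  simp only [zero_smul, add_zero] at h
  rw [h, integral_smul_const]

/-- gradient estimate constant -/
noncomputable def CG (n : ℕ) : ℝ := (∫ y : En n, ‖fderiv ℝ Psi y‖) / |∫ y : En n, Psi y|

theorem CG_nonneg : 0 ≤ CG n := by
  unfold CG; positivity

theorem G1 [CompleteSpace G] (hn : 0 < n) {h : En n → G} {U : Set (En n)} (hUo : IsOpen U)
    (hs : Sm h) (hh : Hm h U) (x : En n) {ρ M : ℝ} (hρ : 0 < ρ) (hU : closedBall x ρ ⊆ U)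
    (hM : ∀ y ∈ closedBall x ρ, ‖h y‖ ≤ M) : ‖fderiv ℝ h x‖ ≤ CG n / ρ * M := by
  have hM0 : 0 ≤ M := (norm_nonneg _).trans (hM x (mem_closedBall_self hρ.le))
  have hI := Psi_int_neg hn
  apply ContinuousLinearMap.opNorm_le_bound _ (by have := CG_nonneg (n := n); positivity)
  intro e
  have h1 := mean_value (Sm_Dd hs e) (Hm_Dd hUo hs hh e) x hρ.le hU
  have hout : ∀ y : En n, 1 < ‖y‖ → Psi y = 0 := fun y h => Psi_zero h
  have h2 := ibp Psi_smooth (Sm_line hs x ρ) hout e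
  simp_rw [fderiv_line hs] at h2
  have h3 : ∫ y : En n, Psi y • ρ • fderiv ℝ h (x + ρ • y) e
      = ρ • ∫ y : En n, Psi y • Dd e h (x + ρ • y) := by
    rw [← integral_smul]
    congr 1; funext y; rw [smul_comm]; rfl
  rw [h3, h1] at h2
  have hint : Integrable (fun y : En n => ‖fderiv ℝ Psi y‖) := by
    apply Continuous.integrable_of_hasCompactSupport (Sm_fderiv Psi_smooth).cont.norm
    apply cs_of_zero
    intro y hy
    have : fderiv ℝ Psi y = 0 := by
      ext1 v; exact fderiv_zero_out hout y v hy
    simp [this]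
  have h4 : ‖∫ y : En n, fderiv ℝ Psi y e • h (x + ρ • y)‖
      ≤ ∫ y : En n, ‖fderiv ℝ Psi y‖ * (‖e‖ * M) := by
    apply norm_integral_le_of_norm_le (hint.mul_const _)
    refine Filter.Eventually.of_forall fun y => ?_
    by_cases hy : 1 < ‖y‖
    · rw [fderiv_zero_out hout y _ hy]; simp; positivity
    push Not at hy
    rw [norm_smul]
    have a1 := (fderiv ℝ Psi y).le_opNorm e
    have a2 : ‖h (x + ρ • y)‖ ≤ M := by
      apply hM
      rw [mem_closedBall, dist_eq_norm]
      simp only [add_sub_cancel_left, norm_smul, Real.norm_eq_abs, abs_of_pos hρ]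
      nlinarith [norm_nonneg y]
    calc _ ≤ (‖fderiv ℝ Psi y‖ * ‖e‖) * M := by gcongr
      _ = _ := by ring
  rw [integral_mul_const] at h4
  have h5 := congrArg norm h2
  rw [norm_neg, norm_smul, norm_smul, Real.norm_eq_abs, Real.norm_eq_abs, abs_of_pos hρ] at h5
  have h6 : ρ * (|∫ y : En n, Psi y| * ‖Dd e h x‖) ≤ (∫ y : En n, ‖fderiv ℝ Psi y‖) * (‖e‖ * M) :=
    h5 ▸ h4
  have hp : 0 < |∫ y : En n, Psi y| := abs_pos.2 hI.ne
  change ‖Dd e h x‖ ≤ _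
  unfold CG
  rw [div_div, div_mul_eq_mul_div, div_mul_eq_mul_div, le_div_iff₀ (by positivity)]
  nlinarith [h6]

end A2

/-- norm of the (k+1)-st derivative -/
noncomputable def bb {n : ℕ} (u : En n → ℝ) (k : ℕ) (x : En n) : ℝ := ‖DD u (k + 1) x‖

/-- gradient growth constant -/
noncomputable def CE (n : ℕ) : ℝ := CG n * Real.exp 1 + 1

section A3
variable {n : ℕ}

theorem bb_nonneg (u : En n → ℝ) (k : ℕ) (x : En n) : 0 ≤ bb u k x := norm_nonneg _

theorem CE_pos : 1 ≤ CE n := by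
  unfold CE; have := CG_nonneg (n := n); have := Real.exp_pos 1
  have : 0 ≤ CG n * Real.exp 1 := by positivity
  linarith

theorem G2 (hn : 0 < n) {u : En n → ℝ} {U : Set (En n)} (hUo : IsOpen U)
    (hs : Sm u) (hh : Hm u U) (y : En n) {R M : ℝ} (hR : 0 < R) (hU : closedBall y R ⊆ U)
    (hM : ∀ z ∈ closedBall y R, ‖fderiv ℝ u z‖ ≤ M) (k : ℕ) :
    bb u k y ≤ k.factorial * (CE n / R) ^ k * M := by
  have hC := CG_nonneg (n := n)
  have hM0 : 0 ≤ M := (norm_nonneg _).trans (hM y (mem_closedBall_self hR.le))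
  rcases Nat.eq_zero_or_pos k with rfl | hk
  · have := hM y (mem_closedBall_self hR.le)
    simp only [Nat.factorial_zero, Nat.cast_one, pow_zero, one_mul]
    exact this
  have hk' : (0:ℝ) < k := by exact_mod_cast hk
  have key : ∀ j : ℕ, j ≤ k → ∀ z ∈ closedBall y (R - j * (R / k)),
      bb u j z ≤ (CG n * k / R) ^ j * M := by
    intro j
    induction j with
    | zero =>
      intro _ z hz
      have := hM z (by simpa using hz)
      simp only [pow_zero, one_mul]
      exact this
    | succ j ih =>
      intro hj z hz
      have hsub : closedBall z (R / k) ⊆ closedBall y (R - j * (R / k)) := by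
        apply closedBall_subset_closedBall'
        rw [mem_closedBall] at hz
        push_cast at hz
        linarith
      have hsub2 : closedBall y (R - j * (R / k)) ⊆ closedBall y R :=
        closedBall_subset_closedBall (by have : 0 ≤ j * (R / k) := by positivity
                                         linarith)
      have := G1 hn hUo (Sm_DD hs (j+1)) (Hm_DD hUo hs hh (j+1)) z (ρ := R / k) (by positivity)
        ((hsub.trans hsub2).trans hU) (fun w hw => ih (by omega) w (hsub hw))
      calc bb u (j+1) z = ‖fderiv ℝ (DD u (j+1)) z‖ := rfl
        _ ≤ _ := this
        _ = _ := by rw [pow_succ]; field_simp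
  have h1 := key k le_rfl y (by simp; field_simp; simp)
  refine h1.trans ?_
  have h2 := Real.pow_div_factorial_le_exp (x := (k:ℝ)) (by positivity) k
  have h3 : (k:ℝ)^k ≤ k.factorial * Real.exp 1 ^ k := by
    rw [div_le_iff₀ (by positivity)] at h2
    rw [← Real.exp_nat_mul]; simp only [mul_one]; linarith
  have h4 : (CG n * k / R) ^ k ≤ k.factorial * (CE n / R) ^ k := by
    calc (CG n * k / R) ^ k = (CG n / R)^k * (k:ℝ)^k := by rw [← mul_pow]; ring_nf
      _ ≤ (CG n / R)^k * (k.factorial * Real.exp 1 ^ k) := by gcongr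
      _ = k.factorial * (CG n * Real.exp 1 / R)^k := by
        rw [show CG n * Real.exp 1 / R = CG n / R * Real.exp 1 by ring, mul_pow]; ring
      _ ≤ _ := by
        have : CG n * Real.exp 1 ≤ CE n := by unfold CE; linarith
        gcongr
  gcongr

/-- data: global smooth function with factorial bounds on a convex set -/
structure Good {n : ℕ} (u : En n → ℝ) (Ω : Set (En n)) (E M : ℝ) : Prop where
  sm : Sm u
  cv : Convex ℝ Ω
  hE : 1 ≤ E
  hM : 0 ≤ M
  bd : ∀ k : ℕ, ∀ y ∈ Ω, bb u k y ≤ k.factorial * E ^ k * M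

theorem taylor_aux {u : En n → ℝ} {Ω : Set (En n)} {E M : ℝ} (g : Good u Ω E M)
    {x y : En n} (hx : x ∈ Ω) (hy : y ∈ Ω) {r H : ℝ} (hr : 0 < r)
    (hxy : ‖y - x‖ < r) (hH : ∀ k, bb u k x * r ^ k ≤ H * k.factorial) (i : ℕ) :
    ∀ j : ℕ, ∀ σ ∈ Icc (0:ℝ) 1,
    ‖DD u (j + 1) (x + σ • (y - x)) - DD u (j + 1) x‖ ≤
      (H * j.factorial / r ^ j * ((1 - σ * ‖y - x‖ / r)⁻¹ ^ (j + 1) - 1)) +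
       (2 * (i + j).factorial * E ^ (i + j) * M) * ‖y - x‖ ^ i * σ ^ i / i.factorial := by
  have hH0 : 0 ≤ H := by
    have := hH 0; have := bb_nonneg u 0 x; simp at *; linarith
  set a := ‖y - x‖ with ha
  have ha0 : 0 ≤ a := norm_nonneg _
  have hseg : ∀ σ ∈ Icc (0:ℝ) 1, x + σ • (y - x) ∈ Ω := by
    intro σ hσ
    exact g.cv.add_smul_sub_mem hx hy hσ
  have hpos : ∀ σ ∈ Icc (0:ℝ) 1, 0 < 1 - σ * a / r := by
    intro σ hσ
    have : σ * a / r < 1 := by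
      rw [div_lt_one hr]; nlinarith [hσ.1, hσ.2]
    linarith
  have hone : ∀ σ ∈ Icc (0:ℝ) 1, 1 ≤ (1 - σ * a / r)⁻¹ := by
    intro σ hσ
    rw [one_le_inv₀ (hpos σ hσ)]
    have : 0 ≤ σ * a / r := by have := hσ.1; positivity
    linarith
  induction i with
  | zero =>
    intro j σ hσ
    have h1 := g.bd j x hx
    have h2 := g.bd j _ (hseg σ hσ)
    have h3 : 0 ≤ H * j.factorial / r ^ j * ((1 - σ * a / r)⁻¹ ^ (j + 1) - 1) := by
      have := one_le_pow₀ (hone σ hσ) (n := j+1)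
      apply mul_nonneg (by positivity); linarith
    have h4 := norm_sub_le (DD u (j + 1) (x + σ • (y - x))) (DD u (j + 1) x)
    simp only [bb] at h1 h2
    simp only [pow_zero, mul_one, Nat.factorial_zero, Nat.cast_one, div_one, zero_add]
    linarith
  | succ i ih =>
    intro j
    have hline : ∀ σ : ℝ, HasDerivAt (fun σ : ℝ => DD u (j+1) (x + σ • (y - x)))
        (fderiv ℝ (DD u (j+1)) (x + σ • (y - x)) (y - x)) σ := by
      intro σ
      have h1 : HasDerivAt (fun s : ℝ => x + s • (y - x)) (y - x) σ := by
        simpa using ((hasDerivAt_id σ).smul_const (y - x)).const_add x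
      exact ((Sm_DD g.sm (j+1)).diff (x + σ • (y - x))).hasFDerivAt.comp_hasDerivAt σ h1
    set e := 2 * ((i + (j+1)).factorial : ℝ) * E ^ (i + (j+1)) * M with he
    have hee : 2 * ((i + 1 + j).factorial : ℝ) * E ^ (i + 1 + j) * M = e := by
      rw [he, show i + 1 + j = i + (j+1) by ring]
    rw [hee]
    have hB : ∀ σ ∈ Icc (0:ℝ) 1, HasDerivAt (fun σ : ℝ => 
        (H * j.factorial / r ^ j * ((1 - σ * a / r)⁻¹ ^ (j + 1) - 1)) +
          e * a ^ (i+1) * σ ^ (i+1) / (i+1).factorial)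
        (a * (H * (j+1).factorial / r ^ (j+1) * (1 - σ * a / r)⁻¹ ^ (j + 1 + 1)) +
          a * (e * a ^ i * σ ^ i / i.factorial)) σ := by
      intro σ hσ
      have hp := hpos σ hσ
      have h1 : HasDerivAt (fun σ : ℝ => 1 - σ * a / r) (-(a / r)) σ := by
        have := (((hasDerivAt_id σ).mul_const a).div_const r).const_sub 1
        simpa using this
      have h2 := (((h1.inv hp.ne').pow (j+1)).sub_const 1).const_mul (H * j.factorial / r ^ j)
      have h3 := (((hasDerivAt_pow (i+1) σ).const_mul (e * a^(i+1))).div_const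
        ((i+1).factorial : ℝ))
      have h4 := h2.add h3
      refine h4.congr_deriv ?_
      simp only [Nat.factorial_succ, Nat.add_sub_cancel]
      push_cast
      have := hp.ne'
      set A := 1 - σ * a / r with hA
      have hi : (i.factorial : ℝ) ≠ 0 := by positivity
      have hi2 : (i : ℝ) + 1 ≠ 0 := by positivity
      simp only [Pi.inv_apply, ← hA]
      clear_value A
      rw [inv_pow, inv_pow]
      field_simp
      ring
    have := image_norm_le_of_norm_deriv_right_le_deriv_boundary' (a := 0) (b := 1)
      (f := fun σ : ℝ => DD u (j+1) (x + σ • (y - x)) - DD u (j+1) x)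
      (f' := fun σ : ℝ => fderiv ℝ (DD u (j+1)) (x + σ • (y - x)) (y - x))
      (fun σ _ => ((hline σ).sub_const _).continuousAt.continuousWithinAt)
      (fun σ _ => ((hline σ).sub_const _).hasDerivWithinAt)
      (B := fun σ : ℝ => 
        (H * j.factorial / r ^ j * ((1 - σ * a / r)⁻¹ ^ (j + 1) - 1)) +
          e * a ^ (i+1) * σ ^ (i+1) / (i+1).factorial)
      (B' := fun σ : ℝ => a * (H * (j+1).factorial / r ^ (j+1) * (1 - σ * a / r)⁻¹ ^ (j + 1 + 1)) +
          a * (e * a ^ i * σ ^ i / i.factorial)) (by simp)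
      (fun σ hσ => (hB σ hσ).continuousAt.continuousWithinAt)
      (fun σ hσ => (hB σ (Ico_subset_Icc_self hσ)).hasDerivWithinAt) (by
        intro σ hσ
        have h1 := ih (j+1) σ (Ico_subset_Icc_self hσ)
        have h2 : ‖DD u (j+1+1) (x + σ • (y - x))‖ ≤
            ‖DD u (j+1+1) (x + σ • (y - x)) - DD u (j+1+1) x‖ + bb u (j+1) x := by
          have := norm_add_le (DD u (j+1+1) (x + σ • (y - x)) - DD u (j+1+1) x) (DD u (j+1+1) x)
          simpa [bb] using this
        have h3 : bb u (j+1) x ≤ H * (j+1).factorial / r ^ (j+1) := by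
          rw [le_div_iff₀ (by positivity)]; exact hH _
        have h4 : ‖fderiv ℝ (DD u (j+1)) (x + σ • (y - x)) (y - x)‖ ≤
          ‖DD u (j+1+1) (x + σ • (y - x))‖ * a := ContinuousLinearMap.le_opNorm _ _
        refine h4.trans ?_
        rw [← mul_add, mul_comm]
        gcongr
        linarith)
    intro σ hσ
    exact this hσ

/-- Taylor majorant -/
theorem taylor {u : En n → ℝ} {Ω : Set (En n)} {E M : ℝ} (g : Good u Ω E M)
    {x y : En n} (hx : x ∈ Ω) (hy : y ∈ Ω) {r H : ℝ} (hr : 0 < r) (hrE : r * (2 * E) ≤ 1)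
    (hxy : ‖y - x‖ < r) (hH : ∀ k, bb u k x * r ^ k ≤ H * k.factorial) (j : ℕ) :
    ‖DD u (j + 1) y - DD u (j + 1) x‖ ≤
      (H * j.factorial / r ^ j * ((1 - ‖y - x‖ / r)⁻¹ ^ (j + 1) - 1)) := by
  have h := fun i => taylor_aux g hx hy hr hxy hH i j 1 (by simp)
  simp only [one_smul, add_sub_cancel, one_mul, one_pow, mul_one] at h
  set D := H * j.factorial / r ^ j * ((1 - ‖y - x‖ / r)⁻¹ ^ (j + 1) - 1)
  have hE := g.hE
  have hM := g.hM
  have hb : ∀ i : ℕ, 2 * ((i + j).factorial:ℝ) * E ^ (i + j) * M * ‖y - x‖ ^ i / i.factorial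
      ≤ 2 * M * E ^ j * 2 ^ j * (((i + j : ℕ) : ℝ) ^ j * (1/2) ^ (i + j)) := by
    intro i
    have h1 : ((i + j).factorial : ℝ) ≤ i.factorial * ((i + j : ℕ) : ℝ) ^ j := by
      rw [← Nat.factorial_mul_ascFactorial]
      have := Nat.ascFactorial_le_pow_add i j
      exact_mod_cast Nat.mul_le_mul_left _ this
    have h2 : (E * ‖y - x‖) ≤ 1/2 := by
      have : E * ‖y - x‖ ≤ E * r := by gcongr
      linarith
    rw [div_le_iff₀ (by positivity)]
    calc _ = 2 * M * E^j * ((i + j).factorial * (E * ‖y - x‖)^i) := by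
            rw [mul_pow, pow_add]; ring
      _ ≤ 2 * M * E^j * ((i.factorial * ((i + j : ℕ) : ℝ) ^ j) * (1/2)^i) := by gcongr
      _ = 2 * M * E^j * ((i.factorial * ((i + j : ℕ) : ℝ) ^ j) * (1/2)^i) * (2 * (1/2)) ^ j := by
          norm_num
      _ = _ := by rw [pow_add, mul_pow]; ring
  have hlim : Filter.Tendsto (fun i : ℕ => D + 2 * M * E ^ j * 2 ^ j *
      (((i + j : ℕ) : ℝ) ^ j * (1/2) ^ (i + j))) Filter.atTop (nhds (D + 2 * M * E ^ j * 2 ^ j * 0)) := by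
    have h0 := tendsto_pow_const_mul_const_pow_of_abs_lt_one j (r := (1/2 : ℝ))
      (by rw [abs_of_pos] <;> norm_num)
    have h1 := h0.comp (Filter.tendsto_add_atTop_nat j)
    exact (h1.const_mul _).const_add _
  rw [mul_zero, add_zero] at hlim
  refine ge_of_tendsto' hlim fun i => ?_
  exact (h i).trans (by have := hb i; linarith)

theorem taylor_le {u : En n → ℝ} {Ω : Set (En n)} {E M : ℝ} (g : Good u Ω E M)
    {x y : En n} (hx : x ∈ Ω) (hy : y ∈ Ω) {r H : ℝ} (hr : 0 < r) (hrE : r * (2 * E) ≤ 1)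
    (hxy : ‖y - x‖ < r) (hH : ∀ k, bb u k x * r ^ k ≤ H * k.factorial) (j : ℕ) :
    bb u j y ≤ H * j.factorial / r ^ j * (1 - ‖y - x‖ / r)⁻¹ ^ (j + 1) := by
  have h1 := taylor g hx hy hr hrE hxy hH j
  have h2 := norm_add_le (DD u (j+1) y - DD u (j+1) x) (DD u (j+1) x)
  have h3 : bb u j x ≤ H * j.factorial / r ^ j := by
    rw [le_div_iff₀ (by positivity)]; exact hH _
  rw [sub_add_cancel] at h2
  simp only [bb] at *
  linarith

end A3

section B1
variable {n : ℕ} {F : Type*} [NormedAddCommGroup F] [NormedSpace ℝ F]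

theorem LA_ext (K : Submodule ℝ (En n)) (L : En n →L[ℝ] F) {β A σ : ℝ}
    (hL : ‖L‖ ≤ β) (hA : 0 ≤ A) (hσ : 0 < σ) (hβ : 0 < β)
    (hK : ∀ v, ‖K.starProjection v‖ * β ≤ A * ‖L v‖)
    {w : En n} (hwK : w ∈ Kᗮ) (hw1 : ‖w‖ = 1) (hw : σ * β ≤ ‖L w‖) :
    ∃ f : En n, ‖f‖ = 1 ∧ f ∈ Kᗮ ∧
      Module.finrank ℝ ↥(K ⊔ (ℝ ∙ f)) = Module.finrank ℝ K + 1 ∧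
      (∀ v, (K ⊔ (ℝ ∙ f)).starProjection v = K.starProjection v + (inner ℝ f v : ℝ) • f) ∧
      (∀ v, ‖(K ⊔ (ℝ ∙ f)).starProjection v‖ * β ≤ (A + (1 + A) / σ) * ‖L v‖) := by
  have hLw : L w ≠ 0 := by
    intro h; rw [h, norm_zero] at hw; have : 0 < σ * β := by positivity
    linarith
  obtain ⟨φ, hφ1, hφ⟩ := exists_dual_vector ℝ (L w) (norm_ne_zero_iff.2 hLw)
  set g : En n := (InnerProductSpace.toDual ℝ (En n)).symm (φ.comp L) with hg
  have hgv : ∀ v, inner ℝ g v = φ (L v) := fun v => by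
    rw [hg, InnerProductSpace.toDual_symm_apply]; rfl
  set g' := g - K.starProjection g with hg'
  have hg'K : g' ∈ Kᗮ := K.sub_starProjection_mem_orthogonal g
  have hg'v : ∀ v, (inner ℝ g' v : ℝ) = φ (L v) - φ (L (K.starProjection v)) := fun v => by
    rw [hg', inner_sub_left, hgv, K.inner_starProjection_left_eq_right, hgv]
  have hφle : ∀ z, |φ z| ≤ ‖z‖ := fun z => by
    have := φ.le_opNorm z; rw [hφ1, one_mul] at this; exact this
  have hPw : K.starProjection w = 0 := (K.starProjection_apply_eq_zero_iff).2 hwK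
  have hgw : σ * β ≤ ‖g'‖ := by
    have h1 := hg'v w
    rw [hPw, map_zero, map_zero, sub_zero, hφ] at h1
    have h2 := real_inner_le_norm g' w
    rw [h1, hw1, mul_one] at h2
    exact hw.trans h2
  have hgp : 0 < ‖g'‖ := lt_of_lt_of_le (by positivity) hgw
  set f := ‖g'‖⁻¹ • g' with hf
  have hf1 : ‖f‖ = 1 := by
    rw [hf, norm_smul, norm_inv, norm_norm, inv_mul_cancel₀ hgp.ne']
  have hfK : f ∈ Kᗮ := Submodule.smul_mem _ _ hg'K
  have hfv : ∀ v, |(inner ℝ f v : ℝ)| * β ≤ (1 + A) / σ * ‖L v‖ := by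
    intro v
    have h1 : |(inner ℝ g' v : ℝ)| ≤ (1 + A) * ‖L v‖ := by
      rw [hg'v]
      have h2 := hφle (L v)
      have h3 := hφle (L (K.starProjection v))
      have h4 := L.le_opNorm (K.starProjection v)
      have h5 : ‖L‖ * ‖K.starProjection v‖ ≤ β * ‖K.starProjection v‖ := by gcongr
      have h6 := hK v
      have h7 := abs_sub (φ (L v)) (φ (L (K.starProjection v)))
      nlinarith
    rw [hf, real_inner_smul_left, abs_mul, abs_inv, abs_norm, inv_mul_eq_div, div_mul_eq_mul_div,
      div_mul_eq_mul_div, div_le_div_iff₀ hgp hσ]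
    have := abs_nonneg (inner ℝ g' v : ℝ)
    calc |(inner ℝ g' v : ℝ)| * β * σ = |(inner ℝ g' v : ℝ)| * (σ * β) := by ring
      _ ≤ ((1 + A) * ‖L v‖) * ‖g'‖ := by gcongr
  have hproj : ∀ v, (K ⊔ (ℝ ∙ f)).starProjection v = K.starProjection v + (inner ℝ f v : ℝ) • f := by
    intro v
    apply Submodule.eq_starProjection_of_mem_orthogonal
    · apply Submodule.add_mem
      · exact Submodule.mem_sup_left (K.starProjection_apply_mem v)
      · exact Submodule.mem_sup_right (Submodule.smul_mem _ _ (Submodule.mem_span_singleton_self f))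
    · rw [← Submodule.inf_orthogonal]
      refine ⟨?_, ?_⟩
      · rw [← sub_sub]
        exact Submodule.sub_mem _ (K.sub_starProjection_mem_orthogonal v) (Submodule.smul_mem _ _ hfK)
      · change _ ∈ (ℝ ∙ f)ᗮ
        rw [Submodule.mem_orthogonal_singleton_iff_inner_right, inner_sub_right, inner_add_right,
          real_inner_smul_right, real_inner_self_eq_norm_sq, hf1,
          Submodule.inner_left_of_mem_orthogonal (K.starProjection_apply_mem v) hfK]
        ring
  refine ⟨f, hf1, hfK, ?_, hproj, ?_⟩
  · have h1 := Submodule.finrank_sup_add_finrank_inf_eq K (ℝ ∙ f)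
    have hf0 : f ≠ 0 := by intro h; rw [h, norm_zero] at hf1; norm_num at hf1
    rw [finrank_span_singleton hf0] at h1
    have h2 : K ⊓ (ℝ ∙ f) = ⊥ := by
      have : (ℝ ∙ f) ≤ Kᗮ := by
        rw [Submodule.span_singleton_le_iff_mem]; exact hfK
      exact (Submodule.orthogonal_disjoint K).mono_right this |>.eq_bot
    rw [h2, finrank_bot] at h1
    omega
  · intro v
    rw [hproj]
    have h1 := norm_add_le (K.starProjection v) ((inner ℝ f v : ℝ) • f)
    rw [norm_smul, hf1, mul_one, Real.norm_eq_abs] at h1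
    have h2 := hK v
    have h3 := hfv v
    nlinarith

theorem ob_inner_sq (f : En n) : ∑ i, (inner ℝ f (eb i) : ℝ) ^ 2 = ‖f‖ ^ 2 := by
  simp [eb, EuclideanSpace.inner_single_right, EuclideanSpace.norm_sq_eq]

theorem ob_inner_mul (f g : En n) :
    ∑ i, (inner ℝ f (eb i) : ℝ) * (inner ℝ g (eb i) : ℝ) = inner ℝ f g := by
  simp only [eb, PiLp.inner_apply]
  simp [mul_comm]

theorem norm_eb (i : Fin n) : ‖(eb i : En n)‖ = 1 := by simp [eb]

theorem tr_bound (B : En n →L[ℝ] En n →L[ℝ] F) (hs : ∀ v w, B v w = B w v)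
    (ht : ∑ i, B (eb i) (eb i) = 0) (K : Submodule ℝ (En n)) {η : ℝ} (hη : 0 ≤ η)
    (hp : ∀ p ∈ Kᗮ, ‖B p‖ ≤ η * ‖p‖) :
    ‖∑ i, B (K.starProjection (eb i)) (K.starProjection (eb i))‖ ≤ 3 * n * η := by
  have h1 : ∀ i : Fin n, B (K.starProjection (eb i)) (K.starProjection (eb i))
      = B (eb i) (eb i) - B (eb i - K.starProjection (eb i)) (eb i + K.starProjection (eb i)) := by
    intro i
    simp only [map_sub, map_add, _root_.sub_apply]
    rw [hs (K.starProjection (eb i)) (eb i)]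
    abel
  simp_rw [h1]
  rw [Finset.sum_sub_distrib, ht, zero_sub, norm_neg]
  refine (norm_sum_le_of_le _ (f := fun i : Fin n => B (eb i - K.starProjection (eb i)) (eb i + K.starProjection (eb i))) (n := fun _ => 3 * η) ?_).trans ?_
  · intro i _
    set q := (eb i : En n) - K.starProjection (eb i) with hq
    have hq1 : q ∈ Kᗮ := K.sub_starProjection_mem_orthogonal _
    have hPn : ‖K.starProjection (eb i : En n)‖ ≤ 1 := by
      have := K.norm_starProjection_apply_le (eb i : En n); rwa [norm_eb] at this
    have hqn : ‖q‖ ≤ 1 := by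
      have := Kᗮ.norm_starProjection_apply_le (eb i : En n)
      rw [norm_eb, Submodule.starProjection_orthogonal_val] at this
      exact this
    have e : (eb i : En n) + K.starProjection (eb i) = q + (2:ℝ) • K.starProjection (eb i) := by
      rw [hq, two_smul]; abel
    have h3 : ‖(eb i : En n) + K.starProjection (eb i)‖ ≤ 3 := by
      rw [e]
      have := norm_add_le q ((2:ℝ) • K.starProjection (eb i))
      rw [norm_smul, Real.norm_eq_abs, abs_of_pos (by norm_num : (0:ℝ) < 2)] at this
      linarith
    have h4 := (B q).le_opNorm ((eb i : En n) + K.starProjection (eb i))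
    have h5 := hp q hq1
    have h6 : ‖B q‖ ≤ η := h5.trans (by nlinarith)
    calc _ ≤ _ := h4
      _ ≤ η * 3 := by gcongr
      _ = _ := by ring
  · simp; linarith


theorem B_split (B : En n →L[ℝ] En n →L[ℝ] F) (K : Submodule ℝ (En n)) (v : En n) :
    ‖B v‖ ≤ ‖B (K.starProjection v)‖ + ‖B (v - K.starProjection v)‖ := by
  have := norm_add_le (B (K.starProjection v)) (B (v - K.starProjection v))
  rwa [← map_add, add_sub_cancel] at this

theorem norm_perp_le (K : Submodule ℝ (En n)) (v : En n) : ‖v - K.starProjection v‖ ≤ ‖v‖ := by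
  have := Kᗮ.norm_starProjection_apply_le v
  rwa [Submodule.starProjection_orthogonal_val] at this

theorem LA_codim1 (B : En n →L[ℝ] En n →L[ℝ] F) (hs : ∀ v w, B v w = B w v)
    (ht : ∑ i, B (eb i) (eb i) = 0) (K : Submodule ℝ (En n)) {f : En n} (hf : ‖f‖ = 1)
    (hK : ∀ v, K.starProjection v = (inner ℝ f v : ℝ) • f) {η : ℝ} (hη : 0 ≤ η)
    (hp : ∀ p ∈ Kᗮ, ‖B p‖ ≤ η * ‖p‖) : ‖B‖ ≤ (3 * n + 2) * η := by
  have h1 := tr_bound B hs ht K hη hp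
  have h2 : ∑ i, B (K.starProjection (eb i)) (K.starProjection (eb i)) = B f f := by
    simp only [hK, map_smul, _root_.smul_apply, smul_smul]
    rw [← Finset.sum_smul]
    have := ob_inner_mul f f
    rw [this, real_inner_self_eq_norm_sq, hf]; simp
  rw [h2] at h1
  have hin : ∀ v, |(inner ℝ f v : ℝ)| ≤ ‖v‖ := fun v => by
    have := abs_real_inner_le_norm f v; rwa [hf, one_mul] at this
  have hpv : ∀ v, ‖B (v - K.starProjection v)‖ ≤ η * ‖v‖ := fun v => by
    refine (hp _ (K.sub_starProjection_mem_orthogonal v)).trans ?_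
    have := norm_perp_le K v
    gcongr
  have h3 : ‖B f‖ ≤ (3 * n + 1) * η := by
    apply ContinuousLinearMap.opNorm_le_bound _ (by positivity)
    intro v
    have e : B f v = (inner ℝ f v : ℝ) • B f f + B (v - K.starProjection v) f := by
      rw [hs (v - K.starProjection v) f, map_sub, hK, map_smul]; abel
    rw [e]
    have a1 := norm_add_le ((inner ℝ f v : ℝ) • B f f) (B (v - K.starProjection v) f)
    rw [norm_smul, Real.norm_eq_abs] at a1
    have a2 := (B (v - K.starProjection v)).le_opNorm f
    rw [hf, mul_one] at a2
    have a3 := hpv v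
    have a4 : |(inner ℝ f v : ℝ)| * ‖B f f‖ ≤ ‖v‖ * (3 * n * η) := by
      have := hin v; gcongr
    nlinarith
  apply ContinuousLinearMap.opNorm_le_bound _ (by positivity)
  intro v
  have a1 := B_split B K v
  have a2 := hpv v
  rw [hK, map_smul, norm_smul, Real.norm_eq_abs, ← hK] at a1
  have a4 : |(inner ℝ f v : ℝ)| * ‖B f‖ ≤ ‖v‖ * ((3 * n + 1) * η) := by
    have := hin v; gcongr
  nlinarith

theorem LA1 (B : En n →L[ℝ] En n →L[ℝ] F) (hs : ∀ v w, B v w = B w v)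
    (ht : ∑ i, B (eb i) (eb i) = 0) (K : Submodule ℝ (En n)) {f g : En n} (hf : ‖f‖ = 1)
    (hg : ‖g‖ = 1) (hfg : inner ℝ f g = (0:ℝ))
    (hK : ∀ v, K.starProjection v = (inner ℝ f v : ℝ) • f + (inner ℝ g v : ℝ) • g)
    {η : ℝ} (hη : 0 ≤ η)
    (hp : ∀ p ∈ Kᗮ, ‖B p‖ ≤ η * ‖p‖) {w : En n} (hw : ‖w‖ ≤ 1)
    (hw2 : 1 / 4 ≤ (inner ℝ f w : ℝ) ^ 2 + (inner ℝ g w : ℝ) ^ 2) :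
    ‖B‖ ≤ 38 * (‖B w‖ + (3 * n + 1) * η) := by
  have h1 := tr_bound B hs ht K hη hp
  have h2 : ∑ i, B (K.starProjection (eb i)) (K.starProjection (eb i)) = B f f + B g g := by
    have e : ∀ i : Fin n, B (K.starProjection (eb i)) (K.starProjection (eb i)) =
        ((inner ℝ f (eb i) : ℝ) * (inner ℝ f (eb i) : ℝ)) • B f f +
        ((inner ℝ g (eb i) : ℝ) * (inner ℝ g (eb i) : ℝ)) • B g g +
        (2 * ((inner ℝ f (eb i) : ℝ) * (inner ℝ g (eb i) : ℝ))) • B f g := by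
      intro i
      simp only [hK, map_add, map_smul, _root_.smul_apply, _root_.add_apply, smul_smul, smul_add]
      rw [hs g f, two_mul, add_smul, mul_comm (inner ℝ g (eb i) : ℝ) (inner ℝ f (eb i) : ℝ)]
      abel
    simp only [e, Finset.sum_add_distrib]
    rw [← Finset.sum_smul, ← Finset.sum_smul, ← Finset.sum_smul, ← Finset.mul_sum, ob_inner_mul,
      ob_inner_mul, ob_inner_mul, hfg, real_inner_self_eq_norm_sq, real_inner_self_eq_norm_sq,
      hf, hg]
    simp
  rw [h2] at h1
  have hin : ∀ v, |(inner ℝ f v : ℝ)| ≤ ‖v‖ := fun v => by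
    have := abs_real_inner_le_norm f v; rwa [hf, one_mul] at this
  have hig : ∀ v, |(inner ℝ g v : ℝ)| ≤ ‖v‖ := fun v => by
    have := abs_real_inner_le_norm g v; rwa [hg, one_mul] at this
  have hpv : ∀ v, ‖B (v - K.starProjection v)‖ ≤ η * ‖v‖ := fun v => by
    refine (hp _ (K.sub_starProjection_mem_orthogonal v)).trans ?_
    have := norm_perp_le K v
    gcongr
  set α := (inner ℝ f w : ℝ) with hα
  set γ := (inner ℝ g w : ℝ) with hγ
  have hα1 : |α| ≤ 1 := (hin w).trans hw
  have hγ1 : |γ| ≤ 1 := (hig w).trans hw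
  set S := ‖B w‖ + (3 * n + 1) * η with hS
  have hS0 : 0 ≤ S := by positivity
  have hηS : η ≤ S := by
    have : 0 ≤ ‖B w‖ := norm_nonneg _
    have : 0 ≤ 3 * (n:ℝ) * η := by positivity
    rw [hS]; linarith
  have hnS : 3 * n * η ≤ S := by
    have : 0 ≤ ‖B w‖ := norm_nonneg _
    rw [hS]; linarith
  have hexp : ∀ v z, B z v = (inner ℝ f v : ℝ) • B z f + (inner ℝ g v : ℝ) • B z g
      + B (v - K.starProjection v) z := by
    intro v z
    rw [hs (v - K.starProjection v) z, map_sub, hK, map_add, map_smul, map_smul]; abel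
  have hw0 : ‖B (w - K.starProjection w)‖ ≤ η := (hpv w).trans (by nlinarith)
  have hBwz : ∀ z : En n, ‖z‖ = 1 → ‖B (w - K.starProjection w) z‖ ≤ η := fun z hz => by
    have := (B (w - K.starProjection w)).le_opNorm z
    rw [hz, mul_one] at this; exact this.trans hw0
  have hBw : ∀ z : En n, ‖z‖ = 1 → ‖B z w‖ ≤ ‖B w‖ := fun z hz => by
    have := (B w).le_opNorm z
    rw [hz, mul_one] at this; rwa [hs z w]
  set X := α • B f f + γ • B f g with hX
  set Y := α • B f g - γ • B f f with hY
  have hXn : ‖X‖ ≤ S := by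
    have e : X = B f w - B (w - K.starProjection w) f := by
      rw [hexp w f, hX]; abel
    rw [e]
    have := norm_sub_le (B f w) (B (w - K.starProjection w) f)
    have := hBw f hf; have := hBwz f hf
    have : 0 ≤ 3 * (n:ℝ) * η := by positivity
    rw [hS]; linarith
  have hYn : ‖Y‖ ≤ S := by
    have e : Y = B g w - B (w - K.starProjection w) g - γ • (B f f + B g g) := by
      rw [hexp w g, hY, hs g f, smul_add]; abel
    rw [e]
    have := norm_sub_le (B g w - B (w - K.starProjection w) g) (γ • (B f f + B g g))
    have := norm_sub_le (B g w) (B (w - K.starProjection w) g)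
    have := hBw g hg; have := hBwz g hg
    have : ‖γ • (B f f + B g g)‖ ≤ 1 * (3 * n * η) := by
      rw [norm_smul, Real.norm_eq_abs]; gcongr
    rw [hS]; linarith
  have hlin : ∀ (a b : ℝ) (P Q : F), |a| ≤ 1 → |b| ≤ 1 → ‖P‖ ≤ S → ‖Q‖ ≤ S →
      ‖a • P + b • Q‖ ≤ 2 * S := by
    intro a b P Q ha hb hP hQ
    have h1 := norm_add_le (a • P) (b • Q)
    rw [norm_smul, norm_smul, Real.norm_eq_abs, Real.norm_eq_abs] at h1
    have h2 : |a| * ‖P‖ ≤ 1 * S := by gcongr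
    have h3 : |b| * ‖Q‖ ≤ 1 * S := by gcongr
    linarith
  have hquart : ∀ P : F, ‖(α ^ 2 + γ ^ 2) • P‖ ≤ 2 * S → ‖P‖ ≤ 8 * S := by
    intro P hP
    rw [norm_smul, Real.norm_eq_abs, abs_of_nonneg (by positivity)] at hP
    have : 1 / 4 * ‖P‖ ≤ (α ^ 2 + γ ^ 2) * ‖P‖ := by gcongr
    linarith
  have h11 : ‖B f f‖ ≤ 8 * S := by
    apply hquart
    have e : (α ^ 2 + γ ^ 2) • B f f = α • X + (-γ) • Y := by
      rw [hX, hY]; module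
    rw [e]
    exact hlin _ _ _ _ hα1 (by rwa [abs_neg]) hXn hYn
  have h12 : ‖B f g‖ ≤ 8 * S := by
    apply hquart
    have e : (α ^ 2 + γ ^ 2) • B f g = γ • X + α • Y := by
      rw [hX, hY]; module
    rw [e]
    exact hlin _ _ _ _ hγ1 hα1 hXn hYn
  have h22 : ‖B g g‖ ≤ 9 * S := by
    have e : B g g = (B f f + B g g) - B f f := by abel
    rw [e]
    have := norm_sub_le (B f f + B g g) (B f f)
    linarith
  have hBz : ∀ z : En n, ‖z‖ = 1 → ‖B z f‖ ≤ 8 * S → ‖B z g‖ ≤ 9 * S → ‖B z‖ ≤ 18 * S := by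
    intro z hz h1 h2
    apply ContinuousLinearMap.opNorm_le_bound _ (by positivity)
    intro v
    rw [hexp v z]
    have a1 := norm_add_le ((inner ℝ f v : ℝ) • B z f + (inner ℝ g v : ℝ) • B z g)
      (B (v - K.starProjection v) z)
    have a2 := norm_add_le ((inner ℝ f v : ℝ) • B z f) ((inner ℝ g v : ℝ) • B z g)
    rw [norm_smul, norm_smul, Real.norm_eq_abs, Real.norm_eq_abs] at a2
    have a3 := (B (v - K.starProjection v)).le_opNorm z
    rw [hz, mul_one] at a3
    have a4 := hpv v
    have a5 : |(inner ℝ f v : ℝ)| * ‖B z f‖ ≤ ‖v‖ * (8 * S) := by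
      have := hin v; gcongr
    have a6 : |(inner ℝ g v : ℝ)| * ‖B z g‖ ≤ ‖v‖ * (9 * S) := by
      have := hig v; gcongr
    have a7 : η * ‖v‖ ≤ S * ‖v‖ := by gcongr
    linarith
  have hBf := hBz f hf h11 (h12.trans (by linarith))
  have hBg := hBz g hg (by rw [hs g f]; exact h12) h22
  apply ContinuousLinearMap.opNorm_le_bound _ (by positivity)
  intro v
  have a1 := B_split B K v
  have a2 := hpv v
  have a3 : ‖B (K.starProjection v)‖ ≤ 36 * S * ‖v‖ := by
    rw [hK, map_add, map_smul, map_smul]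
    have a2 := norm_add_le ((inner ℝ f v : ℝ) • B f) ((inner ℝ g v : ℝ) • B g)
    rw [norm_smul, norm_smul, Real.norm_eq_abs, Real.norm_eq_abs] at a2
    have a5 : |(inner ℝ f v : ℝ)| * ‖B f‖ ≤ ‖v‖ * (18 * S) := by
      have := hin v; gcongr
    have a6 : |(inner ℝ g v : ℝ)| * ‖B g‖ ≤ ‖v‖ * (18 * S) := by
      have := hig v; gcongr
    linarith
  have a7 : η * ‖v‖ ≤ S * ‖v‖ := by gcongr
  have : 0 ≤ S * ‖v‖ := by positivity
  linarith

theorem dirChain {U : Set (En n)} (hU : IsOpen U) {y : En n} (hy : y ∈ U)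
    (K : Submodule ℝ (En n)) {f g : En n} (hf : ‖f‖ = 1)
    (hg : ‖g‖ = 1) (hfg : inner ℝ f g = (0:ℝ))
    (hK : ∀ v, K.starProjection v = (inner ℝ f v : ℝ) • f + (inner ℝ g v : ℝ) • g)
    {η : ℝ} (hη : 0 ≤ η) {w : En n} (hw : ‖w‖ ≤ 1)
    (hw2 : 1 / 4 ≤ (inner ℝ f w : ℝ) ^ 2 + (inner ℝ g w : ℝ) ^ 2) (k : ℕ) :
    ∀ h : En n → ℝ, Sm h → Hm h U → (∀ p ∈ Kᗮ, ‖DD (Dd p h) k y‖ ≤ η * ‖p‖) →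
    ‖DD h (k + 1) y‖ ≤ 76 ^ k * (‖fderiv ℝ ((Dd w)^[k] h) y‖ + (3 * n + 1) * η) := by
  induction k with
  | zero =>
    intro h _ _ _
    have : ‖DD h 1 y‖ = ‖fderiv ℝ h y‖ := rfl
    simp only [zero_add, pow_zero, one_mul, Function.iterate_zero, id_eq]
    rw [this]
    have : 0 ≤ (3 * (n:ℝ) + 1) * η := by positivity
    linarith
  | succ k ih =>
    intro h hs hh hp
    have hsk := Sm_DD hs k
    have h1 := LA1 (fderiv ℝ (fderiv ℝ (DD h k)) y) (fun v w => snd_symm hsk y v w) (by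
      have := Hm_DD hU hs hh k y hy
      simp_rw [Dd_fderiv hsk] at this
      exact this) K hf hg hfg hK hη (by
      intro p hpK
      have := hp p hpK
      rw [DD_Dd hs] at this
      exact this) hw hw2
    have h2 : ‖fderiv ℝ (fderiv ℝ (DD h k)) y w‖ = ‖DD (Dd w h) (k+1) y‖ := by
      rw [DD_Dd hs]; rfl
    have h3 := ih (Dd w h) (Sm_Dd hs w) (Hm_Dd hU hs hh w) (by
      intro p hpK
      rw [Dd_comm hs]
      have a1 := norm_DD_Dd_le (Sm_Dd hs p) k w y
      have a2 := hp p hpK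
      have : ‖DD (Dd p h) (k+1) y‖ * ‖w‖ ≤ ‖DD (Dd p h) (k+1) y‖ * 1 := by gcongr
      linarith)
    rw [h2] at h1
    rw [Function.iterate_succ_apply]
    have h4 : ‖DD h (k+1+1) y‖ ≤ 38 * (‖DD (Dd w h) (k+1) y‖ + (3 * n + 1) * η) := h1
    set X := ‖fderiv ℝ ((Dd w)^[k] (Dd w h)) y‖
    have hX : 0 ≤ X := norm_nonneg _
    have h5 : (3 * (n:ℝ) + 1) * η ≤ 76 ^ k * (X + (3 * n + 1) * η) := by
      have a1 : (1:ℝ) ≤ 76 ^ k := one_le_pow₀ (by norm_num)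
      have a2 : 0 ≤ (3 * (n:ℝ) + 1) * η := by positivity
      nlinarith
    rw [pow_succ]
    linarith

/-- main linear algebra alternative -/
theorem LA_main (B : En n →L[ℝ] En n →L[ℝ] F) (hs : ∀ v w, B v w = B w v)
    (ht : ∑ i, B (eb i) (eb i) = 0) (hB : 0 < ‖B‖) {ε : ℝ} (hε : 0 < ε) (hε1 : ε ≤ 1) :
    ∃ (K : Submodule ℝ (En n)) (f g : En n), ‖f‖ = 1 ∧ ‖g‖ = 1 ∧ inner ℝ f g = (0:ℝ) ∧
      (∀ v, K.starProjection v = (inner ℝ f v : ℝ) • f + (inner ℝ g v : ℝ) • g) ∧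
      Module.finrank ℝ K = 2 ∧
      (∀ v, ‖K.starProjection v‖ * ‖B‖ ≤ (9 * n + 11) * ‖B v‖) ∧
      ((∀ p ∈ Kᗮ, ‖B p‖ ≤ ε * ‖B‖ * ‖p‖) ∨
        ∃ K' : Submodule ℝ (En n), Module.finrank ℝ K' = 3 ∧
          ∀ v, ‖K'.starProjection v‖ * ‖B‖ ≤ (18 * n + 23) / ε * ‖B v‖) := by
  have unit : ∀ (K : Submodule ℝ (En n)) (σ : ℝ), (∃ p ∈ Kᗮ, σ * ‖B‖ * ‖p‖ < ‖B p‖) →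
      ∃ w ∈ Kᗮ, ‖w‖ = 1 ∧ σ * ‖B‖ ≤ ‖B w‖ := by
    rintro K σ ⟨p, hp, h⟩
    have hp0 : p ≠ 0 := by rintro rfl; simp at h
    have hpn : 0 < ‖p‖ := norm_pos_iff.2 hp0
    refine ⟨‖p‖⁻¹ • p, Submodule.smul_mem _ _ hp, ?_, ?_⟩
    · rw [norm_smul, norm_inv, norm_norm, inv_mul_cancel₀ hpn.ne']
    · rw [map_smul, norm_smul, norm_inv, norm_norm, inv_mul_eq_div, le_div_iff₀ hpn]
      exact h.le
  obtain ⟨w1, hw1K, hw1, hw1'⟩ := unit ⊥ (1/2) (by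
    by_contra hcon
    push Not at hcon
    have := ContinuousLinearMap.opNorm_le_bound B (M := 1/2 * ‖B‖) (by positivity)
      (fun v => hcon v (by simp))
    linarith)
  obtain ⟨f, hf, -, hfr, hPf, hAf⟩ := LA_ext ⊥ B (β := ‖B‖) (A := 0) (σ := 1/2) le_rfl le_rfl
    (by norm_num) hB (by simp) hw1K hw1 hw1'
  set K1 := (⊥ : Submodule ℝ (En n)) ⊔ (ℝ ∙ f) with hK1
  have hPf' : ∀ v, K1.starProjection v = (inner ℝ f v : ℝ) • f := fun v => by
    rw [hPf]; simp
  have hσ : (0:ℝ) < 1 / (3 * n + 3) := by positivity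
  obtain ⟨w2, hw2K, hw2, hw2'⟩ := unit K1 (1 / (3 * n + 3)) (by
    by_contra hcon
    push Not at hcon
    have := LA_codim1 B hs ht K1 hf hPf' (η := 1 / (3 * n + 3) * ‖B‖) (by positivity) hcon
    have e : (3 * (n:ℝ) + 2) * (1 / (3 * n + 3) * ‖B‖) < ‖B‖ := by
      rw [one_div, ← mul_assoc, ← div_eq_mul_inv]
      have : (3 * (n:ℝ) + 2) / (3 * n + 3) < 1 := by
        rw [div_lt_one (by positivity)]; linarith
      nlinarith
    linarith)
  obtain ⟨g, hg, hgK, hgr, hPg, hAg⟩ := LA_ext K1 B (β := ‖B‖) (A := 2) (σ := 1 / (3 * n + 3))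
    le_rfl (by norm_num) hσ hB (by
      intro v; have h0 := hAf v
      rwa [show (0:ℝ) + (1 + 0) / (1 / 2) = 2 by norm_num] at h0)
    hw2K hw2 hw2'
  set K2 := K1 ⊔ (ℝ ∙ g) with hK2
  have hAg' : ∀ v, ‖K2.starProjection v‖ * ‖B‖ ≤ (9 * n + 11) * ‖B v‖ := by
    intro v
    have := hAg v
    have e : (2:ℝ) + (1 + 2) / (1 / (3 * n + 3)) = 9 * n + 11 := by
      rw [div_div_eq_mul_div]; ring
    rwa [e] at this
  refine ⟨K2, f, g, hf, hg, ?_, ?_, ?_, hAg', ?_⟩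
  · have : f ∈ K1 := Submodule.mem_sup_right (Submodule.mem_span_singleton_self f)
    exact Submodule.inner_right_of_mem_orthogonal this hgK
  · intro v; rw [hPg, hPf']
  · rw [hgr, hfr]; simp
  · by_cases hc : ∀ p ∈ K2ᗮ, ‖B p‖ ≤ ε * ‖B‖ * ‖p‖
    · exact Or.inl hc
    right
    push Not at hc
    obtain ⟨w3, hw3K, hw3, hw3'⟩ := unit K2 ε hc
    obtain ⟨q, hq, hqK, hqr, hPq, hAq⟩ := LA_ext K2 B (β := ‖B‖) (A := 9 * n + 11) (σ := ε)
      le_rfl (by positivity) hε hB hAg' hw3K hw3 hw3'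
    refine ⟨_, ?_, fun v => (hAq v).trans ?_⟩
    · rw [hqr, hgr, hfr]; simp
    · gcongr
      rw [le_div_iff₀ hε, add_mul, div_mul_cancel₀ _ hε.ne']
      have : (0:ℝ) ≤ 9 * n + 11 := by positivity
      nlinarith

end B1

section C1
variable {n : ℕ}

theorem norm_le_sum_abs (x : En n) : ‖x‖ ≤ ∑ i, |x i| := by
  have h := sum_eb x
  have h2 : ‖x‖ = ‖∑ i, (inner ℝ x (eb i) : ℝ) • (eb i : En n)‖ := by rw [← h]
  rw [h2]
  refine (norm_sum_le _ _).trans (Finset.sum_le_sum fun i _ => ?_)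
  rw [norm_smul, norm_eb, mul_one]
  simp [eb, EuclideanSpace.inner_single_right]

theorem abs_coord_le (x : En n) (i : Fin n) : |x i| ≤ ‖x‖ := by
  have := abs_real_inner_le_norm x (eb i)
  rw [norm_eb, mul_one] at this
  simpa [eb, EuclideanSpace.inner_single_right] using this

theorem cover_lemma (Z : Finset (En n)) {D ℓ M : ℝ} (hD : 0 ≤ D) (hℓ : 0 < ℓ) (hM : 0 ≤ M)
    (hZ : ∀ x ∈ Z, ∀ y ∈ Z, ‖x - y‖ ≤ D)
    (hY : ∀ Y ⊆ Z, (∀ x ∈ Y, ∀ y ∈ Y, ‖x - y‖ ≤ ℓ) → (Y.card : ℝ) ≤ M) :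
    (Z.card : ℝ) ≤ (2 * (n + 1) * D / ℓ + 2) ^ n * M := by
  classical
  rcases Z.eq_empty_or_nonempty with rfl | ⟨x0, hx0⟩
  · simp; positivity
  set h : ℝ := ℓ / (n + 1) with hh
  have hh0 : 0 < h := by positivity
  set cell : En n → (Fin n → ℤ) := fun x i => ⌊(x i - x0 i) / h⌋ with hcell
  have himg : Z.image cell ⊆ Fintype.piFinset (fun _ => Finset.Icc ⌊-(D / h)⌋ ⌊D / h⌋) := by
    intro c hc
    obtain ⟨x, hx, rfl⟩ := Finset.mem_image.1 hc
    rw [Fintype.mem_piFinset]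
    intro i
    have h1 := (abs_coord_le (x - x0) i).trans (hZ x hx x0 hx0)
    simp only [PiLp.sub_apply] at h1
    rw [abs_le] at h1
    rw [Finset.mem_Icc]
    constructor
    · apply Int.floor_le_floor
      rw [← neg_div]; exact div_le_div_of_nonneg_right h1.1 hh0.le
    · apply Int.floor_le_floor
      exact div_le_div_of_nonneg_right h1.2 hh0.le
  have hcard : ((Z.image cell).card : ℝ) ≤ (2 * (n + 1) * D / ℓ + 2) ^ n := by
    have h1 := Finset.card_le_card himg
    rw [Fintype.card_piFinset_const, Int.card_Icc] at h1
    have h2 : (((⌊D / h⌋ + 1 - ⌊-(D / h)⌋).toNat : ℕ) : ℝ) ≤ 2 * (n + 1) * D / ℓ + 2 := by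
      have hnn : 0 ≤ ⌊D / h⌋ + 1 - ⌊-(D / h)⌋ := by
        have : ⌊-(D / h)⌋ ≤ ⌊D / h⌋ := Int.floor_le_floor (by
          have : 0 ≤ D / h := by positivity
          linarith)
        omega
      have e : (((⌊D / h⌋ + 1 - ⌊-(D / h)⌋).toNat : ℕ) : ℝ) =
          ((⌊D / h⌋ + 1 - ⌊-(D / h)⌋ : ℤ) : ℝ) := by
        have := Int.toNat_of_nonneg hnn
        exact_mod_cast this
      rw [e]; push_cast
      have a1 := Int.floor_le (D / h)
      have a2 := Int.sub_one_lt_floor (-(D / h))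
      have e2 : 2 * (n + 1) * D / ℓ = 2 * (D / h) := by
        rw [hh]; field_simp
      linarith
    calc ((Z.image cell).card : ℝ) ≤ (((⌊D / h⌋ + 1 - ⌊-(D / h)⌋).toNat ^ n : ℕ) : ℝ) := by
          exact_mod_cast h1
      _ ≤ _ := by push_cast; gcongr
  have hfib : ∀ c ∈ Z.image cell, ((Z.filter fun x => cell x = c).card : ℝ) ≤ M := by
    intro c _
    apply hY _ (Finset.filter_subset _ _)
    intro x hx y hy
    have hx1 := (Finset.mem_filter.1 hx).2
    have hy1 := (Finset.mem_filter.1 hy).2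
    have : ∀ i, |(x - y) i| ≤ h := by
      intro i
      have e : ⌊(x i - x0 i) / h⌋ = ⌊(y i - x0 i) / h⌋ := congrFun (hx1.trans hy1.symm) i
      have := Int.abs_sub_lt_one_of_floor_eq_floor e
      rw [← sub_div, abs_div, abs_of_pos hh0, div_lt_one hh0] at this
      simp only [PiLp.sub_apply]
      have e3 : x i - x0 i - (y i - x0 i) = x i - y i := by ring
      rw [e3] at this
      exact this.le
    refine (norm_le_sum_abs (x - y)).trans ((Finset.sum_le_sum fun i _ => this i).trans ?_)
    simp only [Finset.sum_const, Finset.card_univ, Fintype.card_fin, nsmul_eq_mul]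
    rw [hh, mul_div_assoc', div_le_iff₀ (by positivity)]
    nlinarith
  have h1 := Finset.card_eq_sum_card_image cell Z
  calc (Z.card : ℝ) = ∑ c ∈ Z.image cell, ((Z.filter fun x => cell x = c).card : ℝ) := by
        exact_mod_cast h1
    _ ≤ ∑ c ∈ Z.image cell, M := Finset.sum_le_sum hfib
    _ = (Z.image cell).card * M := by simp
    _ ≤ _ := by gcongr

theorem int_lemma {ι : Type*} {V : Type*} [NormedAddCommGroup V] [InnerProductSpace ℝ V]
    [FiniteDimensional ℝ V] (Y : Finset ι) (π : ι → V) (a : ι → ℝ)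
    {q : V} {R M : ℝ} (hR : 0 < R) (hM : 0 ≤ M) (ha : ∀ x ∈ Y, 0 < a x) (haR : ∀ x ∈ Y, a x ≤ R)
    (hπ : ∀ x ∈ Y, ‖π x - q‖ ≤ R)
    (h : ∀ p : V, ∑ x ∈ Y with ‖π x - p‖ < a x, ((a x)⁻¹) ^ (Module.finrank ℝ V) ≤ M) :
    (Y.card : ℝ) ≤ (2 * R) ^ (Module.finrank ℝ V) * M := by
  classical
  letI : MeasurableSpace V := borel V
  haveI : BorelSpace V := ⟨rfl⟩
  set m := Module.finrank ℝ V with hm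
  let μ : Measure V := volume
  set β := μ.real (ball (0:V) 1) with hβ
  have hβ0 : 0 < β := by
    rw [hβ, Measure.real]
    exact ENNReal.toReal_pos (measure_ball_pos μ 0 one_pos).ne' measure_ball_lt_top.ne
  have hball : ∀ (z : V) (r : ℝ), 0 < r → μ.real (ball z r) = r ^ m * β := by
    intro z r hr
    rw [hβ, Measure.real, Measure.addHaar_ball_of_pos μ z hr, ENNReal.toReal_mul,
      ENNReal.toReal_ofReal (by positivity)]; rfl
  let F : ι → V → ℝ := fun x => (ball (π x) (a x)).indicator (fun _ => ((a x)⁻¹) ^ m)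
  have hFi : ∀ x, Integrable (F x) μ := by
    intro x
    exact (integrable_indicator_iff measurableSet_ball).2
      (integrableOn_const measure_ball_lt_top.ne)
  have hF : ∀ x ∈ Y, ∫ p, F x p ∂μ = β := by
    intro x hx
    rw [integral_indicator_const _ measurableSet_ball, hball _ _ (ha x hx), smul_eq_mul]
    have := ha x hx
    rw [inv_pow]; field_simp
  have h1 : ∫ p, ∑ x ∈ Y, F x p ∂μ = Y.card * β := by
    rw [integral_finsetSum _ (fun x _ => hFi x), Finset.sum_congr rfl hF]; simp
  have h2 : ∫ p, ∑ x ∈ Y, F x p ∂μ ≤ ∫ p, (ball q (2 * R)).indicator (fun _ => M) p ∂μ := by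
    apply integral_mono (integrable_finset_sum _ (fun x _ => hFi x))
    · exact (integrable_indicator_iff measurableSet_ball).2
        (integrableOn_const measure_ball_lt_top.ne)
    · intro p
      have e : ∑ x ∈ Y, F x p = ∑ x ∈ Y with ‖π x - p‖ < a x, ((a x)⁻¹) ^ m := by
        rw [Finset.sum_filter]
        refine Finset.sum_congr rfl fun x _ => ?_
        simp only [F, Set.indicator_apply, mem_ball, dist_eq_norm]
        rw [norm_sub_rev]
      simp only
      rw [e]
      by_cases hp : p ∈ ball q (2 * R)
      · rw [Set.indicator_of_mem hp]; exact h p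
      · rw [Set.indicator_of_notMem hp]
        apply le_of_eq
        apply Finset.sum_eq_zero
        intro x hx
        exfalso
        obtain ⟨hx, hx2⟩ := Finset.mem_filter.1 hx
        apply hp
        rw [mem_ball, dist_eq_norm]
        have a1 := hπ x hx
        have a2 := haR x hx
        have a3 := norm_sub_le_norm_sub_add_norm_sub p (π x) q
        rw [norm_sub_rev p (π x)] at a3
        linarith
  rw [h1, integral_indicator_const _ measurableSet_ball, hball _ _ (by positivity), smul_eq_mul] at h2
  have h3 : (Y.card : ℝ) * β ≤ ((2 * R) ^ m * M) * β := by linarith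
  exact le_of_mul_le_mul_right h3 hβ0

end C1

/-- normalized derivative size -/
noncomputable def be {n : ℕ} (u : En n → ℝ) (k : ℕ) (x : En n) : ℝ := bb u k x / k.factorial

/-- the k0-th term dominates at scale ρ -/
def Pin {n : ℕ} (u : En n → ℝ) (x : En n) (ρ : ℝ) (k0 : ℕ) : Prop :=
  ∀ k, be u k x * ρ ^ k ≤ be u k0 x * ρ ^ k0

/-- some term of order at most d dominates -/
def Dom {n : ℕ} (u : En n → ℝ) (x : En n) (ρ : ℝ) (d : ℕ) : Prop := ∃ k0 ≤ d, Pin u x ρ k0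

section D1
variable {n : ℕ} {u : En n → ℝ} {x y : En n}

theorem be_nonneg (k : ℕ) (x : En n) : 0 ≤ be u k x := by
  unfold be; have := bb_nonneg u k x; positivity

theorem bb_eq (k : ℕ) (x : En n) : bb u k x = be u k x * k.factorial := by
  unfold be; field_simp

theorem be_zero (x : En n) : be u 0 x = bb u 0 x := by simp [be]

theorem Pin.H {ρ : ℝ} {d : ℕ} (h : Pin u x ρ d) (k : ℕ) :
    bb u k x * ρ ^ k ≤ (be u d x * ρ ^ d) * k.factorial := by
  rw [bb_eq, mul_right_comm]
  exact mul_le_mul_of_nonneg_right (h k) (by positivity)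

theorem term_up {ρ ρ' b b' : ℝ} {k k0 : ℕ} (hρ' : 0 < ρ') (h : ρ' ≤ ρ) (hb' : 0 ≤ b')
    (hk : k0 ≤ k) (hh : b * ρ ^ k ≤ b' * ρ ^ k0) : b * ρ' ^ k ≤ b' * ρ' ^ k0 := by
  have hρ : 0 < ρ := hρ'.trans_le h
  obtain ⟨m, rfl⟩ := Nat.exists_eq_add_of_le hk
  rw [pow_add, ← mul_assoc, mul_right_comm] at hh ⊢
  have h1 := le_of_mul_le_mul_right hh (by positivity)
  rcases le_total b 0 with hb | hb
  · have : b * ρ' ^ m ≤ 0 := mul_nonpos_of_nonpos_of_nonneg hb (by positivity)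
    have : b * ρ' ^ m ≤ b' := by linarith
    gcongr
  · gcongr
    refine le_trans ?_ h1
    gcongr

theorem term_down {ρ ρ' b b' : ℝ} {k k0 : ℕ} (hρ' : 0 < ρ') (h : ρ' ≤ ρ) (hb' : 0 ≤ b')
    (hk : k ≤ k0) (hh : b * ρ' ^ k ≤ b' * ρ' ^ k0) : b * ρ ^ k ≤ b' * ρ ^ k0 := by
  have hρ : 0 < ρ := hρ'.trans_le h
  obtain ⟨m, rfl⟩ := Nat.exists_eq_add_of_le hk
  rw [pow_add, ← mul_assoc, mul_right_comm] at hh ⊢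
  have h1 := le_of_mul_le_mul_right hh (by positivity)
  gcongr
  refine h1.trans ?_
  gcongr

theorem Dom_mono {ρ ρ' : ℝ} {d : ℕ} (hρ' : 0 < ρ') (h : ρ' ≤ ρ) (hD : Dom u x ρ d) :
    Dom u x ρ' d := by
  obtain ⟨k0, hk0, hp⟩ := hD
  obtain ⟨k1, hk1, hm⟩ := (Finset.range (d+1)).exists_max_image (fun k => be u k x * ρ' ^ k)
    ⟨0, by simp⟩
  simp only [Finset.mem_range] at hk1 hm
  refine ⟨k1, by omega, fun k => ?_⟩
  by_cases hk : k ≤ d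
  · exact hm k (by omega)
  · exact (term_up hρ' h (be_nonneg _ _) (by omega) (hp k)).trans (hm k0 (by omega))

theorem Pin0_mono {ρ ρ' : ℝ} (hρ' : 0 < ρ') (h : ρ' ≤ ρ) (hD : Pin u x ρ 0) :
    Pin u x ρ' 0 := by
  obtain ⟨k0, hk, h⟩ := Dom_mono hρ' h ⟨0, le_rfl, hD⟩
  obtain rfl : k0 = 0 := by omega
  exact h

theorem Dom_pin {ρ : ℝ} {d : ℕ} (h : Dom u x ρ (d+1)) (h' : ¬ Dom u x ρ d) :
    Pin u x ρ (d+1) := by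
  obtain ⟨k0, hk, hp⟩ := h
  rcases Nat.lt_or_ge k0 (d+1) with h1 | h1
  · exact absurd ⟨k0, by omega, hp⟩ h'
  · obtain rfl : k0 = d + 1 := by omega
    exact hp

theorem Pin_between {ρ1 ρ ρ2 : ℝ} {d : ℕ} (h0 : 0 < ρ1) (h1 : ρ1 ≤ ρ) (h2 : ρ ≤ ρ2)
    (hp1 : Pin u x ρ1 d) (hp2 : Pin u x ρ2 d) : Pin u x ρ d := by
  intro k
  rcases le_total k d with h | h
  · exact term_down h0 h1 (be_nonneg _ _) h (hp1 k)
  · exact term_up (h0.trans_le h1) h2 (be_nonneg _ _) h (hp2 k)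

theorem Pin_pos {ρ ρ' : ℝ} {d : ℕ} (h : 0 < ρ) (hp : Pin u x ρ d) (hb : ¬ Pin u x ρ' 0) :
    0 < be u d x := by
  rcases (be_nonneg (u := u) d x).lt_or_eq with h1 | h1
  · exact h1
  · exfalso; apply hb
    have : ∀ k, be u k x = 0 := by
      intro k
      have h2 := hp k
      rw [← h1, zero_mul] at h2
      have := be_nonneg (u := u) k x
      by_contra hne
      have : 0 < be u k x * ρ ^ k := by positivity
      linarith
    intro k; simp [this]

theorem bern {a : ℝ} {m : ℕ} (ha : 0 ≤ a) (hm : m * a ≤ 1 / 2) (ha1 : a ≤ 1/2):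
    (1 - a)⁻¹ ^ m ≤ 1 + 2 * (m * a) := by
  have h1 := one_add_mul_le_pow (a := -a) (by linarith) m
  have h2 : 0 < 1 - m * a := by linarith
  rw [inv_pow, inv_le_comm₀ (by apply pow_pos; linarith) (by positivity)]
  refine le_trans ?_ (show 1 - m * a ≤ (1 - a)^m by rw [← sub_eq_add_neg] at h1; linarith)
  rw [inv_le_iff_one_le_mul₀ (by positivity)]
  nlinarith [show 0 ≤ m * a by positivity]

/-- perturbation of the top derivative -/
theorem pert {Ω : Set (En n)} {E M : ℝ} (g : Good u Ω E M) (hx : x ∈ Ω) (hy : y ∈ Ω) {r δ : ℝ}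
    {d : ℕ} (hr : 0 < r) (hrE : r * (2 * E) ≤ 1) (hδ : ((d+1 : ℕ):ℝ) * δ ≤ 1/2)
    (hxy : ‖y - x‖ ≤ δ * r) (hp : Pin u x r d) :
    ‖DD u (d + 1) y - DD u (d + 1) x‖ ≤ 2 * ((d + 1 : ℕ) * δ) * bb u d x := by
  have h0 : 0 ≤ ‖y - x‖ / r := by positivity
  have h1 : ‖y - x‖ / r ≤ δ := by rw [div_le_iff₀ hr]; exact hxy
  have hd : (1:ℝ) ≤ ((d+1 : ℕ):ℝ) := by push_cast; have : (0:ℝ) ≤ d := by positivity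
                                        linarith
  have hδ2 : δ ≤ 1/2 := by nlinarith
  have h2 := taylor g hx hy hr hrE (by rw [← div_lt_one hr]; linarith) hp.H d
  have h3 := bern (a := ‖y - x‖ / r) (m := d+1) h0
    ((mul_le_mul_of_nonneg_left h1 (by linarith)).trans hδ) (by linarith)
  refine h2.trans ?_
  have h4 : be u d x * r ^ d * d.factorial / r ^ d = bb u d x := by
    rw [bb_eq]; field_simp
  rw [h4, mul_comm]
  apply mul_le_mul_of_nonneg_right _ (bb_nonneg _ _ _)
  have : ((d+1 : ℕ):ℝ) * (‖y - x‖ / r) ≤ (d+1 : ℕ) * δ := by gcongr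
  linarith

/-- abstract Taylor expansion on a segment -/
theorem taylor1 {G : Type*} [NormedAddCommGroup G] [NormedSpace ℝ G] (d : ℕ) :
    ∀ (F : ℕ → ℝ → G), (∀ k σ, HasDerivAt (F k) (F (k+1) σ) σ) → ∀ (C t : ℝ),
    (∀ σ ∈ Icc (0:ℝ) t, ‖F d σ‖ ≤ C) → ∀ σ ∈ Icc (0:ℝ) t,
    ‖F 0 σ - ∑ k ∈ Finset.range d, (σ ^ k / k.factorial) • F k 0‖ ≤ C * σ ^ d / d.factorial := by
  induction d with
  | zero => intro F hF C t hC σ hσ; simpa using hC σ hσ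
  | succ d ih =>
    intro F hF C t hC σ hσ
    have h1 := ih (fun k => F (k+1)) (fun k σ => hF (k+1) σ) C t hC
    have hd : ∀ σ : ℝ, HasDerivAt
        (fun σ => F 0 σ - ∑ k ∈ Finset.range (d+1), (σ ^ k / k.factorial) • F k 0)
        (F 1 σ - ∑ k ∈ Finset.range d, (σ ^ k / k.factorial) • F (k+1) 0) σ := by
      intro σ
      refine (hF 0 σ).sub ?_
      have h2 : HasDerivAt (fun σ : ℝ => ∑ k ∈ Finset.range (d+1), (σ ^ k / k.factorial) • F k 0)
        (∑ k ∈ Finset.range (d+1), ((k * σ ^ (k-1)) / k.factorial) • F k 0) σ := by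
        refine HasDerivAt.fun_sum fun k _ => ?_
        exact ((hasDerivAt_pow k σ).div_const _).smul_const _
      refine h2.congr_deriv ?_
      rw [Finset.sum_range_succ']
      simp only [Nat.cast_zero, zero_mul, zero_div, zero_smul, add_zero]
      refine Finset.sum_congr rfl fun k _ => ?_
      congr 1
      rw [Nat.factorial_succ]; push_cast
      field_simp
    have hB : ∀ σ : ℝ, HasDerivAt (fun σ : ℝ => C * σ ^ (d+1) / (d+1).factorial)
        (C * σ ^ d / d.factorial) σ := by
      intro σ
      refine (((hasDerivAt_pow (d+1) σ).const_mul C).div_const _).congr_deriv ?_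
      rw [Nat.factorial_succ]; push_cast
      field_simp
    exact image_norm_le_of_norm_deriv_right_le_deriv_boundary' (a := 0) (b := t)
      (fun σ _ => (hd σ).continuousAt.continuousWithinAt)
      (fun σ _ => (hd σ).hasDerivWithinAt)
      (by simp [Finset.sum_range_succ'])
      (fun σ _ => (hB σ).continuousAt.continuousWithinAt)
      (fun σ _ => (hB σ).hasDerivWithinAt)
      (fun σ hσ => h1 σ (Ico_subset_Icc_self hσ)) hσ

theorem Sm_iter (h : Sm u) (w : En n) (k : ℕ) : Sm ((Dd w)^[k] u) := by
  induction k with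
  | zero => exact h
  | succ k ih => rw [Function.iterate_succ_apply']; exact Sm_Dd ih w

theorem iter_norm (w : En n) (hw : ‖w‖ ≤ 1) (k : ℕ) : ∀ (f : En n → ℝ), Sm f → ∀ j (z : En n),
    ‖DD ((Dd w)^[k] f) j z‖ ≤ ‖DD f (j + k) z‖ := by
  induction k with
  | zero => intro f _ j z; exact le_rfl
  | succ k ih =>
    intro f hf j z
    rw [Function.iterate_succ_apply]
    refine (ih (Dd w f) (Sm_Dd hf w) j z).trans ?_
    refine (norm_DD_Dd_le hf (j + k) w z).trans ?_
    refine mul_le_of_le_one_right (norm_nonneg _) hw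

/-- Taylor for the gradient along a segment -/
theorem taylor_grad (h : Sm u) (y w : En n) (hw : ‖w‖ ≤ 1) (d : ℕ) {C t : ℝ} (ht : 0 ≤ t)
    (hC : ∀ σ ∈ Icc (0:ℝ) t, bb u (d+1) (y + σ • w) ≤ C) :
    ‖fderiv ℝ ((Dd w)^[d] u) y‖ * t ^ d / d.factorial ≤
      bb u 0 (y + t • w) + ∑ k ∈ Finset.range d, be u k y * t ^ k
        + C * t ^ (d+1) / (d+1).factorial := by
  set F : ℕ → ℝ → (En n →L[ℝ] ℝ) := fun k σ => fderiv ℝ ((Dd w)^[k] u) (y + σ • w) with hF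
  have hFn : ∀ k σ, ‖F k σ‖ ≤ bb u k (y + σ • w) := by
    intro k σ
    have := iter_norm w hw k u h 1 (y + σ • w)
    rw [add_comm 1 k] at this
    exact this
  have hd : ∀ k σ, HasDerivAt (F k) (F (k+1) σ) σ := by
    intro k σ
    have h1 : HasDerivAt (fun s : ℝ => y + s • w) w σ := by
      simpa using ((hasDerivAt_id σ).smul_const w).const_add y
    have h2 := ((Sm_fderiv (Sm_iter h w k)).diff (y + σ • w)).hasFDerivAt.comp_hasDerivAt σ h1
    refine h2.congr_deriv ?_
    simp only [hF]
    rw [Function.iterate_succ_apply', fderiv_Dd (Sm_iter h w k)]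
    rfl
  have h1 := taylor1 (d+1) F hd C t (fun σ hσ => (hFn _ _).trans (hC σ hσ)) t ⟨ht, le_rfl⟩
  rw [Finset.sum_range_succ] at h1
  have h2 : ‖(t ^ d / d.factorial : ℝ) • F d 0‖ ≤ ‖F 0 t‖ +
      ‖∑ k ∈ Finset.range d, (t ^ k / k.factorial : ℝ) • F k 0‖ + C * t ^ (d+1) / (d+1).factorial := by
    set S := ∑ k ∈ Finset.range d, (t ^ k / k.factorial : ℝ) • F k 0
    set X := (t ^ d / d.factorial : ℝ) • F d 0
    have : X = (F 0 t - S) - (F 0 t - (S + X)) := by abel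
    have h3 := norm_sub_le (F 0 t - S) (F 0 t - (S + X))
    rw [← this] at h3
    have := norm_sub_le (F 0 t) S
    linarith
  have h3 : ‖∑ k ∈ Finset.range d, (t ^ k / k.factorial : ℝ) • F k 0‖ ≤
      ∑ k ∈ Finset.range d, be u k y * t ^ k := by
    refine norm_sum_le_of_le _ fun k _ => ?_
    rw [norm_smul, Real.norm_of_nonneg (by positivity)]
    have := hFn k 0
    rw [zero_smul, add_zero] at this
    calc _ ≤ t ^ k / k.factorial * bb u k y := by gcongr
      _ = _ := by unfold be; ring
  have h4 := hFn 0 t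
  rw [norm_smul, Real.norm_of_nonneg (by positivity)] at h2
  have h5 : F d 0 = fderiv ℝ ((Dd w)^[d] u) y := by simp [hF]
  rw [h5] at h2
  calc _ = t ^ d / d.factorial * ‖fderiv ℝ ((Dd w)^[d] u) y‖ := by ring
    _ ≤ _ := by linarith

end D1

section D2
variable {n : ℕ} {u : En n → ℝ}

theorem low_le {y : En n} {ρ : ℝ} {d : ℕ} (hρ : 0 < ρ) (h : Pin u y (2 * ρ) (d+1)) :
    bb u d y ≤ 2 * ρ * bb u (d+1) y := by
  have h1 := h d
  rw [pow_succ, ← mul_assoc, mul_right_comm] at h1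
  have h2 := le_of_mul_le_mul_right h1 (by positivity)
  rw [bb_eq, bb_eq, Nat.factorial_succ]
  push_cast
  calc _ ≤ be u (d+1) y * (2 * ρ) * d.factorial := by gcongr
    _ = 2 * ρ * (be u (d+1) y * (1 * d.factorial)) := by ring
    _ ≤ _ := by
      have := be_nonneg (u := u) (d+1) y
      have : (1:ℝ) ≤ d + 1 := by have : (0:ℝ) ≤ d := by positivity
                                 linarith
      gcongr

theorem cone {Ω : Set (En n)} {E M : ℝ} (g : Good u Ω E M) {x0 y y' : En n} (hx0 : x0 ∈ Ω)
    (hy : y ∈ Ω) (hy' : y' ∈ Ω) {r δ ρ ρ' A : ℝ}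
    {d : ℕ} (hr : 0 < r) (hrE : r * (2 * E) ≤ 1) (hδ : ((d+1+1 : ℕ):ℝ) * δ ≤ 1/2)
    (hyd : ‖y - x0‖ ≤ δ * r) (hyd' : ‖y' - x0‖ ≤ δ * r) (hp : Pin u x0 r (d+1))
    (hρ : 0 < ρ) (hρ' : 0 < ρ')
    (hpy : Pin u y (2*ρ) (d+1)) (hpy' : Pin u y' (2*ρ') (d+1)) (hb : 0 < bb u (d+1) x0)
    (hA : 0 ≤ A) (hAε : A * (2 * (((d+1+1 : ℕ):ℝ) * δ)) ≤ 1/4) (K : Submodule ℝ (En n))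
    (hK : ∀ v, ‖K.starProjection v‖ * bb u (d+1) x0 ≤ A * ‖fderiv ℝ (DD u (d+1)) x0 v‖) :
    3/4 * ‖y - y'‖ ≤ ‖Kᗮ.starProjection (y - y')‖ + 4 * A * (ρ + ρ') := by
  set β := bb u (d+1) x0 with hβ
  set ε := 2 * (((d+1+1 : ℕ):ℝ) * δ) with hε
  have hε1 : ε ≤ 1 := by linarith
  have hpert : ∀ z ∈ Ω, ‖z - x0‖ ≤ δ * r →
      ‖fderiv ℝ (DD u (d+1)) z - fderiv ℝ (DD u (d+1)) x0‖ ≤ ε * β :=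
    fun z hz hzd => pert g hx0 hz hr hrE hδ hzd hp
  have hb2 : ∀ z ∈ Ω, ‖z - x0‖ ≤ δ * r → bb u (d+1) z ≤ 2 * β := by
    intro z hz hzd
    have h1 := hpert z hz hzd
    have h2 : bb u (d+1) z ≤ ε * β + β := by
      have h3 := norm_add_le (fderiv ℝ (DD u (d+1)) z - fderiv ℝ (DD u (d+1)) x0)
        (fderiv ℝ (DD u (d+1)) x0)
      rw [sub_add_cancel] at h3
      have h4 : bb u (d+1) z = ‖fderiv ℝ (DD u (d+1)) z‖ := rfl
      have h5 : β = ‖fderiv ℝ (DD u (d+1)) x0‖ := rfl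
      rw [h4]; linarith
    nlinarith
  have hl : ∀ z ∈ Ω, ‖z - x0‖ ≤ δ * r → ∀ ρ, 0 < ρ → Pin u z (2*ρ) (d+1) →
      ‖DD u (d+1) z‖ ≤ 4 * ρ * β := by
    intro z hz hzd ρ hρ hpz
    have h1 := low_le hρ hpz
    have h2 := hb2 z hz hzd
    calc _ ≤ 2 * ρ * bb u (d+1) z := h1
      _ ≤ 2 * ρ * (2 * β) := by gcongr
      _ = _ := by ring
  have hmv := (g.cv.inter (convex_closedBall x0 (δ * r))).norm_image_sub_le_of_norm_fderiv_le'
    (𝕜 := ℝ) (f := DD u (d+1)) (C := ε * β) (φ := fderiv ℝ (DD u (d+1)) x0) (x := y') (y := y)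
    (fun z _ => (Sm_DD g.sm (d+1)).diff z)
    (fun z hz => hpert z hz.1 (by simpa [dist_eq_norm] using hz.2))
    ⟨hy', by simpa [dist_eq_norm] using hyd'⟩ ⟨hy, by simpa [dist_eq_norm] using hyd⟩
  set v := y - y' with hv
  have h1 : ‖fderiv ℝ (DD u (d+1)) x0 v‖ ≤ (ε * ‖v‖ + 4 * (ρ + ρ')) * β := by
    have e1 := hl y hy hyd ρ hρ hpy
    have e2 := hl y' hy' hyd' ρ' hρ' hpy'
    have e3 : fderiv ℝ (DD u (d+1)) x0 v = DD u (d+1) y - DD u (d+1) y' -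
      (DD u (d+1) y - DD u (d+1) y' - fderiv ℝ (DD u (d+1)) x0 v) := by abel
    have e4 := norm_sub_le (DD u (d+1) y - DD u (d+1) y')
      (DD u (d+1) y - DD u (d+1) y' - fderiv ℝ (DD u (d+1)) x0 v)
    rw [← e3] at e4
    have e5 := norm_sub_le (DD u (d+1) y) (DD u (d+1) y')
    linarith
  have h2 := hK v
  have h3 : ‖K.starProjection v‖ ≤ A * (ε * ‖v‖ + 4 * (ρ + ρ')) := by
    refine le_of_mul_le_mul_right ?_ hb
    calc _ ≤ _ := h2
      _ ≤ A * ((ε * ‖v‖ + 4 * (ρ + ρ')) * β) := by gcongr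
      _ = _ := by ring
  have h4 : ‖v‖ ≤ ‖Kᗮ.starProjection v‖ + ‖K.starProjection v‖ := by
    have := norm_add_le (Kᗮ.starProjection v) (K.starProjection v)
    rw [Submodule.starProjection_orthogonal_val, sub_add_cancel] at this
    rw [Submodule.starProjection_orthogonal_val]; exact this
  nlinarith [norm_nonneg v]

theorem be_le_of_pin {Ω : Set (En n)} {E M : ℝ} (g : Good u Ω E M) {x y : En n}
    (hy : y ∈ Ω) (hx : x ∈ Ω) {R : ℝ} (hR : 0 < R) (hrE : R * (2 * E) ≤ 1) {d : ℕ}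
    (hp : Pin u y R d) (hxy : ‖x - y‖ < R) (k : ℕ) :
    be u k x * R ^ k ≤ be u d y * R ^ d * (1 - ‖x - y‖ / R)⁻¹ ^ (k+1) := by
  have h := taylor_le g hy hx hR hrE hxy hp.H k
  rw [bb_eq] at h
  have hk : (0:ℝ) < k.factorial := by positivity
  have h2 : be u d y * R ^ d * k.factorial / R ^ k * (1 - ‖x - y‖ / R)⁻¹ ^ (k + 1) =
    (be u d y * R ^ d * (1 - ‖x - y‖ / R)⁻¹ ^ (k + 1) / R ^ k) * k.factorial := by ring
  rw [h2] at h
  have h3 := le_of_mul_le_mul_right h hk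
  rwa [le_div_iff₀ (by positivity)] at h3

/-- near case -/
theorem near {Ω : Set (En n)} {E M : ℝ} (g : Good u Ω E M) {x y : En n}
    (hy : y ∈ Ω) (hx : x ∈ Ω) {r ρx ρy : ℝ} {d : ℕ} (hrE : r * (2 * E) ≤ 1)
    (hρy : 0 < ρy) (hρx : 2 * ρx ≤ r) (hyx : 4 * ρy ≤ ρx)
    (h1 : Pin u y (2 * ρy) (d+1)) (h2 : Pin u y r (d+1)) (hpos : 0 < be u (d+1) y)
    (ht : ‖x - y‖ ≤ 1 / (20 * (d + 1 + 1 : ℕ)) * ρx) (hD : Dom u x ρx d) : False := by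
  obtain ⟨k0, hk0, hp⟩ := hD
  have hE := g.hE
  have hx0 : 0 < ρx := by linarith
  set R := ρx / 2 with hR
  have hR0 : 0 < R := by positivity
  have hRE : R * (2 * E) ≤ 1 := by
    refine le_trans ?_ hrE
    gcongr; linarith
  have hpR : Pin u y R (d+1) := Pin_between (by positivity) (by linarith) (by linarith) h1 h2
  set a := ‖x - y‖ / R with ha
  have ha0 : 0 ≤ a := by positivity
  have hd1 : (1:ℝ) ≤ ((d+1+1 : ℕ):ℝ) := by push_cast; have : (0:ℝ) ≤ d := by positivity
                                           linarith
  have had : ((d+1+1 : ℕ):ℝ) * a ≤ 1/10 := by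
    rw [ha, mul_div_assoc', div_le_iff₀ hR0, hR]
    calc _ ≤ ((d+1+1 : ℕ):ℝ) * (1 / (20 * (d + 1 + 1 : ℕ)) * ρx) := by gcongr
      _ = _ := by field_simp; norm_num
  have ha1 : a ≤ 1/10 := by nlinarith
  have hlt : ‖x - y‖ < R := by
    rw [← div_lt_one hR0]; linarith
  have hone : 1 ≤ (1 - a)⁻¹ := by
    rw [one_le_inv₀ (by linarith)]; linarith
  have hb : (1 - a)⁻¹ ^ (d+1+1) ≤ 6/5 := by
    have := bern (m := d+1+1) ha0 (by linarith) (by linarith)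
    linarith
  -- upper bound
  have hu := be_le_of_pin g hy hx hR0 hRE hpR hlt k0
  have hu2 : be u k0 x * R ^ k0 ≤ be u (d+1) y * R ^ (d+1) * (6/5) := by
    refine hu.trans ?_
    gcongr
    exact (pow_le_pow_right₀ hone (by omega)).trans hb
  -- lower bound
  have hl := taylor g hy hx hR0 hRE hlt hpR.H (d+1)
  have hl2 : 4/5 * be u (d+1) y ≤ be u (d+1) x := by
    have e1 : be u (d+1) y * R ^ (d+1) * (d+1).factorial / R ^ (d+1) = bb u (d+1) y := by
      rw [bb_eq]; field_simp
    rw [e1] at hl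
    have e2 := norm_sub_le (DD u (d+1+1) x) (DD u (d+1+1) x - DD u (d+1+1) y)
    rw [show DD u (d+1+1) x - (DD u (d+1+1) x - DD u (d+1+1) y) = DD u (d+1+1) y by abel] at e2
    have e3 : bb u (d+1) y = ‖DD u (d+1+1) y‖ := rfl
    have e4 : bb u (d+1) x = ‖DD u (d+1+1) x‖ := rfl
    have e5 : bb u (d+1) y ≤ bb u (d+1) x + bb u (d+1) y * (1/5) := by
      rw [e3, e4]; rw [e3] at hl
      refine e2.trans ?_
      gcongr
      refine hl.trans ?_
      gcongr
      linarith
    rw [bb_eq, bb_eq] at e5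
    have : (0:ℝ) < (d+1).factorial := by positivity
    refine le_of_mul_le_mul_right ?_ this
    linarith
  -- contradiction
  have hc := hp (d+1)
  obtain ⟨m, hm⟩ : ∃ m, d + 1 = k0 + (m + 1) := ⟨d - k0, by omega⟩
  rw [hm, pow_add, ← mul_assoc, mul_right_comm, ← hm] at hc
  have hc2 := le_of_mul_le_mul_right hc (by positivity)
  rw [hm, pow_add, ← mul_assoc, mul_right_comm _ (R^k0), mul_right_comm _ (R^k0), ← hm] at hu2
  have hu3 := le_of_mul_le_mul_right hu2 (by positivity)
  have hRx : R ^ (m+1) ≤ ρx ^ (m+1) / 2 := by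
    rw [hR, div_pow]
    have : (2:ℝ) ≤ 2 ^ (m+1) := by
      rw [pow_succ]; have := one_le_pow₀ (M₀ := ℝ) (a := 2) (n := m) (by norm_num); linarith
    gcongr
  have hX : 0 < ρx ^ (m+1) := by positivity
  have h5 : be u (d+1) y * R ^ (m+1) ≤ be u (d+1) y * (ρx ^ (m+1) / 2) := by gcongr
  have h6 : 4/5 * be u (d+1) y * ρx ^ (m+1) ≤ be u (d+1) x * ρx ^ (m+1) := by gcongr
  have h7 : 0 < be u (d+1) y * ρx ^ (m+1) := by positivity
  nlinarith

/-- far case: nondegenerate direction -/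
theorem far {Ω : Set (En n)} {E M : ℝ} (g : Good u Ω E M) {x y : En n}
    (hy : y ∈ Ω) (hx : x ∈ Ω) {r ρy t κ s0 : ℝ} {d : ℕ} (hr : 0 < r) (hrE : r * (2 * E) ≤ 1)
    (hρy : 0 < ρy) (ht : 0 < t) (hxy : ‖x - y‖ = t) (hκ : 0 < κ) (hκ1 : κ ≤ 1)
    (hyt : 8 * ((d+1 : ℕ):ℝ) * ρy ≤ κ * t) (htr : 2 ^ (d + 5) * t ≤ κ * r)
    (h1 : Pin u y (2 * ρy) (d+1)) (h2 : Pin u y r (d+1))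
    (hdir : κ * bb u (d+1) y ≤ ‖fderiv ℝ ((Dd (t⁻¹ • (x - y)))^[d+1] u) y‖)
    (hbad : ¬ Pin u x s0 0) (hs0 : 0 < s0) : κ * t < 2 ^ (d + 3) * s0 := by
  set w := t⁻¹ • (x - y) with hw
  have hE := g.hE
  have hw1 : ‖w‖ = 1 := by
    rw [hw, norm_smul, hxy, norm_inv, Real.norm_of_nonneg ht.le]; field_simp
  have hxw : y + t • w = x := by
    rw [hw, smul_smul, mul_inv_cancel₀ ht.ne', one_smul]; abel
  set B := be u (d+1) y with hB
  have hB0 : 0 ≤ B := be_nonneg _ _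
  have hpow : (32:ℝ) ≤ 2 ^ (d+5) := by
    rw [pow_add]; have := one_le_pow₀ (M₀ := ℝ) (a := 2) (n := d) (by norm_num); linarith
  have htr2 : 2 * t ≤ r := by nlinarith
  have hd1 : (1:ℝ) ≤ ((d+1 : ℕ):ℝ) := by push_cast; have : (0:ℝ) ≤ d := by positivity
                                         linarith
  have hyt2 : 2 * ρy ≤ t := by nlinarith
  have hlow : (κ / 2) * B * t ^ (d+1) ≤ bb u 0 x := by
    have hT := taylor_grad g.sm y w hw1.le (d+1) (C := B / r * (d+1+1).factorial * 2 ^ (d+1+1+1)) ht.le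
      (by
        intro σ hσ
        have hz : y + σ • w ∈ Ω := by
          have : y + σ • w = y + (σ / t) • (x - y) := by rw [hw, smul_smul]; rfl
          rw [this]
          exact g.cv.add_smul_sub_mem hy hx ⟨div_nonneg hσ.1 ht.le, (div_le_one ht).2 hσ.2⟩
        have hzn : ‖y + σ • w - y‖ ≤ t := by
          rw [add_sub_cancel_left, norm_smul, hw1, mul_one, Real.norm_of_nonneg hσ.1]; exact hσ.2
        have h3 := taylor_le g hy hz hr hrE (by linarith) h2.H (d+1+1)
        refine h3.trans ?_
        have h4 : be u (d+1) y * r ^ (d+1) * (d+1+1).factorial / r ^ (d+1+1) =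
            B / r * (d+1+1).factorial := by rw [pow_succ r (d+1), ← hB]; field_simp
        rw [h4]
        gcongr
        · rw [inv_nonneg, sub_nonneg, div_le_one hr]; linarith
        · have : ‖y + σ • w - y‖ / r ≤ 1/2 := by rw [div_le_iff₀ hr]; linarith
          rw [inv_le_comm₀ (by linarith) (by norm_num)]; linarith)
    rw [hxw] at hT
    have hT1 : κ * B * t ^ (d+1) ≤
        ‖fderiv ℝ ((Dd w)^[d+1] u) y‖ * t ^ (d+1) / (d+1).factorial := by
      rw [le_div_iff₀ (by positivity)]
      rw [bb_eq, ← hB] at hdir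
      calc _ = κ * (B * (d+1).factorial) * t ^ (d+1) := by ring
        _ ≤ _ := by gcongr
    have hT2 : ∑ k ∈ Finset.range (d+1), be u k y * t ^ k ≤ (κ/4) * B * t ^ (d+1) := by
      have : ∀ k ∈ Finset.range (d+1), be u k y * t ^ k ≤ B * t ^ (d+1) * (2 * ρy / t) := by
        intro k hk
        have hk' := Finset.mem_range.1 hk
        have h3 := h1 k
        obtain ⟨m, hm⟩ : ∃ m, d + 1 = k + (m + 1) := ⟨d - k, by omega⟩
        rw [hm, pow_add, ← mul_assoc, mul_right_comm, ← hm] at h3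
        have h4 := le_of_mul_le_mul_right h3 (by positivity)
        have h5 : (2 * ρy) ^ (m+1) ≤ t ^ (m+1) * (2 * ρy / t) := by
          calc (2 * ρy) ^ (m+1) = (2 * ρy) ^ m * (2 * ρy) := pow_succ _ _
            _ ≤ t ^ m * (2 * ρy) := by gcongr
            _ = _ := by rw [pow_succ]; field_simp
        calc be u k y * t ^ k ≤ (B * (2 * ρy) ^ (m+1)) * t ^ k := by gcongr
          _ ≤ (B * (t ^ (m+1) * (2 * ρy / t))) * t ^ k := by gcongr
          _ = _ := by rw [show t ^ (d+1) = t ^ k * t ^ (m+1) by rw [← pow_add, hm]]; ring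
      refine (Finset.sum_le_sum this).trans ?_
      rw [Finset.sum_const, Finset.card_range, nsmul_eq_mul]
      have h6 : ((d+1 : ℕ):ℝ) * (2 * ρy / t) ≤ κ / 4 := by
        rw [mul_div_assoc', div_le_iff₀ ht]; linarith
      calc _ = (((d+1 : ℕ):ℝ) * (2 * ρy / t)) * B * t ^ (d+1) := by ring
        _ ≤ _ := by gcongr
    have hT3 : B / r * (d+1+1).factorial * 2 ^ (d+1+1+1) * t ^ (d+1+1) / (d+1+1).factorial ≤
        (κ/4) * B * t ^ (d+1) := by
      have h6 : 2 ^ (d+1+1+1) * t / r ≤ κ / 4 := by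
        rw [div_le_iff₀ hr]
        have : (2:ℝ) ^ (d+5) = 2 ^ (d+1+1+1) * 4 := by ring
        rw [this] at htr; linarith
      calc _ = (2 ^ (d+1+1+1) * t / r) * B * t ^ (d+1) := by
            rw [pow_succ t (d+1)]; field_simp
        _ ≤ _ := by gcongr
    linarith
  by_contra hcon
  push Not at hcon
  apply hbad
  refine Pin0_mono (ρ := κ * t / 2 ^ (d+3)) hs0 (by rw [le_div_iff₀ (by positivity)]; linarith) ?_
  intro k
  rw [pow_zero, mul_one, be_zero]
  rcases Nat.eq_zero_or_pos k with rfl | hk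
  · simp [be_zero]
  refine le_trans ?_ hlow
  have hp2 : Pin u y (2 * t) (d+1) := Pin_between (by positivity) (by linarith) htr2 h1 h2
  have h3 := be_le_of_pin g hy hx (R := 2 * t) (by positivity)
    (le_trans (by gcongr) hrE) hp2 (by linarith) k
  rw [hxy, show t / (2 * t) = 1/2 by field_simp] at h3
  norm_num at h3
  have h4 : be u k x * t ^ k ≤ B * 2 ^ (d+2) * t ^ (d+1) := by
    rw [mul_pow, mul_pow] at h3
    refine le_of_mul_le_mul_right ?_ (show (0:ℝ) < 2 ^ k by positivity)
    calc _ = be u k x * (2 ^ k * t ^ k) := by ring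
      _ ≤ _ := h3
      _ = _ := by rw [← hB]; ring
  calc be u k x * (κ * t / 2 ^ (d+3)) ^ k = be u k x * t ^ k * (κ / 2 ^ (d+3)) ^ k := by
        rw [mul_div_right_comm, mul_pow]; ring
    _ ≤ B * 2 ^ (d+2) * t ^ (d+1) * (κ / 2 ^ (d+3)) := by
      have : (κ / 2 ^ (d+3)) ^ k ≤ κ / 2 ^ (d+3) := by
        apply pow_le_of_le_one (by positivity) _ (by omega)
        rw [div_le_one (by positivity)]
        exact hκ1.trans (one_le_pow₀ (by norm_num))
      gcongr
    _ = _ := by rw [pow_succ (2:ℝ) (d+2)]; field_simp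

end D2

section D3
variable {n : ℕ} {u : En n → ℝ}

set_option maxHeartbeats 1000000 in
theorem comp2 {Ω U : Set (En n)} {E M : ℝ} (g : Good u Ω E M) (hU : IsOpen U) (hh : Hm u U)
    (hΩ : Ω ⊆ U) {x0 x y : En n} (hx0 : x0 ∈ Ω) (hy : y ∈ Ω) (hx : x ∈ Ω)
    {r δ ε ρx ρy s κ0 θ : ℝ} {d : ℕ} (hr : 0 < r) (hrE : r * (2 * E) ≤ 1)
    (hs : 0 < s) (hκ0 : 0 < κ0)
    (hε : 76 ^ (d+1) * (3 * n + 1) * (8 * ε) ≤ 1)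
    (hδ : 2 * (((d+1+1 : ℕ):ℝ) * δ) ≤ ε)
    (hδ2 : 2 ^ (d+5) * δ ≤ 1 / (2 * 76 ^ (d+1)))
    (hθ : 0 < θ) (hθ1 : θ ≤ 1/4)
    (hθ2 : 8 * ((d+1 : ℕ):ℝ) * θ ≤ 1 / (2 * 76 ^ (d+1)) * (1 / (20 * (d+1+1 : ℕ))))
    (hθ3 : 2 * κ0 * 2 ^ (d+3) * θ ≤ 1 / (2 * 76 ^ (d+1)) * (1 / (20 * (d+1+1 : ℕ))))
    (hyd : ‖y - x0‖ ≤ δ * r) (hxy : ‖x - y‖ ≤ δ * r)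
    (hp0 : Pin u x0 r (d+1)) (hρx0 : 0 < ρx) (hρy : 0 < ρy) (hρx : 2 * ρx ≤ r)
    (hsy : s ≤ 2 * ρy)
    (h1 : Pin u y (2 * ρy) (d+1)) (h2 : Pin u y r (d+1))
    (hD : s ≤ ρx → Dom u x ρx d)
    (hbx : ¬ Pin u x (κ0 * s) 0) (hby : ¬ Pin u y (κ0 * s) 0)
    (K : Submodule ℝ (En n)) {f g' : En n} (hf : ‖f‖ = 1)
    (hg : ‖g'‖ = 1) (hfg : inner ℝ f g' = (0:ℝ))
    (hK : ∀ v, K.starProjection v = (inner ℝ f v : ℝ) • f + (inner ℝ g' v : ℝ) • g')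
    (hKp : ∀ p ∈ Kᗮ, ‖fderiv ℝ (DD u (d+1)) x0 p‖ ≤ ε * bb u (d+1) x0 * ‖p‖)
    (hπ : ‖Kᗮ.starProjection (x - y)‖ ≤ 1 / (20 * (d+1+1 : ℕ)) / 2 * ρx) :
    θ * ρx ≤ ρy := by
  set τ : ℝ := 1 / (20 * (d+1+1 : ℕ)) with hτ
  set κ : ℝ := 1 / (2 * 76 ^ (d+1)) with hκ
  have hτ0 : 0 < τ := by positivity
  have hκ00 : 0 < κ := by positivity
  have h76 : (1:ℝ) ≤ 76 ^ (d+1) := one_le_pow₀ (by norm_num)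
  have hκ1 : κ ≤ 1 := by rw [hκ, div_le_one (by positivity)]; linarith
  have hpos := Pin_pos hr h2 hby
  by_contra hlt
  push Not at hlt
  have hyx : 4 * ρy ≤ ρx := by nlinarith
  set t := ‖x - y‖ with ht
  have ht0 : 0 ≤ t := norm_nonneg _
  rcases le_or_gt t (τ * ρx) with hcase | hcase
  · by_cases hsx : s ≤ ρx
    · exact near g hy hx hrE hρy hρx hyx h1 h2 hpos hcase (hD hsx)
    · nlinarith
  have htpos : 0 < t := lt_of_le_of_lt (by positivity) hcase
  set β := bb u (d+1) x0 with hβ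
  set b := bb u (d+1) y with hb
  have hb0 : 0 ≤ b := bb_nonneg _ _ _
  have hβ0 : 0 ≤ β := bb_nonneg _ _ _
  have hn1 : (1:ℝ) ≤ 3 * n + 1 := by have : (0:ℝ) ≤ n := by positivity
                                     linarith
  have hδr : 0 ≤ δ := by
    by_contra hneg
    push Not at hneg
    nlinarith
  have hε0 : 0 ≤ ε := le_trans (by positivity) hδ
  have hε8 : 8 * ε ≤ 1 := by
    refine le_trans ?_ hε
    exact le_mul_of_one_le_left (by positivity) (one_le_mul_of_one_le_of_one_le h76 hn1)
  have hP := pert g hx0 hy hr hrE (by linarith) hyd hp0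
  rw [← hβ] at hP
  have hP2 : ‖DD u (d+1+1) y - DD u (d+1+1) x0‖ ≤ ε * β := hP.trans (by gcongr)
  have hβb : β ≤ 2 * b := by
    have e := norm_sub_le (DD u (d+1+1) y) (DD u (d+1+1) y - DD u (d+1+1) x0)
    rw [show DD u (d+1+1) y - (DD u (d+1+1) y - DD u (d+1+1) x0) = DD u (d+1+1) x0 by abel] at e
    have e1 : β ≤ b + ε * β := e.trans (by gcongr; exact le_rfl)
    nlinarith
  set w := t⁻¹ • (x - y) with hw
  have hw1 : ‖w‖ = 1 := by
    rw [hw, norm_smul, norm_inv, Real.norm_of_nonneg ht0, ← ht]; field_simp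
  have hπw : ‖Kᗮ.starProjection w‖ ≤ 1/2 := by
    rw [hw, map_smul, norm_smul, norm_inv, Real.norm_of_nonneg ht0, inv_mul_le_iff₀ htpos]
    linarith
  have hw2 : 1 / 4 ≤ (inner ℝ f w : ℝ) ^ 2 + (inner ℝ g' w : ℝ) ^ 2 := by
    have e1 : ‖K.starProjection w‖ ^ 2 = (inner ℝ f w : ℝ) ^ 2 + (inner ℝ g' w : ℝ) ^ 2 := by
      rw [hK, sq, norm_add_sq_eq_norm_sq_add_norm_sq_real]
      · rw [norm_smul, norm_smul, hf, hg]; simp [← sq]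
      · simp [inner_smul_left, inner_smul_right, hfg]
    rw [← e1]
    have e2 := norm_add_le (Kᗮ.starProjection w) (K.starProjection w)
    rw [show Kᗮ.starProjection w + K.starProjection w = w by
      rw [Submodule.starProjection_orthogonal_val, sub_add_cancel], hw1] at e2
    have e3 : 1/2 ≤ ‖K.starProjection w‖ := by linarith
    calc (1:ℝ)/4 = (1/2)^2 := by norm_num
      _ ≤ _ := by gcongr
  have hdc := dirChain hU (hΩ hy) K hf hg hfg hK (η := 4 * ε * b) (by positivity) hw1.le hw2 (d+1)
    u g.sm hh (by
      intro p hp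
      rw [DD_Dd g.sm]
      have e1 := hKp p hp
      have hP3 : ‖fderiv ℝ (DD u (d+1)) y - fderiv ℝ (DD u (d+1)) x0‖ ≤ ε * β := hP2
      have e2 : ‖(fderiv ℝ (DD u (d+1)) y - fderiv ℝ (DD u (d+1)) x0) p‖ ≤ ε * β * ‖p‖ :=
        (ContinuousLinearMap.le_opNorm _ _).trans (by gcongr)
      have e3 : Dd p (DD u (d+1)) y = (fderiv ℝ (DD u (d+1)) y - fderiv ℝ (DD u (d+1)) x0) p +
          fderiv ℝ (DD u (d+1)) x0 p := by
        rw [_root_.sub_apply, sub_add_cancel]; rfl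
      rw [e3]
      refine (norm_add_le _ _).trans ?_
      have e4 : ε * β * ‖p‖ ≤ ε * (2 * b) * ‖p‖ := by gcongr
      linarith)
  have hdir : κ * b ≤ ‖fderiv ℝ ((Dd w)^[d+1] u) y‖ := by
    set X := ‖fderiv ℝ ((Dd w)^[d+1] u) y‖
    have e1 : b ≤ 76 ^ (d+1) * (X + (3 * n + 1) * (4 * ε * b)) := hdc
    have e2 : 76 ^ (d+1) * (3 * n + 1) * (8 * ε) * b ≤ 1 * b := by gcongr
    rw [hκ, one_div, inv_mul_le_iff₀ (by positivity)]
    linarith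
  have hF := far g hy hx hr hrE hρy htpos rfl hκ00 hκ1
    (by calc _ ≤ 8 * ((d+1 : ℕ):ℝ) * (θ * ρx) := by gcongr
          _ = 8 * ((d+1 : ℕ):ℝ) * θ * ρx := by ring
          _ ≤ κ * τ * ρx := by gcongr
          _ = κ * (τ * ρx) := by ring
          _ ≤ _ := by gcongr)
    (by calc _ ≤ 2 ^ (d+5) * (δ * r) := by gcongr
          _ = 2 ^ (d+5) * δ * r := by ring
          _ ≤ _ := by gcongr)
    h1 h2 hdir hbx (by positivity)
  have : 2 ^ (d+3) * (κ0 * s) ≤ κ * t := by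
    calc _ ≤ 2 ^ (d+3) * (κ0 * (2 * (θ * ρx))) := by gcongr; linarith
      _ = 2 * κ0 * 2 ^ (d+3) * θ * ρx := by ring
      _ ≤ κ * τ * ρx := by gcongr
      _ = κ * (τ * ρx) := by ring
      _ ≤ _ := by gcongr
  linarith

end D3

/-- admissible finite sets -/
structure Adm {n : ℕ} (u : En n → ℝ) (Ω : Set (En n)) (s κ0 : ℝ) (Z : Finset (En n)) : Prop where
  mem : ∀ x ∈ Z, x ∈ Ω
  sep : ∀ x ∈ Z, ∀ y ∈ Z, x ≠ y → s ≤ ‖x - y‖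
  bad : ∀ x ∈ Z, ¬ Pin u x (κ0 * s) 0

/-- the counting claim at order d -/
def Cl {n : ℕ} (u : En n → ℝ) (Ω : Set (En n)) (E s κ0 : ℝ) (d : ℕ) (M : ℝ) : Prop :=
  ∀ (Z : Finset (En n)) (r : ℝ), Adm u Ω s κ0 Z → 0 < r → r * (2 * E) ≤ 1 →
    (∀ x ∈ Z, ∀ y ∈ Z, ‖x - y‖ ≤ r) → (s ≤ r → ∀ x ∈ Z, Dom u x r d) →
    (Z.card : ℝ) ≤ M * (max 1 (r / s)) ^ (n - 2)

/-- scale data -/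
structure Dat {n : ℕ} (u : En n → ℝ) (Ω : Set (En n)) (E s κ0 r : ℝ) (d : ℕ) (Y : Finset (En n))
    (ρ : En n → ℝ) : Prop where
  adm : Adm u Ω s κ0 Y
  hs : 0 < s
  hr : 0 < r
  hrE : r * (2 * E) ≤ 1
  le : ∀ x ∈ Y, 2 * ρ x ≤ r
  sle : ∀ x ∈ Y, s ≤ 2 * ρ x
  pin2 : ∀ x ∈ Y, Pin u x (2 * ρ x) (d+1)
  pinr : ∀ x ∈ Y, Pin u x r (d+1)
  dom : ∀ x ∈ Y, s ≤ ρ x → Dom u x (ρ x) d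

section D4
variable {n : ℕ} {u : En n → ℝ} {Ω : Set (En n)} {E s κ0 : ℝ}

theorem Adm.sub {Z Y : Finset (En n)} (h : Adm u Ω s κ0 Z) (hY : Y ⊆ Z) : Adm u Ω s κ0 Y :=
  ⟨fun x hx => h.mem x (hY hx), fun x hx y hy => h.sep x (hY hx) y (hY hy),
    fun x hx => h.bad x (hY hx)⟩

theorem Dat.pos {r : ℝ} {d : ℕ} {Y : Finset (En n)} {ρ : En n → ℝ}
    (h : Dat u Ω E s κ0 r d Y ρ) {x : En n} (hx : x ∈ Y) : 0 < ρ x := by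
  have := h.sle x hx; have := h.hs; linarith

theorem Cl0 (hs : 0 < s) (hκ : 1 ≤ κ0) : Cl u Ω E s κ0 0 ((4 * (n + 1) * κ0 + 2) ^ n) := by
  intro Z r hZ hr _ hd hD
  have hmax : (1:ℝ) ≤ (max 1 (r / s)) ^ (n - 2) := one_le_pow₀ (le_max_left _ _)
  have hpos : (0:ℝ) ≤ (4 * (n + 1) * κ0 + 2) ^ n := by positivity
  rcases Z.eq_empty_or_nonempty with rfl | ⟨x0, hx0⟩
  · simp; positivity
  have hlt : r < κ0 * s := by
    by_contra hcon
    push Not at hcon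
    have hsr : s ≤ r := by nlinarith
    obtain ⟨k, hk, hp⟩ := hD hsr x0 hx0
    obtain rfl : k = 0 := by omega
    exact hZ.bad x0 hx0 (Pin0_mono (by positivity) hcon hp)
  have := cover_lemma Z (D := κ0 * s) (ℓ := s / 2) (M := 1) (by positivity) (by positivity)
    zero_le_one (fun x hx y hy => (hd x hx y hy).trans hlt.le) (by
      intro Y hY hYd
      have : Y.card ≤ 1 := by
        rw [Finset.card_le_one]
        intro a ha b hb
        by_contra hne
        have h1 := hZ.sep a (hY ha) b (hY hb) hne
        have h2 := hYd a ha b hb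
        linarith
      exact_mod_cast this)
  have h3 : 2 * ((n:ℝ) + 1) * (κ0 * s) / (s / 2) = 4 * (n + 1) * κ0 := by field_simp; norm_num
  rw [h3, mul_one] at this
  exact this.trans (le_mul_of_one_le_right hpos hmax)

theorem cov {d : ℕ} {M : ℝ} (hM : 0 ≤ M) (h : Cl u Ω E s κ0 d M)
    {Z : Finset (En n)} (hZ : Adm u Ω s κ0 Z) {D ℓ : ℝ} (hD : 0 ≤ D) (hℓ : 0 < ℓ)
    (hℓE : ℓ * (2 * E) ≤ 1) (hd : ∀ x ∈ Z, ∀ y ∈ Z, ‖x - y‖ ≤ D)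
    (hdom : s ≤ ℓ → ∀ x ∈ Z, Dom u x ℓ d) :
    (Z.card : ℝ) ≤ (2 * (n + 1) * D / ℓ + 2) ^ n * (M * (max 1 (ℓ / s)) ^ (n - 2)) := by
  refine cover_lemma Z hD hℓ (by positivity) hd fun Y hY hYd => ?_
  exact h Y ℓ (hZ.sub hY) hℓ hℓE hYd fun hs x hx => hdom hs x (hY hx)

theorem rho_ex {x : En n} {r : ℝ} {d : ℕ} (hs : 0 < s) (hr : 0 < r) (hsr : s ≤ r)
    (h1 : Dom u x r (d+1)) (h2 : ¬ Dom u x r d) :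
    ∃ j : ℕ, 2 * (r / 2 ^ j) ≤ r ∧ s ≤ 2 * (r / 2 ^ j) ∧ Pin u x (2 * (r / 2 ^ j)) (d+1) ∧
      (s ≤ r / 2 ^ j → Dom u x (r / 2 ^ j) d) := by
  classical
  have hex : ∃ j : ℕ, r / 2 ^ j < s ∨ Dom u x (r / 2 ^ j) d := by
    obtain ⟨j, hj⟩ := pow_unbounded_of_one_lt (r / s) (one_lt_two (α := ℝ))
    refine ⟨j, Or.inl ?_⟩
    rw [div_lt_iff₀ hs] at hj
    rw [div_lt_iff₀ (by positivity)]; linarith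
  set j := Nat.find hex with hj
  have hP := Nat.find_spec hex
  rw [← hj] at hP
  have hj0 : j ≠ 0 := by
    intro h0
    rw [h0] at hP
    simp only [pow_zero, div_one] at hP
    rcases hP with h | h
    · linarith
    · exact h2 h
  obtain ⟨i, hi⟩ := Nat.exists_eq_succ_of_ne_zero hj0
  have hmin := Nat.find_min hex (m := i) (by rw [← hj]; omega)
  push Not at hmin
  have e : 2 * (r / 2 ^ j) = r / 2 ^ i := by rw [hi, pow_succ]; field_simp
  have hle : r / 2 ^ i ≤ r := div_le_self hr.le (one_le_pow₀ (by norm_num))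
  refine ⟨j, by rw [e]; exact hle, by rw [e]; exact hmin.1, ?_, fun h => ?_⟩
  · rw [e]
    exact Dom_pin (Dom_mono (by positivity) hle h1) hmin.2
  · rcases hP with h' | h'
    · linarith
    · exact h'

theorem starProj_norm (K : Submodule ℝ (En n)) (v : En n) :
    ‖K.orthogonalProjectionOnto v‖ = ‖K.starProjection v‖ := rfl

theorem fiber {M0 : ℝ} (g : Good u Ω E M0) {r δ A c1 : ℝ} {d : ℕ} {Y : Finset (En n)}
    {ρ : En n → ℝ} (h : Dat u Ω E s κ0 r d Y ρ) {x0 : En n} (hx0 : x0 ∈ Y)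
    (hδ : ((d+1+1 : ℕ):ℝ) * δ ≤ 1/2)
    (hdiam : ∀ x ∈ Y, ∀ y ∈ Y, ‖x - y‖ ≤ δ * r) (hA : 1 ≤ A) (hc1 : c1 ≤ 1)
    (hAε : A * (2 * (((d+1+1 : ℕ):ℝ) * δ)) ≤ 1/4) (K : Submodule ℝ (En n))
    (hK : ∀ v, ‖K.starProjection v‖ * bb u (d+1) x0 ≤ A * ‖fderiv ℝ (DD u (d+1)) x0 v‖)
    {p : Kᗮ} {x y : En n} (hx : x ∈ Y) (hy : y ∈ Y)
    (hxp : ‖Kᗮ.orthogonalProjectionOnto x - p‖ < c1 * ρ x)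
    (hyp : ‖Kᗮ.orthogonalProjectionOnto y - p‖ < c1 * ρ y) :
    ‖Kᗮ.starProjection (x - y)‖ ≤ c1 * (ρ x + ρ y) ∧ ‖x - y‖ ≤ 8 * A * (ρ x + ρ y) := by
  have h1 : ‖Kᗮ.starProjection (x - y)‖ ≤ c1 * (ρ x + ρ y) := by
    rw [← starProj_norm, map_sub]
    have : Kᗮ.orthogonalProjectionOnto x - Kᗮ.orthogonalProjectionOnto y =
      (Kᗮ.orthogonalProjectionOnto x - p) - (Kᗮ.orthogonalProjectionOnto y - p) := by abel
    rw [this]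
    refine (norm_sub_le _ _).trans ?_
    linarith
  refine ⟨h1, ?_⟩
  have hb : 0 < bb u (d+1) x0 := by
    rw [bb_eq]; have := Pin_pos h.hr (h.pinr x0 hx0) (h.adm.bad x0 hx0); positivity
  have h2 := cone g (h.adm.mem x0 hx0) (h.adm.mem x hx) (h.adm.mem y hy) h.hr h.hrE hδ
    (hdiam x hx x0 hx0) (hdiam y hy x0 hx0) (h.pinr x0 hx0) (h.pos hx) (h.pos hy)
    (h.pin2 x hx) (h.pin2 y hy) hb (by linarith) hAε K hK
  have h3 : c1 * (ρ x + ρ y) ≤ A * (ρ x + ρ y) :=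
    mul_le_mul_of_nonneg_right (by linarith) (by have := h.pos hx; have := h.pos hy; linarith)
  have h4 : 0 ≤ A * (ρ x + ρ y) :=
    mul_nonneg (by linarith) (by have := h.pos hx; have := h.pos hy; linarith)
  linarith

theorem finrank_perp {K : Submodule ℝ (En n)} {m : ℕ} (h : Module.finrank ℝ K = m) :
    Module.finrank ℝ Kᗮ = n - m := by
  have := Submodule.finrank_add_finrank_orthogonal K
  rw [finrank_euclideanSpace_fin, h] at this
  omega

theorem count2 {M0 : ℝ} (g : Good u Ω E M0) {r δ A c1 θ M : ℝ} {d : ℕ} {Y : Finset (En n)}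
    {ρ : En n → ℝ} (h : Dat u Ω E s κ0 r d Y ρ) {x0 : En n} (hx0 : x0 ∈ Y)
    (hM : 0 ≤ M) (hCl : Cl u Ω E s κ0 d M)
    (hδ : ((d+1+1 : ℕ):ℝ) * δ ≤ 1/2) (hδ1 : δ ≤ 1)
    (hdiam : ∀ x ∈ Y, ∀ y ∈ Y, ‖x - y‖ ≤ δ * r) (hA : 1 ≤ A) (hc0 : 0 < c1) (hc1 : c1 ≤ 1)
    (hθ : 0 < θ) (hθ1 : θ ≤ 1)
    (hAε : A * (2 * (((d+1+1 : ℕ):ℝ) * δ)) ≤ 1/4) (K : Submodule ℝ (En n))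
    (hK2 : Module.finrank ℝ K = 2)
    (hK : ∀ v, ‖K.starProjection v‖ * bb u (d+1) x0 ≤ A * ‖fderiv ℝ (DD u (d+1)) x0 v‖)
    (hcmp : ∀ x ∈ Y, ∀ y ∈ Y, ‖Kᗮ.starProjection (x - y)‖ ≤ c1 * (ρ x + ρ y) → θ * ρ x ≤ ρ y) :
    (Y.card : ℝ) ≤ (32 * (n + 1) * A / θ + 2) ^ n * (4 / (c1 * θ)) ^ (n - 2) * M *
      (r / s) ^ (n - 2) := by
  have hs := h.hs
  have hr := h.hr
  have hE := g.hE
  have hfr := finrank_perp hK2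
  have key := int_lemma Y (fun x => Kᗮ.orthogonalProjectionOnto x) (fun x => c1 * ρ x)
    (q := Kᗮ.orthogonalProjectionOnto x0) (R := r)
    (M := (32 * (n + 1) * A / θ + 2) ^ n * M * (2 / (c1 * θ * s)) ^ (n - 2)) hr
    (by positivity) (fun x hx => mul_pos hc0 (h.pos hx))
    (fun x hx => by
      have h1 := h.le x hx; have h2 := h.pos hx
      have : c1 * ρ x ≤ 1 * ρ x := by gcongr
      linarith)
    (fun x hx => by
      rw [← map_sub]
      refine (Submodule.norm_orthogonalProjectionOnto_apply_le _ _).trans ?_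
      refine (hdiam x hx x0 hx0).trans ?_
      exact mul_le_of_le_one_left hr.le hδ1)
    (by
      intro p
      rw [hfr]
      set Yp := Y.filter (fun x => ‖Kᗮ.orthogonalProjectionOnto x - p‖ < c1 * ρ x) with hYp
      have hsub : Yp ⊆ Y := Finset.filter_subset _ _
      rcases Yp.eq_empty_or_nonempty with he | hne
      · rw [he, Finset.sum_empty]; positivity
      obtain ⟨z, hz, hmax⟩ := Yp.exists_max_image ρ hne
      have hzY := hsub hz
      have hρ0 := h.pos hzY
      have hfib : ∀ x ∈ Yp, ∀ y ∈ Yp, ‖Kᗮ.starProjection (x - y)‖ ≤ c1 * (ρ x + ρ y) ∧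
          ‖x - y‖ ≤ 8 * A * (ρ x + ρ y) := by
        intro x hx y hy
        rw [hYp, Finset.mem_filter] at hx hy
        exact fiber g h hx0 hδ hdiam hA hc1 hAε K hK hx.1 hy.1 hx.2 hy.2
      have hlow : ∀ y ∈ Yp, θ * ρ z ≤ ρ y := fun y hy =>
        hcmp z hzY y (hsub hy) (hfib z hz y hy).1
      have hcard := cov hM hCl (h.adm.sub hsub) (D := 16 * A * ρ z) (ℓ := θ * ρ z)
        (by positivity) (by positivity)
        (by
          refine le_trans ?_ h.hrE
          have := h.le z hzY
          have : θ * ρ z ≤ 1 * ρ z := by gcongr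
          gcongr; linarith)
        (fun x hx y hy => (hfib x hx y hy).2.trans (by
          have := hmax x hx; have := hmax y hy
          calc 8 * A * (ρ x + ρ y) ≤ 8 * A * (ρ z + ρ z) := by gcongr
            _ = _ := by ring))
        (fun hsl x hx => Dom_mono (by positivity) (hlow x hx)
          (h.dom x (hsub hx) (hsl.trans (hlow x hx))))
      have e1 : 2 * ((n:ℝ) + 1) * (16 * A * ρ z) / (θ * ρ z) = 32 * (n + 1) * A / θ := by
        field_simp; norm_num
      rw [e1] at hcard
      have e2 : max 1 (θ * ρ z / s) ≤ 2 * ρ z / s := by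
        apply max_le
        · rw [le_div_iff₀ hs]; have := h.sle z hzY; linarith
        · gcongr
          linarith
      calc ∑ x ∈ Yp, ((c1 * ρ x)⁻¹) ^ (n - 2) ≤ ∑ x ∈ Yp, ((c1 * (θ * ρ z))⁻¹) ^ (n-2) := by
            apply Finset.sum_le_sum
            intro x hx
            have := hlow x hx
            have := h.pos (hsub hx)
            gcongr
        _ = Yp.card * ((c1 * (θ * ρ z))⁻¹) ^ (n-2) := by rw [Finset.sum_const, nsmul_eq_mul]
        _ ≤ ((32 * (n + 1) * A / θ + 2) ^ n * (M * (2 * ρ z / s) ^ (n - 2))) *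
            ((c1 * (θ * ρ z))⁻¹) ^ (n-2) := by
            gcongr
            refine hcard.trans ?_
            gcongr
        _ = (32 * (n + 1) * A / θ + 2) ^ n * M * ((2 * ρ z / s) * (c1 * (θ * ρ z))⁻¹) ^ (n - 2) := by
            rw [mul_pow (2 * ρ z / s)]; ring
        _ = _ := by
            congr 2
            field_simp)
  rw [hfr] at key
  refine key.trans (le_of_eq ?_)
  have : (2 * r) * (2 / (c1 * θ * s)) = 4 / (c1 * θ) * (r / s) := by field_simp; norm_num
  calc _ = (32 * (n + 1) * A / θ + 2) ^ n * M * ((2 * r) * (2 / (c1 * θ * s))) ^ (n - 2) := by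
        rw [mul_pow (2 * r)]; ring
    _ = _ := by rw [this, mul_pow]; ring

theorem geo_sum (J : Finset ℕ) : ∑ j ∈ J, (1 / 2 : ℝ) ^ j ≤ 2 := by
  have := summable_geometric_two.sum_le_tsum J (fun i _ => by positivity)
  rwa [tsum_geometric_two] at this

theorem count3 {M0 : ℝ} (g : Good u Ω E M0) {r δ A c1 M : ℝ} {d : ℕ} {Y : Finset (En n)}
    {jj : En n → ℕ} (h : Dat u Ω E s κ0 r d Y (fun x => r / 2 ^ jj x)) {x0 : En n} (hx0 : x0 ∈ Y)
    (hM : 0 ≤ M) (hCl : Cl u Ω E s κ0 d M)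
    (hδ : ((d+1+1 : ℕ):ℝ) * δ ≤ 1/2) (hδ1 : δ ≤ 1)
    (hdiam : ∀ x ∈ Y, ∀ y ∈ Y, ‖x - y‖ ≤ δ * r) (hA : 1 ≤ A) (hc0 : 0 < c1) (hc1 : c1 ≤ 1)
    (hAε : A * (2 * (((d+1+1 : ℕ):ℝ) * δ)) ≤ 1/4) (K : Submodule ℝ (En n))
    (hK2 : Module.finrank ℝ K = 3)
    (hK : ∀ v, ‖K.starProjection v‖ * bb u (d+1) x0 ≤ A * ‖fderiv ℝ (DD u (d+1)) x0 v‖) :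
    (Y.card : ℝ) ≤ (32 * (n + 1) * A + 2) ^ n * (4 * (4 / c1) ^ (n - 3)) * M *
      (r / s) ^ (n - 2) := by
  classical
  have hs := h.hs
  have hr := h.hr
  have hE := g.hE
  have hfr := finrank_perp hK2
  have hn3 : 3 ≤ n := by
    have := Submodule.finrank_le K
    rwa [hK2, finrank_euclideanSpace_fin] at this
  have hn2 : n - 2 = (n - 3) + 1 := by omega
  set ρ : En n → ℝ := fun x => r / 2 ^ jj x with hρ
  set G := (32 * (n + 1) * A + 2) ^ n * M with hG
  have hG0 : 0 ≤ G := by positivity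
  have key := int_lemma Y (fun x => Kᗮ.orthogonalProjectionOnto x) (fun x => c1 * ρ x)
    (q := Kᗮ.orthogonalProjectionOnto x0) (R := r)
    (M := G * ((2 / s) ^ (n - 2) * (1 / c1) ^ (n - 3)) * (2 * r)) hr
    (by positivity) (fun x hx => mul_pos hc0 (h.pos hx))
    (fun x hx => by
      have h1 := h.le x hx; have h2 := h.pos hx
      have : c1 * ρ x ≤ 1 * ρ x := by gcongr
      linarith)
    (fun x hx => by
      rw [← map_sub]
      refine (Submodule.norm_orthogonalProjectionOnto_apply_le _ _).trans ?_
      refine (hdiam x hx x0 hx0).trans ?_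
      exact mul_le_of_le_one_left hr.le hδ1)
    (by
      intro p
      rw [hfr]
      set Yp := Y.filter (fun x => ‖Kᗮ.orthogonalProjectionOnto x - p‖ < c1 * ρ x) with hYp
      have hsub : Yp ⊆ Y := Finset.filter_subset _ _
      have hfib : ∀ x ∈ Yp, ∀ y ∈ Yp, ‖x - y‖ ≤ 8 * A * (ρ x + ρ y) := by
        intro x hx y hy
        rw [hYp, Finset.mem_filter] at hx hy
        exact (fiber g h hx0 hδ hdiam hA hc1 hAε K hK hx.1 hy.1 hx.2 hy.2).2
      rw [← Finset.sum_fiberwise_of_maps_to (t := Yp.image jj) (g := jj)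
        (fun x hx => Finset.mem_image_of_mem _ hx)]
      have hj : ∀ j ∈ Yp.image jj, ∑ x ∈ Yp with jj x = j, ((c1 * ρ x)⁻¹) ^ (n - 3) ≤
          G * ((2 / s) ^ (n - 2) * (1 / c1) ^ (n - 3)) * (r * (1/2) ^ j) := by
        intro j hj
        obtain ⟨z, hz, hzj⟩ := Finset.mem_image.1 hj
        set W := Yp.filter (fun x => jj x = j) with hW
        have hWY : W ⊆ Yp := Finset.filter_subset _ _
        have hWj : ∀ x ∈ W, ρ x = r / 2 ^ j := by
          intro x hx; rw [hW, Finset.mem_filter] at hx; simp only [hρ]; rw [hx.2]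
        set a := r / 2 ^ j with ha
        have hza : ρ z = a := by simp only [hρ]; rw [hzj]
        have ha0 : 0 < a := by positivity
        have hcard := cov hM hCl (h.adm.sub (hWY.trans hsub)) (D := 16 * A * a) (ℓ := a)
          (by positivity) ha0
          (by
            refine le_trans ?_ h.hrE
            have := h.le z (hsub hz)
            have : a ≤ r := by rw [← hza]; have := h.pos (hsub hz); simp only [hρ] at *; linarith
            gcongr)
          (fun x hx y hy => (hfib x (hWY hx) y (hWY hy)).trans (by
            rw [hWj x hx, hWj y hy]; apply le_of_eq; ring))
          (fun hsl x hx => by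
            have := h.dom x (hsub (hWY hx))
            rw [← hWj x hx] at hsl ⊢
            exact this hsl)
        have e1 : 2 * ((n:ℝ) + 1) * (16 * A * a) / a = 32 * (n + 1) * A := by
          field_simp; norm_num
        rw [e1] at hcard
        have e2 : max 1 (a / s) ≤ 2 * a / s := by
          apply max_le
          · rw [le_div_iff₀ hs, ← hza]; have := h.sle z (hsub hz); simp only [hρ] at *; linarith
          · gcongr
            linarith
        calc ∑ x ∈ W, ((c1 * ρ x)⁻¹) ^ (n - 3) = ∑ x ∈ W, ((c1 * a)⁻¹) ^ (n - 3) := by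
              refine Finset.sum_congr rfl fun x hx => by rw [hWj x hx]
          _ = W.card * ((c1 * a)⁻¹) ^ (n - 3) := by rw [Finset.sum_const, nsmul_eq_mul]
          _ ≤ ((32 * (n + 1) * A + 2) ^ n * (M * (2 * a / s) ^ (n - 2))) *
              ((c1 * a)⁻¹) ^ (n - 3) := by
            gcongr
            refine hcard.trans ?_
            gcongr
          _ = G * ((2 / s) ^ (n - 2) * (1 / c1) ^ (n - 3)) * a := by
            rw [hG, hn2, pow_succ, pow_succ, mul_inv, mul_pow, ← div_mul_eq_mul_div, mul_pow,
              inv_pow a]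
            field_simp
          _ = _ := by rw [ha, one_div_pow (2:ℝ) j, mul_one_div]
      refine (Finset.sum_le_sum hj).trans ?_
      rw [← Finset.mul_sum, ← Finset.mul_sum]
      have := geo_sum (Yp.image jj)
      calc _ ≤ G * ((2 / s) ^ (n - 2) * (1 / c1) ^ (n - 3)) * (r * 2) := by gcongr
        _ = _ := by ring)
  rw [hfr] at key
  refine key.trans (le_of_eq ?_)
  rw [hG, hn2]
  simp only [pow_succ, mul_pow, div_pow, one_pow]
  rw [show (4:ℝ) = 2 * 2 by norm_num, mul_pow]
  field_simp

end D4

/-- parameters -/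
noncomputable def epsP (n d : ℕ) : ℝ := 1 / (8 * (3 * n + 1) * 76 ^ (d+1))
/-- parameters -/
noncomputable def delP (n d : ℕ) : ℝ := 1 / (64 * (18 * n + 23) * (3 * n + 1) * 152 ^ (d+1))
/-- parameters -/
noncomputable def theP (κ0 : ℝ) (d : ℕ) : ℝ := 1 / (320 * κ0 * 304 ^ (d+1))
/-- parameters -/
noncomputable def c1P (d : ℕ) : ℝ := 1 / (20 * (d+1+1 : ℕ)) / 4
/-- parameters -/
noncomputable def facG (n : ℕ) (κ0 : ℝ) (d : ℕ) : ℝ :=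
  (32 * (n + 1) * (9 * n + 11) / theP κ0 d + 2) ^ n * (4 / (c1P d * theP κ0 d)) ^ (n - 2) +
    (32 * (n + 1) * ((18 * n + 23) / epsP n d) + 2) ^ n * (4 * (4 / c1P d) ^ (n - 3))
/-- parameters -/
noncomputable def facP (n : ℕ) (κ0 : ℝ) (d : ℕ) : ℝ :=
  1 + (2 * (n + 1) / delP n d + 2) ^ n * facG n κ0 d

section D5
variable {n : ℕ} {u : En n → ℝ} {Ω : Set (En n)} {E s κ0 : ℝ}

theorem two_pow_ge (d : ℕ) : ((d+1+1 : ℕ):ℝ) ≤ 2 ^ (d+1) := by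
  have : d + 1 + 1 ≤ 2 ^ (d+1) := Nat.lt_two_pow_self
  exact_mod_cast this

theorem par1 (d : ℕ) : 76 ^ (d+1) * (3 * n + 1) * (8 * epsP n d) ≤ 1 := by
  unfold epsP; apply le_of_eq; field_simp

theorem eps_le (d : ℕ) : epsP n d ≤ 1 / 8 := by
  unfold epsP
  have : (1:ℝ) ≤ 76 ^ (d+1) := one_le_pow₀ (by norm_num)
  have hn : (0:ℝ) ≤ n := by positivity
  gcongr
  calc (8:ℝ) = 8 * 1 * 1 := by norm_num
    _ ≤ _ := by gcongr; linarith

theorem eps_pos (d : ℕ) : 0 < epsP n d := by unfold epsP; positivity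
theorem del_pos (d : ℕ) : 0 < delP n d := by unfold delP; positivity
theorem c1_pos (d : ℕ) : 0 < c1P d := by unfold c1P; positivity
theorem the_pos (h : 1 ≤ κ0) (d : ℕ) : 0 < theP κ0 d := by unfold theP; positivity

theorem par2 (d : ℕ) : (18 * n + 23) / epsP n d * (2 * (((d+1+1 : ℕ):ℝ) * delP n d)) ≤ 1/4 := by
  have h := two_pow_ge d
  have e : (18 * (n:ℝ) + 23) / epsP n d * (2 * (((d+1+1 : ℕ):ℝ) * delP n d)) =
    ((d+1+1 : ℕ):ℝ) / 2 ^ (d+1) / 4 := by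
    unfold epsP delP
    rw [show (152:ℝ) = 2 * 76 by norm_num, mul_pow]
    field_simp
    norm_num
  rw [e]
  have : ((d+1+1 : ℕ):ℝ) / 2 ^ (d+1) ≤ 1 := by rw [div_le_one (by positivity)]; exact h
  linarith

theorem par3 (d : ℕ) : 2 * (((d+1+1 : ℕ):ℝ) * delP n d) ≤ epsP n d := by
  have h := par2 (n := n) d
  have h0 := eps_pos (n := n) d
  rw [div_mul_eq_mul_div, div_le_iff₀ h0] at h
  have hn : (0:ℝ) ≤ n := by positivity
  have hd := del_pos (n := n) d
  have : 0 ≤ 2 * (((d+1+1 : ℕ):ℝ) * delP n d) := by positivity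
  nlinarith

theorem par4 (d : ℕ) : 2 ^ (d+5) * delP n d ≤ 1 / (2 * 76 ^ (d+1)) := by
  have hn : (0:ℝ) ≤ n := by positivity
  have e : 2 ^ (d+5) * delP n d = 1 / (2 * 76 ^ (d+1)) * (1 / (2 * (18 * n + 23) * (3 * n + 1))) := by
    unfold delP
    rw [show (152:ℝ) = 2 * 76 by norm_num, mul_pow, show (2:ℝ) ^ (d+5) = 2 ^ (d+1) * 16 by ring]
    field_simp
    norm_num
  rw [e]
  apply mul_le_of_le_one_right (by positivity)
  rw [div_le_one (by positivity)]
  nlinarith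

theorem the_le (h : 1 ≤ κ0) (d : ℕ) : theP κ0 d ≤ 1/4 := by
  unfold theP
  have : (1:ℝ) ≤ 304 ^ (d+1) := one_le_pow₀ (by norm_num)
  gcongr
  nlinarith

theorem par5 (h : 1 ≤ κ0) (d : ℕ) : 8 * ((d+1 : ℕ):ℝ) * theP κ0 d ≤
    1 / (2 * 76 ^ (d+1)) * (1 / (20 * (d+1+1 : ℕ))) := by
  have h1 := two_pow_ge d
  have h2 : ((d+1 : ℕ):ℝ) ≤ 2 ^ (d+1) := le_trans (by push_cast; linarith) h1
  unfold theP
  rw [show (304:ℝ) = 2 * 2 * 76 by norm_num, mul_pow, mul_pow]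
  rw [div_mul_div_comm, mul_one_div, div_le_div_iff₀ (by positivity) (by positivity)]
  calc 8 * ((d+1 : ℕ):ℝ) * ((2 * 76 ^ (d+1)) * (20 * (d+1+1 : ℕ)))
      = 320 * 1 * (((d+1 : ℕ):ℝ) * (d+1+1 : ℕ) * 76 ^ (d+1)) := by ring
    _ ≤ 320 * κ0 * (2 ^ (d+1) * 2 ^ (d+1) * 76 ^ (d+1)) := by gcongr
    _ = _ := by ring

theorem par6 (h : 1 ≤ κ0) (d : ℕ) : 2 * κ0 * 2 ^ (d+3) * theP κ0 d ≤
    1 / (2 * 76 ^ (d+1)) * (1 / (20 * (d+1+1 : ℕ))) := by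
  have h1 := two_pow_ge d
  unfold theP
  rw [show (304:ℝ) = 2 * 2 * 76 by norm_num, mul_pow, mul_pow]
  rw [div_mul_div_comm, mul_one_div, div_le_div_iff₀ (by positivity) (by positivity)]
  calc 2 * κ0 * 2 ^ (d+3) * ((2 * 76 ^ (d+1)) * (20 * (d+1+1 : ℕ)))
      = 320 * κ0 * (2 ^ (d+1) * (d+1+1 : ℕ) * 76 ^ (d+1)) := by ring
    _ ≤ 320 * κ0 * (2 ^ (d+1) * 2 ^ (d+1) * 76 ^ (d+1)) := by gcongr
    _ = _ := by ring

theorem facG_nonneg (h : 1 ≤ κ0) (d : ℕ) : 0 ≤ facG n κ0 d := by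
  have := eps_pos (n := n) d; have := c1_pos d; have := the_pos h d
  unfold facG; positivity

theorem facP_ge (h : 1 ≤ κ0) (d : ℕ) : 1 ≤ facP n κ0 d := by
  have := facG_nonneg (n := n) h d; have := del_pos (n := n) d
  unfold facP
  have : 0 ≤ (2 * (n + 1) / delP n d + 2) ^ n * facG n κ0 d := by positivity
  linarith

set_option maxHeartbeats 1000000 in
theorem piece {M0 : ℝ} (g : Good u Ω E M0) {U : Set (En n)} (hU : IsOpen U) (hh : Hm u U)
    (hΩ : Ω ⊆ U) (hκ : 1 ≤ κ0) {r M : ℝ} {d : ℕ} {Y : Finset (En n)}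
    {jj : En n → ℕ} (h : Dat u Ω E s κ0 r d Y (fun x => r / 2 ^ jj x))
    (hM : 0 ≤ M) (hCl : Cl u Ω E s κ0 d M)
    (hdiam : ∀ x ∈ Y, ∀ y ∈ Y, ‖x - y‖ ≤ delP n d * r) :
    (Y.card : ℝ) ≤ facG n κ0 d * M * (r / s) ^ (n - 2) := by
  have hε0 := eps_pos (n := n) d
  have hε1 := eps_le (n := n) d
  have hδ0 := del_pos (n := n) d
  have hc0 := c1_pos d
  have hθ0 := the_pos hκ d
  have hθ1 := the_le hκ d
  have hr := h.hr
  have hs := h.hs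
  have hn : (0:ℝ) ≤ n := by positivity
  have hRHS : 0 ≤ facG n κ0 d * M * (r / s) ^ (n - 2) := by
    have := facG_nonneg (n := n) hκ d; positivity
  rcases Y.eq_empty_or_nonempty with rfl | ⟨x0, hx0⟩
  · simpa using hRHS
  have hp3 := par3 (n := n) d
  have hδd : ((d+1+1 : ℕ):ℝ) * delP n d ≤ 1/2 := by linarith
  have hδ1 : delP n d ≤ 1 := by
    have : (1:ℝ) ≤ ((d+1+1 : ℕ):ℝ) := by push_cast; have : (0:ℝ) ≤ d := by positivity
                                         linarith
    nlinarith
  have hc1 : c1P d ≤ 1 := by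
    unfold c1P
    rw [div_div, div_le_one (by positivity)]; push_cast
    have : (0:ℝ) ≤ d := by positivity
    linarith
  have hb : 0 < bb u (d+1) x0 := by
    rw [bb_eq]; have := Pin_pos h.hr (h.pinr x0 hx0) (h.adm.bad x0 hx0); positivity
  set B : En n →L[ℝ] En n →L[ℝ] (TT n d).α := fderiv ℝ (fderiv ℝ (DD u d)) x0 with hB
  have hBn : ‖B‖ = bb u (d+1) x0 := rfl
  have hBv : ∀ v, ‖B v‖ = ‖fderiv ℝ (DD u (d+1)) x0 v‖ := fun v => rfl
  obtain ⟨K, f, g', hf, hg, hfg, hK, hK2, hKA, hcase⟩ := LA_main B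
    (fun v w => snd_symm (Sm_DD g.sm d) x0 v w)
    (by
      have := Hm_DD hU g.sm hh d x0 (hΩ (h.adm.mem x0 hx0))
      simp only [Dd_fderiv (Sm_DD g.sm d)] at this
      exact this)
    (by rw [hBn]; exact hb) hε0 (by linarith)
  have hA3 : 9 * (n:ℝ) + 11 ≤ (18 * n + 23) / epsP n d := by
    rw [le_div_iff₀ hε0]; nlinarith
  have hp2 := par2 (n := n) d
  have hδnn : 0 ≤ 2 * (((d+1+1 : ℕ):ℝ) * delP n d) := by positivity
  unfold facG
  rw [hBn] at hKA hcase
  simp only [hBv] at hKA hcase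
  rcases hcase with hcase | ⟨K', hK3, hKA3⟩
  · have := count2 g h hx0 hM hCl hδd hδ1 hdiam (A := 9 * n + 11) (by linarith) hc0 hc1 hθ0
      (by linarith) (le_trans (by gcongr) hp2) K hK2 hKA (by
        intro x hx y hy hπ
        rcases le_total (r / 2 ^ jj x) (r / 2 ^ jj y) with hle | hle
        · refine le_trans ?_ hle
          exact mul_le_of_le_one_left (by positivity) (by linarith)
        · exact comp2 g hU hh hΩ (h.adm.mem x0 hx0) (h.adm.mem y hy) (h.adm.mem x hx) hr h.hrE hs
            (by linarith) (par1 d) hp3 (par4 d) hθ0 hθ1 (par5 hκ d) (par6 hκ d)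
            (hdiam y hy x0 hx0) (hdiam x hx y hy) (h.pinr x0 hx0) (h.pos hx) (h.pos hy)
            (h.le x hx) (h.sle y hy) (h.pin2 y hy) (h.pinr y hy) (h.dom x hx)
            (h.adm.bad x hx) (h.adm.bad y hy) K hf hg hfg hK hcase
            (by
              refine hπ.trans ?_
              calc c1P d * (r / 2 ^ jj x + r / 2 ^ jj y) ≤ c1P d * (r / 2 ^ jj x + r / 2 ^ jj x) := by
                    gcongr
                _ = _ := by unfold c1P; ring))
    refine this.trans ?_
    gcongr
    apply le_add_of_nonneg_right
    positivity
  · have := count3 g h hx0 hM hCl hδd hδ1 hdiam (A := (18 * n + 23) / epsP n d) (by linarith) hc0 hc1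
      hp2 K' hK3 hKA3
    refine this.trans ?_
    gcongr
    apply le_add_of_nonneg_left
    positivity

theorem step {M0 : ℝ} (g : Good u Ω E M0) {U : Set (En n)} (hU : IsOpen U) (hh : Hm u U)
    (hΩ : Ω ⊆ U) (hs : 0 < s) (hκ : 1 ≤ κ0) {M : ℝ} {d : ℕ}
    (hM : 1 ≤ M) (hCl : Cl u Ω E s κ0 d M) : Cl u Ω E s κ0 (d+1) (facP n κ0 d * M) := by
  classical
  intro Z r hZ hr hrE hd hD
  have hδ0 := del_pos (n := n) d
  have hG := facG_nonneg (n := n) hκ d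
  have hF := facP_ge (n := n) hκ d
  have hmax : (1:ℝ) ≤ (max 1 (r / s)) ^ (n - 2) := one_le_pow₀ (le_max_left _ _)
  rcases lt_or_ge r s with hrs | hsr
  · have : Z.card ≤ 1 := by
      rw [Finset.card_le_one]
      intro a ha b hb
      by_contra hne
      have h1 := hZ.sep a ha b hb hne
      have h2 := hd a ha b hb
      linarith
    have h1 : (Z.card : ℝ) ≤ 1 := by exact_mod_cast this
    refine h1.trans ?_
    exact one_le_mul_of_one_le_of_one_le (one_le_mul_of_one_le_of_one_le hF hM) hmax
  have hD' := hD hsr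
  set Z1 := Z.filter (fun x => Dom u x r d) with hZ1
  set Z2 := Z.filter (fun x => ¬ Dom u x r d) with hZ2
  have hcard : Z.card = Z1.card + Z2.card := (Finset.card_filter_add_card_filter_not _).symm
  have hs1 : Z1 ⊆ Z := Finset.filter_subset _ _
  have hs2 : Z2 ⊆ Z := Finset.filter_subset _ _
  have h1 := hCl Z1 r (hZ.sub hs1) hr hrE (fun x hx y hy => hd x (hs1 hx) y (hs1 hy))
    (fun _ x hx => (Finset.mem_filter.1 hx).2)
  have hex : ∀ x : En n, ∃ j : ℕ, x ∈ Z2 → 2 * (r / 2 ^ j) ≤ r ∧ s ≤ 2 * (r / 2 ^ j) ∧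
      Pin u x (2 * (r / 2 ^ j)) (d+1) ∧ (s ≤ r / 2 ^ j → Dom u x (r / 2 ^ j) d) := by
    intro x
    by_cases hx : x ∈ Z2
    · obtain ⟨j, hj⟩ := rho_ex hs hr hsr (hD' x (hs2 hx)) (Finset.mem_filter.1 hx).2
      exact ⟨j, fun _ => hj⟩
    · exact ⟨0, fun h => absurd h hx⟩
  choose jj hjj using hex
  have h2 := cover_lemma Z2 (D := r) (ℓ := delP n d * r)
    (M := facG n κ0 d * M * (r / s) ^ (n - 2)) hr.le (by positivity) (by positivity)
    (fun x hx y hy => hd x (hs2 hx) y (hs2 hy)) (by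
      intro Y hY hYd
      refine piece g hU hh hΩ hκ (jj := jj) ?_ (by linarith) hCl hYd
      exact {
        adm := hZ.sub (hY.trans hs2)
        hs := hs
        hr := hr
        hrE := hrE
        le := fun x hx => (hjj x (hY hx)).1
        sle := fun x hx => (hjj x (hY hx)).2.1
        pin2 := fun x hx => (hjj x (hY hx)).2.2.1
        pinr := fun x hx => Dom_pin (hD' x (hs2 (hY hx))) (Finset.mem_filter.1 (hY hx)).2
        dom := fun x hx => (hjj x (hY hx)).2.2.2 })
  have e1 : 2 * ((n:ℝ) + 1) * r / (delP n d * r) = 2 * (n + 1) / delP n d := by field_simp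
  rw [e1] at h2
  have h3 : (r / s) ^ (n - 2) ≤ (max 1 (r / s)) ^ (n - 2) := by
    gcongr; exact le_max_right _ _
  rw [hcard]
  push_cast
  calc (Z1.card : ℝ) + Z2.card ≤ M * (max 1 (r / s)) ^ (n - 2) +
        (2 * (n + 1) / delP n d + 2) ^ n * (facG n κ0 d * M * (max 1 (r / s)) ^ (n - 2)) := by
        refine add_le_add h1 (h2.trans ?_)
        gcongr
    _ = _ := by unfold facP; ring

/-- accumulated constant -/
noncomputable def MM (n : ℕ) (κ0 : ℝ) : ℕ → ℝ
  | 0 => (4 * (n + 1) * κ0 + 2) ^ n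
  | d + 1 => facP n κ0 d * MM n κ0 d

theorem MM_ge (h : 1 ≤ κ0) (d : ℕ) : 1 ≤ MM n κ0 d := by
  induction d with
  | zero =>
    unfold MM
    apply one_le_pow₀
    have : (0:ℝ) ≤ 4 * (n + 1) * κ0 := by positivity
    linarith
  | succ d ih =>
    unfold MM
    exact one_le_mul_of_one_le_of_one_le (facP_ge h d) ih

theorem claim {M0 : ℝ} (g : Good u Ω E M0) {U : Set (En n)} (hU : IsOpen U) (hh : Hm u U)
    (hΩ : Ω ⊆ U) (hs : 0 < s) (hκ : 1 ≤ κ0) (d : ℕ) : Cl u Ω E s κ0 d (MM n κ0 d) := by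
  induction d with
  | zero => exact Cl0 hs hκ
  | succ d ih => exact step g hU hh hΩ hs hκ (MM_ge hκ d) ih

/-- at most exponential growth -/
def EB (f : ℕ → ℝ) : Prop := (∀ d, 0 ≤ f d) ∧ ∃ B : ℝ, 1 ≤ B ∧ ∀ d, f d ≤ B ^ (d+1)

theorem EB.const {a : ℝ} (ha : 0 ≤ a) : EB fun _ => a := by
  refine ⟨fun _ => ha, max 1 a, le_max_left _ _, fun d => ?_⟩
  exact (le_max_right 1 a).trans (le_self_pow₀ (le_max_left _ _) (by omega))

theorem EB.mul {f h : ℕ → ℝ} (hf : EB f) (hg : EB h) : EB fun d => f d * h d := by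
  obtain ⟨f0, B, hB, hfB⟩ := hf
  obtain ⟨g0, B', hB', hgB⟩ := hg
  refine ⟨fun d => mul_nonneg (f0 d) (g0 d), B * B', one_le_mul_of_one_le_of_one_le hB hB', fun d => ?_⟩
  rw [mul_pow]
  exact mul_le_mul (hfB d) (hgB d) (g0 d) (by positivity)

theorem EB.add {f h : ℕ → ℝ} (hf : EB f) (hg : EB h) : EB fun d => f d + h d := by
  obtain ⟨f0, B, hB, hfB⟩ := hf
  obtain ⟨g0, B', hB', hgB⟩ := hg
  refine ⟨fun d => add_nonneg (f0 d) (g0 d), B + B', by linarith, fun d => ?_⟩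
  refine (add_le_add (hfB d) (hgB d)).trans ?_
  exact pow_add_pow_le (by linarith) (by linarith) (by omega)

theorem EB.pow {f : ℕ → ℝ} (hf : EB f) (m : ℕ) : EB fun d => f d ^ m := by
  induction m with
  | zero => simpa using EB.const zero_le_one
  | succ m ih => simp only [pow_succ]; exact ih.mul hf

theorem EB.expo {a : ℝ} (ha : 1 ≤ a) : EB fun d => a ^ (d+1) :=
  ⟨fun d => by positivity, a, ha, fun d => le_rfl⟩

theorem EB.congr {f h : ℕ → ℝ} (hf : EB f) (e : ∀ d, h d = f d) : EB h := by
  have : h = f := funext e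
  rw [this]; exact hf

theorem EB_fac (hκ : 1 ≤ κ0) : EB (facP n κ0) := by
  have i1 : EB fun d => 1 / theP κ0 d :=
    ((EB.const (a := 320 * κ0) (by positivity)).mul (EB.expo (a := 304) (by norm_num))).congr
      (fun d => by simp [theP])
  have i2 : EB fun d => 1 / epsP n d :=
    ((EB.const (a := 8 * (3 * n + 1)) (by positivity)).mul (EB.expo (a := 76) (by norm_num))).congr
      (fun d => by simp [epsP])
  have i3 : EB fun d => 1 / delP n d :=
    ((EB.const (a := 64 * (18 * n + 23) * (3 * n + 1)) (by positivity)).mul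
      (EB.expo (a := 152) (by norm_num))).congr (fun d => by simp [delP])
  have i4 : EB fun d => 1 / c1P d := by
    refine ⟨fun d => by have := c1_pos d; positivity, 160, by norm_num, fun d => ?_⟩
    have e : 1 / c1P d = 80 * (d+1+1 : ℕ) := by unfold c1P; field_simp; norm_num
    change 1 / c1P d ≤ _
    rw [e]
    calc (80:ℝ) * (d+1+1 : ℕ) ≤ 80 ^ (d+1) * 2 ^ (d+1) := by
          have := two_pow_ge d
          have h2 : (80:ℝ) ≤ 80 ^ (d+1) := le_self_pow₀ (by norm_num) (by omega)
          gcongr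
      _ = _ := by rw [← mul_pow]; norm_num
  have cn : ∀ a : ℝ, 0 ≤ a → EB fun _ => a := fun a ha => EB.const ha
  have hn : (0:ℝ) ≤ n := by positivity
  have hG : EB (facG n κ0) := by
    have := ((((cn (32 * (n+1) * (9 * n + 11)) (by positivity)).mul i1).add (cn 2 (by norm_num))).pow n).mul
      (((cn 4 (by norm_num)).mul (i4.mul i1)).pow (n-2))
    have h2 := ((((cn (32 * (n+1) * (18 * n + 23)) (by positivity)).mul i2).add (cn 2 (by norm_num))).pow n).mul
      ((cn 4 (by norm_num)).mul (((cn 4 (by norm_num)).mul i4).pow (n-3)))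
    refine (this.add h2).congr fun d => ?_
    unfold facG
    congr 1
    · congr 2
      · ring
      · have := c1_pos d; have := the_pos hκ d; field_simp
    · congr 2
      · ring
      · congr 1; ring
  refine ((cn 1 zero_le_one).add (((((cn (2 * (n+1)) (by positivity)).mul i3).add
    (cn 2 (by norm_num))).pow n).mul hG)).congr fun d => ?_
  unfold facP
  congr 3
  ring

theorem MM_bound (hκ : 1 ≤ κ0) : ∃ B : ℝ, 1 ≤ B ∧ ∀ d, MM n κ0 d ≤ B ^ ((d+1)^2) := by
  obtain ⟨f0, B, hB, hfB⟩ := EB_fac (n := n) hκ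
  have h0 := MM_ge (n := n) hκ 0
  refine ⟨max B (MM n κ0 0), hB.trans (le_max_left _ _), fun d => ?_⟩
  set A := max B (MM n κ0 0)
  have hA : 1 ≤ A := hB.trans (le_max_left _ _)
  induction d with
  | zero => simp [A]
  | succ d ih =>
    change facP n κ0 d * MM n κ0 d ≤ _
    calc _ ≤ A ^ (d+1) * A ^ ((d+1)^2) := by
          have := MM_ge (n := n) hκ d
          gcongr
          refine (hfB d).trans ?_
          gcongr
          exact le_max_left _ _
      _ = A ^ ((d+1) + (d+1)^2) := (pow_add A (d+1) ((d+1)^2)).symm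
      _ ≤ _ := pow_le_pow_right₀ hA (by nlinarith)

end D5

section E1
variable {n : ℕ} {v : En n → ℝ} {Ω : Set (En n)} {E s : ℝ}

theorem bddG (hs : Sm v) {A : Set (En n)} (hA : Bornology.IsBounded A) :
    BddAbove ((fun x => ‖fderiv ℝ v x‖) '' A) := by
  have hc : Continuous fun x => ‖fderiv ℝ v x‖ := (Sm_fderiv hs).cont.norm
  obtain ⟨R, hR⟩ := hA.subset_closedBall (0 : En n)
  exact ((isCompact_closedBall (0 : En n) R).bddAbove_image hc.continuousOn).mono (image_mono hR)

theorem le_supG (hs : Sm v) {x y : En n} {r : ℝ} (hy : y ∈ ball x r) :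
    ‖fderiv ℝ v y‖ ≤ supGrad v (ball x r) :=
  le_csSup (bddG hs isBounded_ball) (mem_image_of_mem _ hy)

theorem supG_nonneg (A : Set (En n)) : 0 ≤ supGrad v A := by
  apply Real.sSup_nonneg
  rintro _ ⟨y, _, rfl⟩
  exact norm_nonneg _

theorem supG_mono (hs : Sm v) {x : En n} {r r' : ℝ} (h : r ≤ r') :
    supGrad v (ball x r) ≤ supGrad v (ball x r') := by
  apply Real.sSup_le _ (supG_nonneg _)
  rintro _ ⟨y, hy, rfl⟩
  exact le_supG hs (ball_subset_ball h hy)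

theorem start (hn : 0 < n) {M N : ℝ} (g : Good v Ω (CE n) M) {U : Set (En n)} (hU : IsOpen U)
    (hh : Hm v U) {x : En n} (hxΩ : ball x 1 ⊆ Ω) (hxU : ball x 1 ⊆ U)
    (hd : ∀ r : ℝ, 0 < r → r ≤ 1 → doublingIndex v x r ≤ N) {m d : ℕ}
    (hm : CE n * (2 * (2 * (1/2) ^ m)) * 3 ≤ 1) (hdN : m * N ≤ d) :
    Dom v x (2 * (1/2) ^ m) d := by
  have hE := CE_pos (n := n)
  have ht : (0:ℝ) < (1/2) ^ m := by positivity
  set t : ℝ := (1/2) ^ m with htdef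
  have ht1 : t ≤ 1/12 := by nlinarith
  set q : ℝ := CE n * (2 * (2 * t)) with hq
  have hq0 : 0 < q := by positivity
  have hq3 : q ≤ 1/3 := by linarith
  set S : ℝ → ℝ := fun r => supGrad v (ball x r) with hS
  have hβ : ∀ k, be v k x * (2 * t) ^ k ≤ q ^ k * S 1 := by
    intro k
    have h := G2 hn hU g.sm hh x (R := 1/2) (M := S 1) (by norm_num)
      ((closedBall_subset_ball (by norm_num)).trans hxU)
      (fun z hz => le_supG g.sm (closedBall_subset_ball (by norm_num) hz)) k
    rw [bb_eq] at h
    have hk : (0:ℝ) < k.factorial := by positivity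
    have h2 : be v k x ≤ (CE n / (1/2)) ^ k * S 1 := by
      refine le_of_mul_le_mul_right (h.trans_eq ?_) hk
      ring
    calc be v k x * (2 * t) ^ k ≤ (CE n / (1/2)) ^ k * S 1 * (2 * t) ^ k := by gcongr
      _ = (CE n / (1/2) * (2 * t)) ^ k * S 1 := by rw [mul_pow (CE n / (1/2))]; ring
      _ = _ := by congr 2; rw [hq]; ring
  have hS1 : 0 ≤ S 1 := supG_nonneg _
  obtain ⟨k1, hk1, hmax⟩ := (Finset.range (d+1)).exists_max_image (fun k => be v k x * (2 * t) ^ k)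
    ⟨0, by simp⟩
  simp only [Finset.mem_range] at hk1 hmax
  by_contra hno
  have hno1 : ¬ Pin v x (2 * t) k1 := fun h => hno ⟨k1, by omega, h⟩
  unfold Pin at hno1
  push Not at hno1
  obtain ⟨k, hk⟩ := hno1
  have hkd : d + 1 ≤ k := by
    by_contra hc
    exact absurd (hmax k (by omega)) (not_le.2 hk)
  have hqd : ∀ j, d + 1 ≤ j → be v j x * (2 * t) ^ j ≤ q ^ (d+1) * S 1 := by
    intro j hj
    refine (hβ j).trans ?_
    have := pow_le_pow_of_le_one hq0.le (by linarith) hj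
    gcongr
  have hall : ∀ j, be v j x * (2 * t) ^ j ≤ q ^ (d+1) * S 1 := by
    intro j
    rcases Nat.lt_or_ge j (d+1) with hj | hj
    · exact (hmax j hj).trans (hk.le.trans (hqd k hkd))
    · exact hqd j hj
  have hxb : x ∈ Ω := hxΩ (mem_ball_self one_pos)
  have hSt : S t ≤ 2 * (q ^ (d+1) * S 1) := by
    apply Real.sSup_le _ (by positivity)
    rintro _ ⟨y, hy, rfl⟩
    have hyn : ‖y - x‖ < t := by rwa [mem_ball, dist_eq_norm] at hy
    have h := taylor_le g hxb (hxΩ (ball_subset_ball (by linarith) hy)) (r := 2 * t)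
      (H := q ^ (d+1) * S 1) (by positivity) (by nlinarith) (by linarith)
      (fun k => by
        rw [bb_eq, mul_right_comm]
        exact mul_le_mul_of_nonneg_right (hall k) (by positivity)) 0
    simp only [Nat.factorial_zero, Nat.cast_one, mul_one, pow_zero, div_one, zero_add, pow_one] at h
    refine le_trans h ?_
    rw [mul_comm 2 (q ^ (d+1) * S 1)]
    refine mul_le_mul_of_nonneg_left ?_ (by positivity)
    have h2 : ‖y - x‖ / (2 * t) ≤ 1/2 := by
      rw [div_le_iff₀ (by positivity)]; linarith
    have h3 := inv_anti₀ (by norm_num) (show (1/2:ℝ) ≤ 1 - ‖y - x‖ / (2 * t) by linarith)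
    norm_num at h3
    exact h3
  have hbk : 0 < be v k x := by
    have : 0 < be v k x * (2 * t) ^ k :=
      lt_of_le_of_lt (mul_nonneg (be_nonneg k1 x) (by positivity)) hk
    exact pos_of_mul_pos_left this (by positivity)
  rcases (supG_nonneg (v := v) (ball x t)).eq_or_lt with h0 | hpos
  · have h := G2 hn hU g.sm hh x (R := t/2) (M := 0) (by positivity)
      ((closedBall_subset_ball (by linarith)).trans hxU)
      (fun z hz => (le_supG g.sm (closedBall_subset_ball (by linarith) hz)).trans_eq h0.symm) k
    rw [bb_eq, mul_zero] at h
    have : 0 < be v k x * k.factorial := by positivity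
    linarith
  · have hch : ∀ i ≤ m, S ((1/2) ^ (m - i) : ℝ) ≤ Real.exp (i * N) * S t := by
      intro i
      induction i with
      | zero => intro _; simp [htdef]
      | succ i ih =>
        intro hi
        have h1 := ih (by omega)
        set r : ℝ := (1/2) ^ (m - i) with hr
        have hr0 : 0 < r := by positivity
        have hr1 : r ≤ 1 := pow_le_one₀ (by norm_num) (by norm_num)
        have e : ((1/2) ^ (m - (i+1)) : ℝ) = 2 * r := by
          rw [hr, show m - i = (m - (i+1)) + 1 by omega, pow_succ]; ring
        have htr : t ≤ r := pow_le_pow_of_le_one (by norm_num) (by norm_num) (by omega)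
        have hSr : 0 < S r := lt_of_lt_of_le hpos (supG_mono g.sm htr)
        have hS2r : 0 < S (2 * r) := lt_of_lt_of_le hSr (supG_mono g.sm (by linarith))
        have h2 := hd r hr0 hr1
        unfold doublingIndex at h2
        change Real.log (S (2 * r) / S r) ≤ N at h2
        rw [Real.log_le_iff_le_exp (by positivity), div_le_iff₀ hSr] at h2
        rw [e]
        calc S (2 * r) ≤ Real.exp N * (Real.exp (i * N) * S t) := h2.trans (by gcongr)
          _ = Real.exp (((i+1 : ℕ) : ℝ) * N) * S t := by
            rw [← mul_assoc, ← Real.exp_add]; congr 2; push_cast; ring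
    have h1 := hch m le_rfl
    simp only [Nat.sub_self, pow_zero] at h1
    have hS1p : 0 < S 1 := lt_of_lt_of_le hpos (supG_mono g.sm (by linarith))
    have h2 : Real.exp (m * N) ≤ 3 ^ d := by
      calc Real.exp (m * N) ≤ Real.exp (d * 1) := Real.exp_le_exp.2 (by linarith)
        _ = Real.exp 1 ^ d := by rw [Real.exp_nat_mul]
        _ ≤ 3 ^ d := by
          have := Real.exp_one_lt_d9
          gcongr
          linarith
    have h3 : S 1 ≤ 3 ^ d * (2 * ((1/3) ^ (d+1) * S 1)) := by
      refine h1.trans ?_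
      calc _ ≤ Real.exp (m * N) * (2 * (q ^ (d+1) * S 1)) := by gcongr
        _ ≤ _ := by gcongr
    have h4 : (3:ℝ) ^ d * (2 * ((1/3) ^ (d+1) * S 1)) = 2/3 * S 1 := by
      rw [pow_succ, one_div, inv_pow]; field_simp
    linarith

theorem norm_le_coord {z : En n} {a : ℝ} (ha : 0 ≤ a) (h : ∀ i, |z i| ≤ a) : ‖z‖ ≤ n * a := by
  have h1 : ‖z‖ ^ 2 ≤ (n * a) ^ 2 := by
    rw [EuclideanSpace.norm_sq_eq]
    calc ∑ i, ‖z i‖ ^ 2 ≤ ∑ _i : Fin n, a ^ 2 := by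
          gcongr with i
          rw [Real.norm_eq_abs]; exact h i
      _ = n * a ^ 2 := by simp
      _ ≤ (n * a) ^ 2 := by
        rw [mul_pow]
        gcongr
        rcases Nat.eq_zero_or_pos n with rfl | hn
        · simp
        · have : (1:ℝ) ≤ n := by exact_mod_cast hn
          nlinarith
  exact le_of_sq_le_sq h1 (by positivity)

theorem good_cube (hn : 0 < n) {M : ℝ} (g : Good v Ω E M) {x : En n} (hs : 0 < s)
    (hx : cube x (2 * s) ⊆ Ω) (hsE : (4 * n * s) * (2 * E) ≤ 1) (hp : Pin v x (4 * n * s) 0) :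
    ¬ (sInf ((fun y => ‖fderiv ℝ v y‖) '' cube x s) < 1/2 * supGrad v (cube x (2 * s))) := by
  have hn1 : (1:ℝ) ≤ n := by exact_mod_cast hn
  have hxc : ∀ r, 0 ≤ r → x ∈ cube x r := fun r hr i => by simp; linarith
  have hsub : cube x s ⊆ cube x (2 * s) := fun y hy i => (hy i).trans (by linarith)
  have hb0 : 0 ≤ bb v 0 x := bb_nonneg v 0 x
  have key : ∀ y ∈ cube x (2 * s), ‖fderiv ℝ v y - fderiv ℝ v x‖ ≤ bb v 0 x / 3 := by
    intro y hy
    have hyn : ‖y - x‖ ≤ n * s := norm_le_coord hs.le fun i => by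
      have := hy i
      simpa using this
    have hlt : ‖y - x‖ < 4 * n * s := by nlinarith [mul_pos (zero_lt_one.trans_le hn1) hs]
    have h := taylor g (hx (hxc _ (by positivity))) (hx hy) (r := 4 * n * s)
      (H := be v 0 x * (4 * n * s) ^ 0) (by positivity) hsE hlt hp.H 0
    simp only [Nat.factorial_zero, Nat.cast_one, mul_one, pow_zero, div_one, zero_add, pow_one,
      be_zero] at h
    refine le_trans h ?_
    rw [div_eq_mul_inv (bb v 0 x)]
    refine mul_le_mul_of_nonneg_left ?_ hb0
    have h2 : ‖y - x‖ / (4 * n * s) ≤ 1/4 := by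
      rw [div_le_iff₀ (by positivity)]; linarith
    have h3 := inv_anti₀ (by norm_num) (show (3/4:ℝ) ≤ 1 - ‖y - x‖ / (4 * n * s) by linarith)
    norm_num at h3
    linarith
  have hx1 : ‖fderiv ℝ v x‖ = bb v 0 x := rfl
  have h1 : 2/3 * bb v 0 x ≤ sInf ((fun y => ‖fderiv ℝ v y‖) '' cube x s) := by
    apply le_csInf (Nonempty.image _ ⟨x, hxc _ hs.le⟩)
    rintro _ ⟨y, hy, rfl⟩
    have := key y (hsub hy)
    have h3 := norm_sub_norm_le (fderiv ℝ v x) (fderiv ℝ v y)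
    rw [norm_sub_rev] at h3
    simp only
    linarith
  have h2 : supGrad v (cube x (2 * s)) ≤ 4/3 * bb v 0 x := by
    apply csSup_le (Nonempty.image _ ⟨x, hxc _ (by positivity)⟩)
    rintro _ ⟨y, hy, rfl⟩
    have := key y hy
    have h3 := norm_sub_norm_le (fderiv ℝ v y) (fderiv ℝ v x)
    simp only
    linarith
  linarith

theorem sub_app (K : ℕ) (k : Fin n → Fin K) (i : Fin n) :
    (subCenter (0 : En n) 1 K k) i = ((k i : ℝ) + 1 / 2) / K - 1 / 2 := by
  simp [subCenter, _root_.vec]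

theorem sub_bd {K : ℕ} (hK : 2 ≤ K) (k : Fin n → Fin K) (i : Fin n) :
    |(subCenter (0 : En n) 1 K k) i| ≤ 1/2 - 1/(2 * K) := by
  have hK' : (2:ℝ) ≤ K := by exact_mod_cast hK
  have h1 : ((k i : ℕ) : ℝ) + 1 ≤ K := by exact_mod_cast (k i).2
  have h0 : (0:ℝ) ≤ ((k i : ℕ) : ℝ) := by positivity
  rw [sub_app, abs_le]
  constructor
  · have : 1/(2 * (K:ℝ)) ≤ (((k i : ℕ) : ℝ) + 1/2)/K := by
      rw [div_le_div_iff₀ (by positivity) (by positivity)]; nlinarith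
    linarith
  · have : (((k i : ℕ) : ℝ) + 1/2)/K + 1/(2 * (K:ℝ)) ≤ 1 := by
      have : (((k i : ℕ) : ℝ) + 1/2)/K + 1/(2 * (K:ℝ)) = (((k i : ℕ) : ℝ) + 1)/K := by
        field_simp; ring
      rw [this, div_le_one (by positivity)]; exact h1
    linarith

theorem sub_sep {K : ℕ} (hK : 2 ≤ K) {k k' : Fin n → Fin K} (h : k ≠ k') :
    (1:ℝ)/K ≤ ‖subCenter (0 : En n) 1 K k - subCenter 0 1 K k'‖ := by
  have hK' : (2:ℝ) ≤ K := by exact_mod_cast hK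
  obtain ⟨i, hi⟩ := Function.ne_iff.1 h
  have h1 := PiLp.norm_apply_le (subCenter (0 : En n) 1 K k - subCenter 0 1 K k') i
  refine le_trans ?_ h1
  rw [Real.norm_eq_abs, PiLp.sub_apply, sub_app, sub_app]
  have e : (((k i : ℕ) : ℝ) + 1/2)/K - 1/2 - ((((k' i : ℕ) : ℝ) + 1/2)/K - 1/2) =
    (((k i : ℕ) : ℝ) - ((k' i : ℕ) : ℝ))/K := by ring
  rw [e, abs_div, abs_of_pos (show (0:ℝ) < K by positivity)]
  gcongr
  have h3 : ((k i : ℕ) : ℤ) - ((k' i : ℕ) : ℤ) ≠ 0 := by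
    intro h4; apply hi; apply Fin.ext; omega
  have h5 := Int.one_le_abs h3
  exact_mod_cast h5

end E1

section E2
variable {n : ℕ}

theorem cube_norm {x : En n} {ℓ : ℝ} (hℓ : 0 ≤ ℓ) (h : x ∈ cube (0 : En n) ℓ) : ‖x‖ ≤ n * (ℓ / 2) :=
  norm_le_coord (by positivity) fun i => by simpa using h i

theorem subC_mem {K : ℕ} (hK : 2 ≤ K) (k : Fin n → Fin K) :
    subCenter (0 : En n) 1 K k ∈ cube (0 : En n) 1 := fun i => by
  have := sub_bd hK k i
  have h : (0:ℝ) ≤ 1 / (2 * K) := by positivity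
  simp only [PiLp.zero_apply, sub_zero]
  linarith

theorem sub_cube {K : ℕ} (hK : 2 ≤ K) (k : Fin n → Fin K) {y : En n}
    (hy : y ∈ cube (subCenter (0 : En n) 1 K k) (2 / K)) : ‖y‖ ≤ n := by
  have hK' : (2:ℝ) ≤ K := by exact_mod_cast hK
  have : ‖y‖ ≤ n * 1 := norm_le_coord zero_le_one fun i => by
    have h1 := sub_bd hK k i
    have h2 := hy i
    have h3 : (2 / (K:ℝ)) / 2 ≤ 1/2 := by
      rw [div_div, div_le_div_iff₀ (by positivity) (by norm_num)]; linarith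
    have h : (0:ℝ) ≤ 1 / (2 * K) := by positivity
    have h4 := abs_add_le (y i - subCenter (0 : En n) 1 K k i) (subCenter (0 : En n) 1 K k i)
    rw [sub_add_cancel] at h4
    linarith
  linarith

theorem main_v (hn : 2 ≤ n) : ∃ C : ℝ, 1 < C ∧ ∀ (v : En n → ℝ) (N : ℝ), 1 ≤ N → Sm v →
    Hm v (ball 0 (50 * n)) →
    (∀ x ∈ cube (0 : En n) 1, ∀ r : ℝ, 0 < r → r ≤ 1 → doublingIndex v x r ≤ N) →
    ∀ K : ℕ, 2 ≤ K →
      (Set.ncard {k : Fin n → Fin K |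
        sInf ((fun y => ‖fderiv ℝ v y‖) '' cube (subCenter 0 1 K k) ((1 : ℝ) / K)) <
          1/2 * supGrad v (cube (subCenter 0 1 K k) (2 / K))} : ℝ) ≤
        C ^ (N ^ 2) * (K : ℝ) ^ (n - 2) := by
  have hn0 : 0 < n := by omega
  have hn2 : (2:ℝ) ≤ n := by exact_mod_cast hn
  have hE := CE_pos (n := n)
  have hκ : (1:ℝ) ≤ 4 * n := by linarith
  obtain ⟨B, hB, hMB⟩ := MM_bound (n := n) hκ
  obtain ⟨m, hm⟩ : ∃ m : ℕ, CE n * (2 * (2 * (1/2) ^ m)) * 3 ≤ 1 := by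
    obtain ⟨m, hm⟩ := exists_pow_lt_of_lt_one (show (0:ℝ) < 1 / (12 * CE n) by positivity)
      (show (1/2:ℝ) < 1 by norm_num)
    refine ⟨m, ?_⟩
    rw [lt_div_iff₀ (by positivity)] at hm
    linarith
  have hT0 : (0:ℝ) < 2 * (1/2) ^ m := by positivity
  set T : ℝ := 2 * (1/2) ^ m with hT
  have hT1 : T ≤ 1 := by nlinarith
  set P : ℝ := (2 * (n + 1) * n / T + 2) ^ n with hP
  have hP0 : 0 ≤ P := by positivity
  set A : ℝ := P + (8 * n * CE n) ^ 2 + 2 with hA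
  have hA2 : 2 ≤ A := by have : 0 ≤ (8 * n * CE n) ^ 2 := by positivity
                         linarith
  have hBm : 1 ≤ B ^ ((m+2)^2) := one_le_pow₀ hB
  refine ⟨A * B ^ ((m+2)^2), by nlinarith, ?_⟩
  intro v N hN hs hh hd K hK
  have hK' : (2:ℝ) ≤ K := by exact_mod_cast hK
  have hN2 : 1 ≤ N ^ 2 := one_le_pow₀ hN
  have hCN : A * (B ^ ((m+2)^2)) ^ (N^2) ≤ (A * B ^ ((m+2)^2)) ^ (N ^ 2) := by
    rw [Real.mul_rpow (by positivity) (by positivity)]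
    gcongr
    exact Real.self_le_rpow_of_one_le (by linarith) hN2
  have hBN : 1 ≤ (B ^ ((m+2)^2)) ^ (N^2) := Real.one_le_rpow hBm (by positivity)
  set W := {k : Fin n → Fin K |
        sInf ((fun y => ‖fderiv ℝ v y‖) '' cube (subCenter 0 1 K k) ((1 : ℝ) / K)) <
          1/2 * supGrad v (cube (subCenter 0 1 K k) (2 / K))} with hW
  by_cases hsmall : (4 * n * (1 / K : ℝ)) * (2 * CE n) ≤ 1
  swap
  · push Not at hsmall
    have hKb : (K:ℝ) ≤ 8 * n * CE n := by
      have e : (4 * n * (1 / K : ℝ)) * (2 * CE n) = (8 * n * CE n) / K := by ring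
      rw [e, lt_div_iff₀ (by positivity)] at hsmall
      linarith
    have h1 : W.ncard ≤ K ^ n := by
      have := Set.ncard_le_encard (s := W)
      calc W.ncard ≤ (Set.univ : Set (Fin n → Fin K)).ncard :=
            Set.ncard_le_ncard (Set.subset_univ _) (Set.toFinite _)
        _ = K ^ n := by rw [Set.ncard_univ]; simp
    calc (W.ncard : ℝ) ≤ (K:ℝ) ^ n := by exact_mod_cast h1
      _ = (K:ℝ) ^ 2 * (K:ℝ) ^ (n-2) := by rw [← pow_add]; congr 1; omega
      _ ≤ (8 * n * CE n) ^ 2 * (K:ℝ) ^ (n-2) := by gcongr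
      _ ≤ A * (K:ℝ) ^ (n-2) := by gcongr; linarith
      _ ≤ _ := by
        gcongr
        refine le_trans ?_ hCN
        nlinarith
  · set Ω : Set (En n) := ball 0 (2 * n) with hΩ
    have hΩU : Ω ⊆ ball 0 (50 * n) := ball_subset_ball (by linarith)
    obtain ⟨M, hMb⟩ := bddG hs (isBounded_ball (x := (0 : En n)) (r := 2 * n + 2))
    have hM : ∀ z : En n, ‖z‖ < 2 * n + 2 → ‖fderiv ℝ v z‖ ≤ M := fun z hz =>
      hMb (mem_image_of_mem _ (by simpa using hz))
    have g : Good v Ω (CE n) M := by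
      refine ⟨hs, convex_ball _ _, hE, (norm_nonneg _).trans (hM 0 (by simp; linarith)), ?_⟩
      intro k y hy
      have hyn : ‖y‖ < 2 * n := by simpa [hΩ] using hy
      have hz : ∀ z ∈ closedBall y 1, ‖z‖ < 2 * n + 2 := by
        intro z hz
        rw [mem_closedBall, dist_eq_norm] at hz
        have := norm_add_le (z - y) y
        rw [sub_add_cancel] at this
        linarith
      have := G2 hn0 isOpen_ball hs hh y one_pos
        (fun z h => by rw [mem_ball_zero_iff]; linarith [hz z h]) (fun z h => hM z (hz z h)) k
      simpa using this
    have hb1 : ∀ x ∈ cube (0 : En n) 1, ball x 1 ⊆ Ω := by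
      intro x hx y hy
      have h1 := cube_norm zero_le_one hx
      rw [mem_ball, dist_eq_norm] at hy
      have := norm_add_le (y - x) x
      rw [sub_add_cancel] at this
      rw [hΩ, mem_ball_zero_iff]
      linarith
    set d := ⌈m * N⌉₊ with hdd
    have hdN : m * N ≤ d := Nat.le_ceil _
    have hd1 : (d:ℝ) < m * N + 1 := Nat.ceil_lt_add_one (by positivity)
    classical
    set Z : Finset (En n) := W.toFinset.image (fun k => subCenter (0 : En n) 1 K k) with hZ
    have hinj : Function.Injective (fun k : Fin n → Fin K => subCenter (0 : En n) 1 K k) := by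
      intro k k' h
      by_contra hne
      have := sub_sep (n := n) hK hne
      simp only at h
      rw [h, sub_self, norm_zero] at this
      have : (0:ℝ) < 1 / K := by positivity
      linarith
    have hcard : (W.ncard : ℝ) = Z.card := by
      rw [hZ, Finset.card_image_of_injective _ hinj, Set.ncard_eq_toFinset_card']
    have hZm : ∀ x ∈ Z, ∃ k ∈ W, subCenter (0 : En n) 1 K k = x := by
      intro x hx
      simpa [hZ] using hx
    have hadm : Adm v Ω (1 / K : ℝ) (4 * n) Z := by
      refine ⟨?_, ?_, ?_⟩
      · intro x hx
        obtain ⟨k, _, rfl⟩ := hZm x hx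
        exact hb1 _ (subC_mem hK k) (mem_ball_self one_pos)
      · intro x hx y hy hxy
        obtain ⟨k, _, rfl⟩ := hZm x hx
        obtain ⟨k', _, rfl⟩ := hZm y hy
        exact sub_sep hK fun h => hxy (by rw [h])
      · intro x hx hp
        obtain ⟨k, hk, rfl⟩ := hZm x hx
        have e : (2:ℝ) / K = 2 * (1 / K) := by ring
        refine good_cube hn0 g (s := (1 / K : ℝ)) (by positivity) ?_ hsmall hp ?_
        · intro y hy
          rw [← e] at hy
          have := sub_cube hK k hy
          rw [hΩ, mem_ball_zero_iff]
          linarith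
        · rw [← e]; exact hk
    have hdiam : ∀ x ∈ Z, ∀ y ∈ Z, ‖x - y‖ ≤ (n:ℝ) := by
      intro x hx y hy
      obtain ⟨k, _, rfl⟩ := hZm x hx
      obtain ⟨k', _, rfl⟩ := hZm y hy
      have h1 := cube_norm zero_le_one (subC_mem hK k)
      have h2 := cube_norm zero_le_one (subC_mem hK k')
      have := norm_sub_le (subCenter (0 : En n) 1 K k) (subCenter 0 1 K k')
      linarith
    have hMM := MM_ge (n := n) hκ d
    have h1 := cov (by linarith) (claim g isOpen_ball hh hΩU (s := (1 / K : ℝ)) (by positivity) hκ d)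
      hadm (D := n) (ℓ := T) (by positivity) hT0 (by linarith) hdiam
      (fun _ x hx => by
        obtain ⟨k, _, rfl⟩ := hZm x hx
        have hx1 := subC_mem (n := n) hK k
        exact start hn0 g isOpen_ball hh (hb1 _ hx1) ((hb1 _ hx1).trans hΩU) (hd _ hx1) hm hdN)
    rw [hcard]
    have hB2 : MM n (4 * n) d ≤ (B ^ ((m+2)^2)) ^ (N^2) := by
      refine (hMB d).trans ?_
      rw [← Real.rpow_natCast B ((m+2)^2), ← Real.rpow_natCast B ((d+1)^2),
        ← Real.rpow_mul (by linarith)]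
      apply Real.rpow_le_rpow_of_exponent_le hB
      push_cast
      rw [← mul_pow]
      have : (0:ℝ) ≤ m := by positivity
      gcongr
      nlinarith
    have hmx : max 1 (T / (1 / K : ℝ)) ≤ K := by
      apply max_le (by linarith)
      rw [div_div_eq_mul_div, div_one]
      nlinarith
    calc (Z.card : ℝ) ≤ P * (MM n (4 * n) d * (max 1 (T / (1 / K : ℝ))) ^ (n - 2)) := h1
      _ ≤ P * ((B ^ ((m+2)^2)) ^ (N^2) * (K:ℝ) ^ (n-2)) := by gcongr
      _ = P * (B ^ ((m+2)^2)) ^ (N^2) * (K:ℝ) ^ (n-2) := by ring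
      _ ≤ A * (B ^ ((m+2)^2)) ^ (N^2) * (K:ℝ) ^ (n-2) := by
        gcongr
        have : 0 ≤ (8 * n * CE n) ^ 2 := by positivity
        linarith
      _ ≤ _ := by gcongr

theorem cutoff (hn : 0 < n) {u : En n → ℝ} (hu : ContDiffOn ℝ (⊤ : ℕ∞) u (ball 0 (100 * n))) :
    ∃ v : En n → ℝ, Sm v ∧ ∀ x ∈ ball (0 : En n) (60 * n), v x = u x := by
  have hn' : (0:ℝ) < n := by exact_mod_cast hn
  let f : ContDiffBump (0 : En n) := ⟨60 * n, 70 * n, by positivity, by linarith⟩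
  refine ⟨fun x => f x * u x, ?_, ?_⟩
  · refine contDiff_iff_contDiffAt.2 fun x => ?_
    by_cases hx : x ∈ ball (0 : En n) (100 * n)
    · exact f.contDiff.contDiffAt.mul (hu.contDiffAt (isOpen_ball.mem_nhds hx))
    · have h : x ∈ (closedBall (0 : En n) (70 * n))ᶜ := fun h =>
        hx (closedBall_subset_ball (by linarith) h)
      have : (fun x => f x * u x) =ᶠ[nhds x] fun _ => 0 := by
        filter_upwards [isClosed_closedBall.isOpen_compl.mem_nhds h] with y hy
        have : 70 * (n:ℝ) ≤ dist y 0 := by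
          rw [mem_compl_iff, mem_closedBall, not_le] at hy
          exact hy.le
        rw [f.zero_of_le_dist this, zero_mul]
      exact contDiffAt_const.congr_of_eventuallyEq this
  · intro x hx
    have : f x = 1 := f.one_of_mem_closedBall (ball_subset_closedBall hx)
    simp only [this, one_mul]

theorem reduce (hn : 0 < n) {u : En n → ℝ} (hu : IsHarmonicOn u (ball 0 (100 * n))) :
    ∃ v : En n → ℝ, Sm v ∧ Hm v (ball 0 (50 * n)) ∧
      ∀ x ∈ ball (0 : En n) (50 * n), fderiv ℝ u x = fderiv ℝ v x := by
  have hn' : (0:ℝ) < n := by exact_mod_cast hn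
  obtain ⟨v, hs, hv⟩ := cutoff hn hu.1
  have hev : ∀ x ∈ ball (0 : En n) (60 * n), u =ᶠ[nhds x] v := fun x hx => by
    filter_upwards [isOpen_ball.mem_nhds hx] with y hy using (hv y hy).symm
  have hsub : ball (0 : En n) (50 * n) ⊆ ball 0 (60 * n) := ball_subset_ball (by linarith)
  have hsub2 : ball (0 : En n) (50 * n) ⊆ ball 0 (100 * n) := ball_subset_ball (by linarith)
  refine ⟨v, hs, fun x hx => ?_, fun x hx => (hev x (hsub hx)).fderiv_eq⟩
  rw [← hu.2 x (hsub2 hx)]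
  refine Finset.sum_congr rfl fun i _ => ?_
  have : Dd (eb i) v =ᶠ[nhds x] (fun y => fderiv ℝ u y (EuclideanSpace.single i 1)) := by
    filter_upwards [isOpen_ball.mem_nhds (hsub hx)] with y hy
    rw [(hev y hy).fderiv_eq]; rfl
  change fderiv ℝ (Dd (eb i) v) x (EuclideanSpace.single i 1) = _
  rw [this.fderiv_eq]

theorem supGrad_congr {u v : En n → ℝ} {A : Set (En n)}
    (h : ∀ x ∈ A, fderiv ℝ u x = fderiv ℝ v x) : supGrad u A = supGrad v A := by
  unfold supGrad
  rw [image_congr fun x hx => by rw [h x hx]]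

theorem transfer (hn : 0 < n) {u v : En n → ℝ}
    (h : ∀ x ∈ ball (0 : En n) (50 * n), fderiv ℝ u x = fderiv ℝ v x) {K : ℕ} (hK : 2 ≤ K) :
    {k : Fin n → Fin K |
        sInf ((fun y => ‖fderiv ℝ u y‖) '' cube (subCenter 0 1 K k) ((1 : ℝ) / K)) <
          1/2 * supGrad u (cube (subCenter 0 1 K k) (2 / K))} =
    {k : Fin n → Fin K |
        sInf ((fun y => ‖fderiv ℝ v y‖) '' cube (subCenter 0 1 K k) ((1 : ℝ) / K)) <
          1/2 * supGrad v (cube (subCenter 0 1 K k) (2 / K))} := by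
  have hn' : (0:ℝ) < n := by exact_mod_cast hn
  ext k
  have h1 : ∀ x ∈ cube (subCenter (0 : En n) 1 K k) (2 / K), fderiv ℝ u x = fderiv ℝ v x :=
    fun x hx => h x (by rw [mem_ball_zero_iff]; linarith [sub_cube hK k hx])
  have h2 : ∀ x ∈ cube (subCenter (0 : En n) 1 K k) (1 / K), fderiv ℝ u x = fderiv ℝ v x :=
    fun x hx => h1 x fun i => (hx i).trans (by gcongr; norm_num)
  have h3 : (fun y => ‖fderiv ℝ u y‖) '' cube (subCenter (0 : En n) 1 K k) ((1 : ℝ) / K) =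
      (fun y => ‖fderiv ℝ v y‖) '' cube (subCenter 0 1 K k) ((1 : ℝ) / K) :=
    image_congr fun x hx => by rw [h2 x hx]
  rw [mem_setOf_eq, mem_setOf_eq, supGrad_congr h1, h3]

theorem const_empty {v : En n → ℝ} {L : En n →L[ℝ] ℝ} {K : ℕ} (hK : 2 ≤ K)
    (h : ∀ x : En n, ‖x‖ ≤ n → fderiv ℝ v x = L) :
    {k : Fin n → Fin K |
        sInf ((fun y => ‖fderiv ℝ v y‖) '' cube (subCenter 0 1 K k) ((1 : ℝ) / K)) <
          1/2 * supGrad v (cube (subCenter 0 1 K k) (2 / K))} = ∅ := by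
  ext k
  simp only [mem_setOf_eq, mem_empty_iff_false, iff_false, not_lt]
  have hsub : cube (subCenter (0 : En n) 1 K k) (1 / K) ⊆ cube (subCenter (0 : En n) 1 K k) (2 / K) :=
    fun x hx i => (hx i).trans (by gcongr; norm_num)
  have hne : (cube (subCenter (0 : En n) 1 K k) (1 / K)).Nonempty :=
    ⟨subCenter (0 : En n) 1 K k, fun i => by simp; positivity⟩
  have h1 : ‖L‖ ≤ sInf ((fun y => ‖fderiv ℝ v y‖) '' cube (subCenter (0 : En n) 1 K k) ((1 : ℝ) / K)) := by
    apply le_csInf (hne.image _)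
    rintro _ ⟨y, hy, rfl⟩
    simp only [h y (sub_cube hK k (hsub hy)), le_refl]
  have h2 : supGrad v (cube (subCenter (0 : En n) 1 K k) (2 / K)) ≤ ‖L‖ := by
    apply csSup_le ((hne.mono hsub).image _)
    rintro _ ⟨y, hy, rfl⟩
    simp only [h y (sub_cube hK k hy), le_refl]
  linarith [norm_nonneg L]

end E2

/-- **Counting subcubes with small gradient.** There are `c > 0` and `C > 1` depending only
on `n` such that: if `u` is harmonic on a large neighborhood of the unit cube `Q` with the
doubling index of `∇u` bounded by `N ≥ 1` on `Q`, and `Q` is subdivided into `Kⁿ` congruent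
subcubes, then the number of subcubes `q` with `inf_q |∇u| < c sup_{2q} |∇u|` is at most
`C^{N²} K^{n-2}`. -/
theorem count_small_gradient_cubes (n : ℕ) :
    ∃ c C : ℝ, 0 < c ∧ 1 < C ∧
      ∀ (u : EuclideanSpace ℝ (Fin n) → ℝ) (N : ℝ), 1 ≤ N →
        IsHarmonicOn u (ball 0 (100 * n)) →
        (∀ x ∈ cube (0 : EuclideanSpace ℝ (Fin n)) 1, ∀ r : ℝ, 0 < r → r ≤ 1 →
          doublingIndex u x r ≤ N) →
        ∀ K : ℕ, 2 ≤ K →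
          (Set.ncard {k : Fin n → Fin K |
              sInf ((fun y => ‖fderiv ℝ u y‖) '' cube (subCenter 0 1 K k) ((1 : ℝ) / K)) <
                c * supGrad u (cube (subCenter 0 1 K k) (2 / K))} : ℝ) ≤
            C ^ (N ^ 2) * (K : ℝ) ^ ((n : ℝ) - 2) := by
  rcases Nat.lt_or_ge n 2 with hn | hn
  · refine ⟨1/2, 2, by norm_num, by norm_num, ?_⟩
    intro u N hN hu hd K hK
    have key : ∃ (v : En n → ℝ) (L : En n →L[ℝ] ℝ), (∀ x : En n, ‖x‖ ≤ n → fderiv ℝ v x = L) ∧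
        ({k : Fin n → Fin K |
          sInf ((fun y => ‖fderiv ℝ u y‖) '' cube (subCenter 0 1 K k) ((1 : ℝ) / K)) <
          1/2 * supGrad u (cube (subCenter 0 1 K k) (2 / K))} =
        {k : Fin n → Fin K |
          sInf ((fun y => ‖fderiv ℝ v y‖) '' cube (subCenter 0 1 K k) ((1 : ℝ) / K)) <
          1/2 * supGrad v (cube (subCenter 0 1 K k) (2 / K))}) := by
      interval_cases n
      · exact ⟨u, 0, fun x _ => Subsingleton.elim _ _, rfl⟩
      · obtain ⟨v, hs, hh, he⟩ := reduce one_pos hu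
        refine ⟨v, fderiv ℝ v 0, ?_, transfer one_pos he hK⟩
        have hz : EqOn (fderiv ℝ (fderiv ℝ v)) 0 (ball (0 : En 1) (50 * (1:ℕ))) := by
          intro x hx
          have h := hh x hx
          rw [Fin.sum_univ_one, Dd_fderiv hs] at h
          have hb : ∀ w : En 1, w = w 0 • eb (0 : Fin 1) := by
            intro w; ext i
            have : i = 0 := Subsingleton.elim _ _
            subst this
            simp [eb]
          ext w z
          rw [hb w, hb z]
          simp [h]
        intro x hx
        refine isOpen_ball.is_const_of_fderiv_eq_zero (convex_ball (0 : En 1) _).isPreconnected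
          (Sm_fderiv hs).diff.differentiableOn hz ?_ ?_
        · rw [mem_ball_zero_iff]; push_cast at hx ⊢; linarith
        · simp
    obtain ⟨v, L, hL, hv⟩ := key
    rw [hv, const_empty hK hL]
    simp only [Set.ncard_empty, Nat.cast_zero]
    positivity
  · obtain ⟨C, hC, h⟩ := main_v hn
    have hn0 : 0 < n := by omega
    have hn2 : (2:ℝ) ≤ n := by exact_mod_cast hn
    refine ⟨1/2, C, by norm_num, hC, ?_⟩
    intro u N hN hu hd K hK
    obtain ⟨v, hs, hh, he⟩ := reduce hn0 hu
    have e : ((K:ℝ)) ^ ((n:ℝ) - 2) = (K:ℝ) ^ (n-2) := by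
      rw [← Real.rpow_natCast]; congr 1; push_cast [Nat.cast_sub hn]; ring
    rw [transfer hn0 he hK, e]
    refine h v N hN hs hh ?_ K hK
    intro x hx r hr hr1
    have hb : ∀ ρ ≤ 2, ∀ y ∈ ball x ρ, fderiv ℝ u y = fderiv ℝ v y := by
      intro ρ hρ y hy
      apply he
      have h1 := cube_norm zero_le_one hx
      rw [mem_ball, dist_eq_norm] at hy
      have := norm_add_le (y - x) x
      rw [sub_add_cancel] at this
      rw [mem_ball_zero_iff]
      linarith
    have := hd x hx r hr hr1
    unfold doublingIndex at this ⊢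
    rwa [supGrad_congr (hb (2 * r) (by linarith)), supGrad_congr (hb r (by linarith))] at this
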